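/- arXiv:1611.07506 — 5 statements merged into one kernel-verified Lean document; each statement's English description precedes it below -/
import Mathlib

section
/- Let k be a field, R = k[x_1,...,x_n] with n ≥ 2, and I an ideal of R. For any projective resolution ... → P_{n-1} → P_{n-2} → ... → P_0 → I → 0 of I by finitely generated projective R-modules, the (n-2)-th syzygy module K_{n-2} = ker(P_{n-2} → P_{n-3}) is a free R-module. -/
namespace QS
open Polynomial Matrix

/-- column vectors related by an invertible matrix -/
def Sim {m : ℕ} {R : Type*} [CommRing R] (f g : Fin m → R) : Prop :=
  ∃ M N : Matrix (Fin m) (Fin m) R, N * M = 1 ∧ M *ᵥ f = g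

section sim
variable {m : ℕ} {R S : Type*} [CommRing R] [CommRing S]

theorem Sim.refl (f : Fin m → R) : Sim f f := ⟨1, 1, by simp, by simp⟩

theorem Sim.symm {f g : Fin m → R} (h : Sim f g) : Sim g f := by
  obtain ⟨M, N, h1, h2⟩ := h
  refine ⟨N, M, mul_eq_one_comm.mp h1, ?_⟩
  rw [← h2, mulVec_mulVec, h1, one_mulVec]

theorem Sim.trans {f g h : Fin m → R} (h1 : Sim f g) (h2 : Sim g h) : Sim f h := by
  obtain ⟨M, N, a, b⟩ := h1
  obtain ⟨M', N', a', b'⟩ := h2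
  refine ⟨M' * M, N * N', ?_, ?_⟩
  · calc N * N' * (M' * M) = N * (N' * M') * M := by simp only [Matrix.mul_assoc]
      _ = 1 := by rw [a', Matrix.mul_one, a]
  · rw [← mulVec_mulVec, b, b']

theorem Sim.map {f g : Fin m → R} (φ : R →+* S) (h : Sim f g) :
    Sim (fun i => φ (f i)) (fun i => φ (g i)) := by
  obtain ⟨M, N, a, b⟩ := h
  refine ⟨M.map φ, N.map φ, ?_, ?_⟩
  · rw [← Matrix.map_mul, a]; simp
  · ext i
    rw [← b, RingHom.map_mulVec]; rfl

theorem sim_of_det {f g : Fin m → R} (M : Matrix (Fin m) (Fin m) R) (hM : IsUnit M.det)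
    (h : M *ᵥ f = g) : Sim f g :=
  ⟨M, M⁻¹, Matrix.nonsing_inv_mul _ hM, h⟩

theorem det_updateCol_one (i : Fin m) (v : Fin m → R) :
    ((1 : Matrix (Fin m) (Fin m) R).updateCol i v).det = v i := by
  have := congrFun (congrArg (fun φ => φ v) (Matrix.cramer_one (n := Fin m) (α := R))) i
  rw [Matrix.cramer_apply] at this
  exact this

theorem det_updateRow_one (i : Fin m) (v : Fin m → R) :
    ((1 : Matrix (Fin m) (Fin m) R).updateRow i v).det = v i := by
  rw [← det_transpose, ← updateCol_transpose, transpose_one, det_updateCol_one]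

theorem sim_col (f v : Fin m → R) (i : Fin m) (hv : IsUnit (v i)) :
    Sim f (fun j => if j = i then v i * f i else f j + v j * f i) := by
  refine sim_of_det ((1 : Matrix (Fin m) (Fin m) R).updateCol i v)
    (by rwa [det_updateCol_one]) ?_
  ext j
  simp only [mulVec, dotProduct, updateCol_apply, ite_mul]
  have h1 : ∀ x, (if x = i then v j * f x else (1 : Matrix (Fin m) (Fin m) R) j x * f x)
      = (if x = i then (v j * f i - (1 : Matrix (Fin m) (Fin m) R) j i * f i) else 0) +
        (1 : Matrix (Fin m) (Fin m) R) j x * f x := by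
    intro x; split_ifs with h
    · subst h; ring
    · ring
  rw [Finset.sum_congr rfl (fun x _ => h1 x), Finset.sum_add_distrib]
  have h2 : ∑ x, (1 : Matrix (Fin m) (Fin m) R) j x * f x = f j :=
    congrFun (one_mulVec f) j
  rw [h2]
  simp only [Finset.sum_ite_eq', Finset.mem_univ, if_true]
  split_ifs with h
  · subst h; simp
  · rw [Matrix.one_apply_ne h]; ring

theorem sim_row (f w : Fin m → R) (i : Fin m) (hw : IsUnit (w i)) :
    Sim f (Function.update f i (w ⬝ᵥ f)) := by
  refine sim_of_det ((1 : Matrix (Fin m) (Fin m) R).updateRow i w)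
    (by rwa [det_updateRow_one]) ?_
  rw [updateRow_mulVec, one_mulVec]

theorem sim_unit (f : Fin m → R) (i : Fin m) (h : IsUnit (f i)) :
    Sim f (Pi.single i 1) := by
  refine Sim.symm ?_
  refine sim_of_det ((1 : Matrix (Fin m) (Fin m) R).updateCol i f)
    (by rwa [det_updateCol_one]) ?_
  ext j; simp [updateCol_apply]

theorem sim_single (i j : Fin m) : Sim (Pi.single i (1 : R)) (Pi.single j 1) := by
  by_cases h : i = j
  · subst h; exact Sim.refl _
  have h1 := sim_row (Pi.single i (1 : R)) (Pi.single i 1 + Pi.single j 1) j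
    (by simp [Pi.single_apply, Ne.symm h])
  refine h1.trans (sim_unit _ j ?_)
  simp [Ne.symm h]

def Uni (f : Fin m → R) : Prop := ∃ g : Fin m → R, g ⬝ᵥ f = 1

theorem Uni.map {f : Fin m → R} (φ : R →+* S) (h : Uni f) : Uni (fun i => φ (f i)) := by
  obtain ⟨g, hg⟩ := h
  refine ⟨fun i => φ (g i), ?_⟩
  have := congrArg φ hg
  simpa [dotProduct] using this

theorem Uni.sim {f g : Fin m → R} (h : Uni f) (hs : Sim f g) : Uni g := by
  obtain ⟨M, N, a, b⟩ := hs
  obtain ⟨u, hu⟩ := h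
  refine ⟨u ᵥ* N, ?_⟩
  rw [← dotProduct_mulVec, ← b, mulVec_mulVec, a, one_mulVec, hu]

theorem uni_two {f : Fin 2 → R} (h : Uni f) : Sim f (Pi.single 0 1) := by
  obtain ⟨g, hg⟩ := h
  simp only [dotProduct, Fin.sum_univ_two] at hg
  refine sim_of_det !![g 0, g 1; - f 1, f 0] ?_ ?_
  · rw [det_fin_two_of]
    have : g 0 * f 0 - g 1 * -f 1 = 1 := by rw [← hg]; ring
    rw [this]; exact isUnit_one
  · ext j; fin_cases j
    · simp [mulVec, dotProduct, Fin.sum_univ_two, hg]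
    · simp [mulVec, dotProduct, Fin.sum_univ_two]; ring

theorem uni_one {f : Fin 1 → R} (h : Uni f) : Sim f (Pi.single 0 1) := by
  obtain ⟨g, hg⟩ := h
  simp only [dotProduct, Fin.sum_univ_one] at hg
  exact sim_unit _ 0 (IsUnit.of_mul_eq_one_right _ hg)

end sim

section horrocks
variable {R : Type*} [CommRing R]

theorem coeff_mem_of_ideal (J : Ideal R[X]) (a : R[X]) (ha : a.Monic) (haJ : a ∈ J) (d : ℕ)
    (hd : a.natDegree = d + 1) (𝔞 : Ideal R)
    (h𝔞 : ∀ p ∈ J, p.natDegree ≤ d → p.coeff d ∈ 𝔞) (s : ℕ) :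
    ∀ p ∈ J, p.natDegree ≤ d → s ≤ d → p.coeff (d - s) ∈ 𝔞 := by
  induction s with
  | zero => intro p hp h _; exact h𝔞 p hp h
  | succ s ih =>
    intro p hp hpd hs
    set q := X * p - C (p.coeff d) * a with hq
    have hqJ : q ∈ J := J.sub_mem (J.mul_mem_left _ hp) (J.mul_mem_left _ haJ)
    have hqd : q.natDegree ≤ d := by
      rw [natDegree_le_iff_coeff_eq_zero]
      intro N hN
      obtain ⟨N, rfl⟩ : ∃ N', N = N' + 1 := ⟨N - 1, by omega⟩
      rw [hq, coeff_sub, coeff_X_mul, coeff_C_mul]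
      rcases Nat.eq_or_lt_of_le (Nat.lt_succ_iff.mp hN) with h | h
      · have : a.coeff (N + 1) = 1 := by rw [← h, ← hd]; exact ha
        rw [this, h]; simp
      · rw [coeff_eq_zero_of_natDegree_lt (p := p) (by omega),
          coeff_eq_zero_of_natDegree_lt (p := a) (by omega)]; simp
    have h1 := ih q hqJ hqd (by omega)
    have h2 : q.coeff (d - s) = p.coeff (d - (s + 1)) - p.coeff d * a.coeff (d - s) := by
      have : d - s = (d - (s + 1)) + 1 := by omega
      rw [hq, coeff_sub, coeff_C_mul]
      conv_lhs => rw [this, coeff_X_mul]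
      rw [← this]
    have h3 : p.coeff (d - (s + 1)) = q.coeff (d - s) + p.coeff d * a.coeff (d - s) := by
      rw [h2]; ring
    rw [h3]
    exact 𝔞.add_mem h1 (𝔞.mul_mem_right _ (h𝔞 p hp hpd))

theorem exists_monic_comb (a b : R[X]) (d : ℕ) (ha : a.Monic) (hd : a.natDegree = d + 1)
    (hb : b.natDegree ≤ d) (j : ℕ) (hj : IsUnit (b.coeff j)) :
    ∃ g h : R[X], (g * a + h * b).natDegree ≤ d ∧ (g * a + h * b).coeff d = 1 := by
  classical
  by_cases htriv : Subsingleton R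
  · exact ⟨0, 0, by simp, Subsingleton.elim _ _⟩
  rw [not_subsingleton_iff_nontrivial] at htriv
  let J : Ideal R[X] := Ideal.span {a, b}
  let 𝔞 : Ideal R :=
    { carrier := {c | ∃ p ∈ J, p.natDegree ≤ d ∧ p.coeff d = c}
      zero_mem' := ⟨0, J.zero_mem, by simp, by simp⟩
      add_mem' := by
        rintro _ _ ⟨p, hp, hpd, rfl⟩ ⟨q, hq, hqd, rfl⟩
        exact ⟨p + q, J.add_mem hp hq, natDegree_add_le_of_degree_le hpd hqd, by simp⟩
      smul_mem' := by
        rintro c _ ⟨p, hp, hpd, rfl⟩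
        exact ⟨C c * p, J.mul_mem_left _ hp, (natDegree_C_mul_le _ _).trans hpd, by simp⟩ }
  have hjd : j ≤ d := by
    by_contra hcon
    rw [coeff_eq_zero_of_natDegree_lt (by omega)] at hj
    exact not_isUnit_zero hj
  have key := coeff_mem_of_ideal J a ha (Ideal.subset_span (by simp)) d hd 𝔞
    (fun p hp h => ⟨p, hp, h, rfl⟩) (d - j) b (Ideal.subset_span (by simp)) hb (by omega)
  rw [Nat.sub_sub_self hjd] at key
  have h1 : (1 : R) ∈ 𝔞 := (Ideal.eq_top_iff_one _).mp (Ideal.eq_top_of_isUnit_mem _ key hj)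
  obtain ⟨p, hp, hpd, hpc⟩ := h1
  obtain ⟨g, h, rfl⟩ := Ideal.mem_span_pair.mp hp
  exact ⟨g, h, hpd, hpc⟩

theorem horrocks_aux [IsLocalRing R] {m : ℕ} (hm : 2 < m) (d : ℕ) :
    ∀ (f : Fin m → R[X]), Uni f → ∀ i, (f i).Monic → (f i).natDegree = d →
    ∃ j, Sim f (Pi.single j 1) := by
  induction d with
  | zero =>
    intro f _ i hi hd
    refine ⟨i, sim_unit f i ?_⟩
    rw [hi.natDegree_eq_zero.mp hd]; exact isUnit_one
  | succ d ih =>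
    intro f hf i hi hd
    -- reduce
    let v : Fin m → R[X] := fun j => if j = i then 1 else - (f j /ₘ f i)
    have hs := sim_col f v i (by simp [v])
    set f' : Fin m → R[X] := (fun j => if j = i then v i * f i else f j + v j * f i) with hf'
    have hfi : f' i = f i := by simp [hf', v]
    have hfj : ∀ j, j ≠ i → f' j = f j %ₘ f i := by
      intro j hj
      simp only [hf', v, if_neg hj]
      rw [modByMonic_eq_sub_mul_div]; ring
    have hdeg : ∀ j, j ≠ i → (f' j).natDegree ≤ d := by
      intro j hj
      have := natDegree_modByMonic_lt (f j) hi (by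
        intro h; rw [h] at hd; simp at hd)
      rw [hfj j hj]; omega
    have hu : Uni f' := hf.sim hs
    obtain ⟨j, hj, s, hjs⟩ : ∃ j, j ≠ i ∧ ∃ s, IsUnit ((f' j).coeff s) := by
      by_contra hcon
      push Not at hcon
      obtain ⟨g, hg⟩ := hu
      have h0 : ∀ j, j ≠ i → (f' j).map (IsLocalRing.residue R) = 0 := by
        intro j hj
        ext s
        rw [coeff_map, coeff_zero, IsLocalRing.residue_eq_zero_iff]
        exact hcon j hj s
      have h1 := congrArg (Polynomial.map (IsLocalRing.residue R)) hg
      rw [dotProduct, Polynomial.map_sum, Finset.sum_eq_single i] at h1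
      · rw [Polynomial.map_mul, hfi, Polynomial.map_one] at h1
        have h2 := IsUnit.of_mul_eq_one_right _ h1
        have h3 := (hi.map (IsLocalRing.residue R)).natDegree_eq_zero.mp
          (natDegree_eq_zero_of_isUnit h2)
        have h4 := hi.natDegree_map (IsLocalRing.residue R)
        rw [h3, hd] at h4
        simp at h4
      · intro j _ hj
        rw [Polynomial.map_mul, h0 j hj, mul_zero]
      · simp
    obtain ⟨l, hl1, hl2⟩ := Fin.exists_ne_and_ne_of_two_lt i j hm
    obtain ⟨g, h, hgd, hgc⟩ := exists_monic_comb (f' i) (f' j) d (by rwa [hfi]) (by rw [hfi, hd])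
      (hdeg j hj) s hjs
    set p := g * f' i + h * f' j with hp
    set c : R[X] := C (1 - (f' l).coeff d) with hc
    let w : Fin m → R[X] := Pi.single l 1 + Pi.single i (c * g) + Pi.single j (c * h)
    have hsw := sim_row f' w l (by simp [w, hl1, hl2])
    have hw : w ⬝ᵥ f' = f' l + c * p := by
      simp only [w, add_dotProduct, single_dotProduct, hp]; ring
    rw [hw] at hsw
    have hdl : (f' l + c * p).natDegree ≤ d :=
      natDegree_add_le_of_degree_le (hdeg l hl1) ((natDegree_C_mul_le _ _).trans hgd)
    have hcl : (f' l + c * p).coeff d = 1 := by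
      rw [coeff_add, hc, coeff_C_mul, hgc]; ring
    have hmon : (f' l + c * p).Monic := monic_of_natDegree_le_of_coeff_eq_one d hdl hcl
    obtain ⟨t, ht⟩ := ih _ (hu.sim hsw) l (by simpa using hmon) (by
      simp only [Function.update_self]
      refine le_antisymm hdl (le_natDegree_of_ne_zero ?_)
      rw [hcl]; exact one_ne_zero)
    exact ⟨t, (hs.trans hsw).trans ht⟩

theorem horrocks [IsLocalRing R] {m : ℕ} (f : Fin m → R[X]) (hf : Uni f) (i : Fin m)
    (hi : (f i).Monic) : ∃ j, Sim f (Pi.single j 1) := by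
  rcases m with _ | _ | _ | m
  · exact i.elim0
  · exact ⟨0, uni_one hf⟩
  · exact ⟨0, uni_two hf⟩
  · exact horrocks_aux (by omega) _ f hf i hi rfl

theorem uni_local [IsLocalRing R] {m : ℕ} (f : Fin m → R) (hf : Uni f) :
    ∃ j, Sim f (Pi.single j 1) := by
  obtain ⟨g, hg⟩ := hf
  by_contra hcon
  push Not at hcon
  have h : ∀ j, g j * f j ∈ IsLocalRing.maximalIdeal R := by
    intro j
    refine Ideal.mul_mem_left _ _ ?_
    intro h
    exact hcon j (sim_unit f j h)
  have := Ideal.sum_mem (IsLocalRing.maximalIdeal R) (fun j (_ : j ∈ Finset.univ) => h j)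
  have h1 : ∑ j, g j * f j = 1 := hg
  rw [h1] at this
  exact (Ideal.ne_top_iff_one _).mp (IsLocalRing.maximalIdeal.isMaximal R).ne_top this

/-- over a local ring, `f ~ f(0)` -/
theorem local_sim [IsLocalRing R] {m : ℕ} (f : Fin m → R[X]) (hf : Uni f) (i : Fin m)
    (hi : (f i).Monic) : Sim f (fun j => C ((f j).eval 0)) := by
  obtain ⟨j, hj⟩ := horrocks f hf i hi
  obtain ⟨l, hl⟩ := uni_local _ (hf.map (evalRingHom 0))
  have h2 := hl.map (C : R →+* R[X])
  have h3 : (fun i => C ((Pi.single l 1 : Fin m → R) i)) = (Pi.single l 1 : Fin m → R[X]) := by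
    ext1 t
    by_cases h : t = l
    · subst h; simp
    · simp [h]
  rw [h3] at h2
  exact (hj.trans (sim_single j l)).trans h2.symm

end horrocks
end QS

namespace QS
open Polynomial Matrix

section patch
variable {R S : Type*} [CommRing R] [CommRing S]

theorem clear_denom (φ : R →+* S) (T : Submonoid R)
    (hT : ∀ s, ∃ c ∈ T, ∃ r, φ c * s = φ r) (p : S[X]) :
    ∃ c ∈ T.map (C : R →+* R[X]), ∃ r, mapRingHom φ c * p = mapRingHom φ r := by
  induction p using Polynomial.induction_on' with
  | add p q hp hq =>
    obtain ⟨c, hc, r, h⟩ := hp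
    obtain ⟨c', hc', r', h'⟩ := hq
    refine ⟨c * c', mul_mem hc hc', c' * r + c * r', ?_⟩
    simp only [map_mul, map_add, ← h, ← h']; ring
  | monomial n s =>
    obtain ⟨c, hc, r, h⟩ := hT s
    refine ⟨C c, ⟨c, hc, rfl⟩, monomial n r, ?_⟩
    simp [C_mul_monomial, h]

theorem clear_denom2 (φ : R →+* S) (T : Submonoid R)
    (hT : ∀ s, ∃ c ∈ T, ∃ r, φ c * s = φ r) (p : S[X][X]) :
    ∃ c ∈ T, ∃ r, C (C (φ c)) * p = mapRingHom (mapRingHom φ) r := by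
  obtain ⟨c, hc, r, h⟩ := clear_denom (mapRingHom φ) (T.map (C : R →+* R[X]))
    (clear_denom φ T hT) p
  obtain ⟨_, ⟨c, hc, rfl⟩, rfl⟩ := hc
  refine ⟨c, hc, r, ?_⟩
  rw [← h]; simp

theorem scale_one (φ : R →+* S) (T : Submonoid R)
    (hT : ∀ s, ∃ c ∈ T, ∃ r, φ c * s = φ r) (p : S[X][X]) (hp : p.eval 0 = 0) :
    ∃ c ∈ T, ∀ a, ∃ r, p.comp (C (C (φ (c * a))) * X) = mapRingHom (mapRingHom φ) r := by
  have hX : X ∣ p := by rw [X_dvd_iff, ← hp, coeff_zero_eq_eval_zero]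
  obtain ⟨q, rfl⟩ := hX
  obtain ⟨c, hc, r, h⟩ := clear_denom2 φ T hT q
  refine ⟨c, hc, fun a => ⟨C (C a) * X * r.comp (C (C (c * a)) * X), ?_⟩⟩
  have h2 : (C (C (φ c)) * q).comp (C (C (φ (c * a))) * X)
      = (mapRingHom (mapRingHom φ) r).comp (C (C (φ (c * a))) * X) := by rw [h]
  rw [mul_comp, C_comp] at h2
  have h3 : mapRingHom (mapRingHom φ) (r.comp (C (C (c * a)) * X)) =
      (mapRingHom (mapRingHom φ) r).comp (C (C (φ (c * a))) * X) := by
    simp [Polynomial.map_comp]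
  rw [map_mul (mapRingHom (mapRingHom φ)), h3, ← h2, mul_comp, X_comp]
  simp; ring

theorem scale_many (φ : R →+* S) (T : Submonoid R)
    (hT : ∀ s, ∃ c ∈ T, ∃ r, φ c * s = φ r) {ι : Type*} [Fintype ι] (p : ι → S[X][X])
    (hp : ∀ i, (p i).eval 0 = 0) :
    ∃ c ∈ T, ∀ a i, ∃ r, (p i).comp (C (C (φ (c * a))) * X) = mapRingHom (mapRingHom φ) r := by
  classical
  choose c hc h using fun i => scale_one φ T hT (p i) (hp i)
  refine ⟨∏ i, c i, prod_mem (fun i _ => hc i), fun a i => ?_⟩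
  obtain ⟨b, hb⟩ := Finset.dvd_prod_of_mem c (Finset.mem_univ i)
  rw [hb, mul_assoc]
  exact h i _

theorem patch (φ : R →+* S) (hφ : Function.Injective φ) (T : Submonoid R)
    (hT : ∀ s, ∃ c ∈ T, ∃ r, φ c * s = φ r) {m : ℕ} (f : Fin m → R[X])
    (h : Sim (fun j => (f j).map φ) (fun j => C (φ ((f j).eval 0)))) :
    ∃ c ∈ T, Sim (fun j => (f j).eval₂ (C.comp C) (C X + C (C c) * X : R[X][X]))
      (fun j => C (f j)) := by
  classical
  obtain ⟨M, N, hNM, hM⟩ := h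
  have hMN : M * N = 1 := mul_eq_one_comm.mp hNM
  let σ : S[X] →+* S[X][X] := eval₂RingHom (C.comp C) (C X + X)
  let ι : S[X] →+* S[X][X] := C
  let ev : S[X][X] →+* S[X] := evalRingHom 0
  have hevσ : ev.comp σ = RingHom.id _ := by
    ext <;> simp [ev, σ]
  have hevι : ev.comp ι = RingHom.id _ := by
    ext <;> simp [ev, ι]
  let G := N.map ι * M.map σ
  let G' := N.map σ * M.map ι
  have hGG : G * G' = 1 := by
    have h1 : M.map σ * N.map σ = 1 := by rw [← Matrix.map_mul, hMN]; simp
    have h2 : N.map ι * M.map ι = 1 := by rw [← Matrix.map_mul, hNM]; simp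
    calc G * G' = N.map ι * (M.map σ * N.map σ) * M.map ι := by
          simp only [G, G', Matrix.mul_assoc]
      _ = 1 := by rw [h1, Matrix.mul_one, h2]
  have hid : ∀ A : Matrix (Fin m) (Fin m) S[X], (A.map σ).map ev = A := by
    intro A; ext1 i j; exact congrArg (fun ψ => ψ (A i j)) hevσ
  have hid' : ∀ A : Matrix (Fin m) (Fin m) S[X], (A.map ι).map ev = A := by
    intro A; ext1 i j; exact congrArg (fun ψ => ψ (A i j)) hevι
  have hG0 : G.map ev = 1 := by
    simp only [G]; rw [Matrix.map_mul, hid, hid', hNM]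
  have hG'0 : G'.map ev = 1 := by
    simp only [G']; rw [Matrix.map_mul, hid, hid', hNM]
  have hGf : G *ᵥ (fun j => σ ((f j).map φ)) = fun j => ι ((f j).map φ) := by
    have h1 : M.map σ *ᵥ (fun j => σ ((f j).map φ)) = fun j => C (C (φ ((f j).eval 0))) := by
      ext1 j
      have := (RingHom.map_mulVec σ M (fun j => (f j).map φ) j).symm
      rw [hM] at this
      refine Eq.trans this ?_
      simp [σ]
    have h2 : M.map ι *ᵥ (fun j => ι ((f j).map φ)) = fun j => C (C (φ ((f j).eval 0))) := by
      ext1 j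
      have := (RingHom.map_mulVec ι M (fun j => (f j).map φ) j).symm
      rw [hM] at this
      exact this
    simp only [G]
    rw [← mulVec_mulVec, h1, ← h2, mulVec_mulVec, ← Matrix.map_mul, hNM]
    simp
  obtain ⟨c, hc, hcs⟩ := scale_many φ T hT
    (fun x : Bool × Fin m × Fin m => if x.1 then (G - 1) x.2.1 x.2.2 else (G' - 1) x.2.1 x.2.2)
    (by
      rintro ⟨b, i, j⟩
      have h1 := congrFun (congrFun hG0 i) j
      have h2 := congrFun (congrFun hG'0 i) j
      simp only [Matrix.map_apply, ev, coe_evalRingHom] at h1 h2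
      by_cases hij : i = j
      · subst hij; cases b <;> simp [h1, h2]
      · cases b <;> simp [h1, h2, Matrix.one_apply_ne hij])
  replace hcs := hcs 1
  rw [mul_one] at hcs
  let τ : S[X][X] →+* S[X][X] := compRingHom (C (C (φ c)) * X)
  let Φ : R[X][X] →+* S[X][X] := mapRingHom (mapRingHom φ)
  have hΦ : Function.Injective Φ :=
    Polynomial.map_injective _ (Polynomial.map_injective _ hφ)
  choose E hE using fun i j => hcs (true, i, j)
  choose E' hE' using fun i j => hcs (false, i, j)
  have hEG : (1 + Matrix.of E).map Φ = G.map τ := by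
    ext1 i j
    have h1 : τ ((G - 1) i j) = Φ (E i j) := hE i j
    have h2 : (1 : Matrix (Fin m) (Fin m) S[X][X]) i j = τ ((1 : Matrix (Fin m) (Fin m) _) i j) := by
      by_cases hij : i = j
      · subst hij; simp
      · simp [Matrix.one_apply_ne hij]
    have h3 : (1 : Matrix (Fin m) (Fin m) S[X][X]) i j = Φ ((1 : Matrix (Fin m) (Fin m) _) i j) := by
      by_cases hij : i = j
      · subst hij; simp
      · simp [Matrix.one_apply_ne hij]
    rw [Matrix.map_apply, Matrix.add_apply, map_add, Matrix.of_apply, ← h1, ← h3, h2, ← map_add,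
      Matrix.map_apply]
    congr 1; simp
  have hEG' : (1 + Matrix.of E').map Φ = G'.map τ := by
    ext1 i j
    have h1 : τ ((G' - 1) i j) = Φ (E' i j) := hE' i j
    have h2 : (1 : Matrix (Fin m) (Fin m) S[X][X]) i j = τ ((1 : Matrix (Fin m) (Fin m) _) i j) := by
      by_cases hij : i = j
      · subst hij; simp
      · simp [Matrix.one_apply_ne hij]
    have h3 : (1 : Matrix (Fin m) (Fin m) S[X][X]) i j = Φ ((1 : Matrix (Fin m) (Fin m) _) i j) := by
      by_cases hij : i = j
      · subst hij; simp
      · simp [Matrix.one_apply_ne hij]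
    rw [Matrix.map_apply, Matrix.add_apply, map_add, Matrix.of_apply, ← h1, ← h3, h2, ← map_add,
      Matrix.map_apply]
    congr 1; simp
  have hEE : (1 + Matrix.of E) * (1 + Matrix.of E') = 1 := by
    apply Matrix.map_injective hΦ
    beta_reduce
    rw [Matrix.map_mul, hEG, hEG', ← Matrix.map_mul, hGG]
    simp
  refine ⟨c, hc, 1 + Matrix.of E, 1 + Matrix.of E', mul_eq_one_comm.mp hEE, ?_⟩
  ext1 j
  apply hΦ
  rw [RingHom.map_mulVec, hEG]
  have h1 : (Φ ∘ fun j => (f j).eval₂ (C.comp C) (C X + C (C c) * X : R[X][X]))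
      = τ ∘ (fun j => σ ((f j).map φ)) := by
    ext1 j
    simp only [Function.comp_apply]
    have : Φ.comp (eval₂RingHom (C.comp C) (C X + C (C c) * X : R[X][X])) =
        (τ.comp σ).comp (mapRingHom φ) := by
      ext <;> simp [Φ, τ, σ]
    exact congrArg (fun ψ => ψ (f j)) this
  rw [h1, ← RingHom.map_mulVec, hGf]
  simp [τ, ι, Φ]

end patch

theorem sim_eval_zero {R : Type*} [CommRing R] [IsDomain R] {m : ℕ} (f : Fin m → R[X])
    (hf : Uni f) (i : Fin m) (hi : (f i).Monic) : Sim f (fun j => C ((f j).eval 0)) := by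
  let J : Ideal R :=
    { carrier := {c | ∀ b t : R[X], Sim (fun j => aeval (b + C c * t) (f j))
        (fun j => aeval b (f j))}
      zero_mem' := by intro b t; simpa using Sim.refl _
      add_mem' := by
        intro c c' h h' b t
        have h1 := h (b + C c' * t) t
        have h2 := h' b t
        refine Sim.trans ?_ h2
        have e : b + C (c + c') * t = b + C c' * t + C c * t := by rw [C_add]; ring
        simp only [e]; exact h1
      smul_mem' := by
        intro a c h b t
        have := h b (C a * t)
        have e : b + C (a • c) * t = b + C c * (C a * t) := by
          rw [smul_eq_mul, C_mul]; ring
        simp only [e]; exact this }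
  have hJ : J = ⊤ := by
    by_contra hne
    obtain ⟨P, hP, hJP⟩ := Ideal.exists_le_maximal J hne
    have := hP.isPrime
    let S := Localization.AtPrime P
    let φ : R →+* S := algebraMap R S
    have hφ : Function.Injective φ :=
      IsLocalization.injective S P.primeCompl_le_nonZeroDivisors
    have hT : ∀ s, ∃ c ∈ P.primeCompl, ∃ r, φ c * s = φ r := by
      intro s
      obtain ⟨⟨r, c⟩, h⟩ := IsLocalization.surj P.primeCompl s
      exact ⟨c, c.2, r, by rw [mul_comm]; exact h⟩
    have h1 := local_sim (fun j => (f j).map φ) (hf.map (mapRingHom φ)) i (hi.map φ)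
    have h2 : (fun j => C (((f j).map φ).eval 0)) = fun j => C (φ ((f j).eval 0)) := by
      ext1 j
      congr 1
      rw [← Polynomial.coeff_zero_eq_eval_zero, ← Polynomial.coeff_zero_eq_eval_zero, coeff_map]
    rw [h2] at h1
    obtain ⟨c, hc, hs⟩ := patch φ hφ P.primeCompl hT f h1
    refine hc (hJP ?_)
    intro b t
    have h3 := hs.map (eval₂RingHom (aeval b : R[X] →ₐ[R] R[X]).toRingHom t)
    convert h3 using 1
    · ext1 j
      have : (aeval (b + C c * t) : R[X] →ₐ[R] R[X]).toRingHom =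
        (eval₂RingHom (aeval b : R[X] →ₐ[R] R[X]).toRingHom t).comp
          (eval₂RingHom (C.comp C) (C X + C (C c) * X : R[X][X])) := by
        ext <;> simp
      exact congrArg (fun ψ => ψ (f j)) this
    · ext1 j; simp
  have h1 : (1 : R) ∈ J := by rw [hJ]; trivial
  have h2 := h1 0 X
  simp only [map_one, one_mul, zero_add, aeval_X_left_apply] at h2
  convert h2 using 2 with j
  rw [← Polynomial.coeff_zero_eq_aeval_zero']
  simp [Polynomial.coeff_zero_eq_eval_zero]

end QS

namespace QS
section equivT
open Polynomial MvPolynomial Ideal Nat RingHom List NoetherNormalization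
variable {k : Type*} [Field k] {n : ℕ} (f : MvPolynomial (Fin (n + 1)) k)
variable (v w : Fin (n + 1) →₀ ℕ)

variable {f v} in
lemma lt_up (vlt : ∀ i, v i < (2 + f.totalDegree)) : ∀ l ∈ ofFn v, l < (2 + f.totalDegree) := by
  grind

lemma t1_comp_t1_neg (c : k) : (T1 f c).comp (T1 f (-c)) = AlgHom.id _ _ := by
  rw [comp_aeval, ← MvPolynomial.aeval_X_left]
  ext i v
  cases i using Fin.cases <;> simp

/-- `T1 f 1` leads to an algebra equiv `T f`. -/
noncomputable abbrev T := AlgEquiv.ofAlgHom (T1 f 1) (T1 f (-1))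
  (t1_comp_t1_neg f 1) (by simpa using t1_comp_t1_neg f (-1))

lemma sum_r_mul_ne (vlt : ∀ i, v i < (2 + f.totalDegree)) (wlt : ∀ i, w i < (2 + f.totalDegree)) (ne : v ≠ w) :
    ∑ x : Fin (n + 1), (2 + f.totalDegree) ^ x.1 * v x ≠ ∑ x : Fin (n + 1), (2 + f.totalDegree) ^ x.1 * w x := by
  intro h
  refine ne <| Finsupp.ext <| congrFun <| ofFn_inj.mp ?_
  apply ofDigits_inj_of_len_eq (Nat.lt_add_right f.totalDegree one_lt_two)
    (by simp) (lt_up vlt) (lt_up wlt)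
  simpa only [ofDigits_eq_sum_mapIdx, mapIdx_eq_ofFn, get_ofFn, length_ofFn,
    Fin.val_cast, mul_comm, sum_ofFn] using! h

lemma degreeOf_zero_t {a : k} (ha : a ≠ 0) : ((T f) (monomial v a)).degreeOf 0 =
    ∑ i : Fin (n + 1), ((2 + f.totalDegree) ^ i.1) * v i := by
  rw [← natDegree_finSuccEquiv, monomial_eq, Finsupp.prod_pow v fun a ↦ X a]
  simp only [Fin.prod_univ_succ, Fin.sum_univ_succ, map_mul, map_prod, map_pow,
    AlgEquiv.ofAlgHom_apply, MvPolynomial.aeval_C, MvPolynomial.aeval_X, if_pos, Fin.succ_ne_zero,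
    ite_false, one_smul, map_add, finSuccEquiv_X_zero, finSuccEquiv_X_succ, algebraMap_eq]
  have h (i : Fin n) :
      (Polynomial.C (X (R := k) i) + Polynomial.X ^ (2 + f.totalDegree) ^ (i.succ).1) ^ v i.succ ≠ 0 :=
    pow_ne_zero (v i.succ) (leadingCoeff_ne_zero.mp <| by simp [add_comm, leadingCoeff_X_pow_add_C])
  rw [natDegree_mul (by simp [ha]) (mul_ne_zero (by simp) (Finset.prod_ne_zero_iff.mpr
    (fun i _ ↦ h i))), natDegree_mul (by simp) (Finset.prod_ne_zero_iff.mpr (fun i _ ↦ h i)),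
    natDegree_prod _ _ (fun i _ ↦ h i), natDegree_finSuccEquiv, degreeOf_C]
  simpa only [natDegree_pow, zero_add, natDegree_X, mul_one, Fin.val_zero, pow_zero, one_mul,
    add_right_inj] using Finset.sum_congr rfl (fun i _ ↦ by
    rw [add_comm (Polynomial.C _), natDegree_X_pow_add_C, mul_comm])

/-- `T` maps different monomials of `f` to polynomials with different degrees in `X_0`. -/
lemma degreeOf_t_ne_of_ne (hv : v ∈ f.support) (hw : w ∈ f.support) (ne : v ≠ w) :
    (T f <| monomial v <| coeff v f).degreeOf 0 ≠
    (T f <| monomial w <| coeff w f).degreeOf 0 := by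
  rw [degreeOf_zero_t _ _ <| mem_support_iff.mp hv, degreeOf_zero_t _ _ <| mem_support_iff.mp hw]
  refine sum_r_mul_ne f v w (fun i ↦ ?_) (fun i ↦ ?_) ne <;>
  exact lt_of_le_of_lt ((monomial_le_degreeOf i ‹_›).trans (degreeOf_le_totalDegree f i))
    (by lia)

lemma leadingCoeff_finSuccEquiv_t :
    (finSuccEquiv k n ((T f) ((monomial v) (coeff v f)))).leadingCoeff =
    algebraMap k _ (coeff v f) := by
  rw [monomial_eq, Finsupp.prod_fintype]
  · simp only [map_mul, map_prod, leadingCoeff_mul, leadingCoeff_prod]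
    rw [AlgEquiv.ofAlgHom_apply, algHom_C, algebraMap_eq, finSuccEquiv_apply,
      eval₂Hom_C, coe_comp]
    simp only [AlgEquiv.ofAlgHom_apply, Function.comp_apply, leadingCoeff_C, map_pow,
      leadingCoeff_pow, algebraMap_eq]
    have : ∀ j, ((finSuccEquiv k n) ((T1 f) 1 (X j))).leadingCoeff = 1 := fun j ↦ by
      by_cases h : j = 0
      · simp [h, finSuccEquiv_apply]
      · simp only [aeval_eq_bind₁, bind₁_X_right, if_neg h, one_smul, map_add, map_pow]
        obtain ⟨i, rfl⟩ := Fin.exists_succ_eq.mpr h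
        simp [finSuccEquiv_X_succ, finSuccEquiv_X_zero, add_comm]
    simp only [this, one_pow, Finset.prod_const_one, mul_one]
  exact fun i ↦ pow_zero _

/-- `T` maps `f` into some polynomial in `X_0` such that the leading coefficient is invertible. -/
lemma T_leadingcoeff_isUnit (fne : f ≠ 0) :
    IsUnit (finSuccEquiv k n (T f f)).leadingCoeff := by
  obtain ⟨v, vin, vs⟩ := Finset.exists_max_image f.support
    (fun v ↦ (T f ((monomial v) (coeff v f))).degreeOf 0) (support_nonempty.mpr fne)
  set h := fun w ↦ (MvPolynomial.monomial w) (coeff w f)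
  simp only [← natDegree_finSuccEquiv] at vs
  replace vs : ∀ x ∈ f.support \ {v}, (finSuccEquiv k n ((T f) (h x))).degree <
      (finSuccEquiv k n ((T f) (h v))).degree := by
    intro x hx
    obtain ⟨h1, h2⟩ := Finset.mem_sdiff.mp hx
    apply degree_lt_degree <| lt_of_le_of_ne (vs x h1) ?_
    simpa only [natDegree_finSuccEquiv]
      using degreeOf_t_ne_of_ne f _ _ h1 vin <| ne_of_not_mem_cons h2
  have coeff : (finSuccEquiv k n ((T f) (h v + ∑ x ∈ f.support \ {v}, h x))).leadingCoeff =
      (finSuccEquiv k n ((T f) (h v))).leadingCoeff := by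
    simp only [map_add, map_sum]
    rw [add_comm]
    apply leadingCoeff_add_of_degree_lt <| (lt_of_le_of_lt <| degree_sum_le _ _) ?_
    have h2 : h v ≠ 0 := by simpa [h] using mem_support_iff.mp vin
    replace h2 : (finSuccEquiv k n ((T f) (h v))) ≠ 0 := fun eq ↦ h2 <|
      by simpa only [map_eq_zero_iff _ (AlgEquiv.injective _)] using eq
    exact (Finset.sup_lt_iff <| Ne.bot_lt (fun x ↦ h2 <| degree_eq_bot.mp x)).mpr vs
  nth_rw 2 [← f.support_sum_monomial_coeff]
  rw [Finset.sum_eq_add_sum_sdiff_singleton_of_mem vin h]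
  rw [leadingCoeff_finSuccEquiv_t] at coeff
  simpa only [coeff, algebraMap_eq] using (mem_support_iff.mp vin).isUnit.map MvPolynomial.C

end equivT
end QS

namespace QS
open Polynomial Matrix

def Hermite (R : Type*) [CommRing R] : Prop :=
  ∀ (m : ℕ) (f : Fin m → R), Uni f → ∃ j, Sim f (Pi.single j 1)

theorem Hermite.of_equiv {R S : Type*} [CommRing R] [CommRing S] (e : R ≃+* S)
    (h : Hermite R) : Hermite S := by
  intro m f hf
  obtain ⟨j, hj⟩ := h m _ (hf.map (e.symm : S →+* R))
  refine ⟨j, ?_⟩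
  have h2 := hj.map (e : R →+* S)
  convert h2 using 1
  · ext1 i; simp
  · ext1 i
    by_cases h : i = j
    · subst h; simp
    · simp [h]

theorem hermite_field {k : Type*} [Field k] : Hermite k := fun _ f hf => uni_local f hf

theorem exists_equiv_unit {k : Type*} [Field k] {n : ℕ} (p : MvPolynomial (Fin (n + 1)) k)
    (hp : p ≠ 0) : ∃ e : MvPolynomial (Fin (n + 1)) k ≃+* (MvPolynomial (Fin n) k)[X],
      IsUnit (e p).leadingCoeff :=
  ⟨((T p).trans (MvPolynomial.finSuccEquiv k n)).toRingEquiv, T_leadingcoeff_isUnit p hp⟩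

theorem hermite_mvPolynomial (k : Type*) [Field k] (n : ℕ) :
    Hermite (MvPolynomial (Fin n) k) := by
  induction n with
  | zero => exact hermite_field.of_equiv (MvPolynomial.isEmptyRingEquiv k (Fin 0)).symm
  | succ n ih =>
    intro m f hf
    obtain ⟨i, hi⟩ : ∃ i, f i ≠ 0 := by
      by_contra hcon
      push Not at hcon
      obtain ⟨g, hg⟩ := hf
      simp [dotProduct, hcon] at hg
    obtain ⟨e, hu⟩ := exists_equiv_unit (f i) hi
    obtain ⟨u, hu⟩ := hu
    let f' : Fin m → (MvPolynomial (Fin n) k)[X] := fun j => e (f j)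
    have hf' : Uni f' := hf.map e.toRingHom
    have hs := sim_row f' (Pi.single i (C (↑u⁻¹))) i (by
      simpa using (Units.isUnit u⁻¹).map (C : _ →+* (MvPolynomial (Fin n) k)[X]))
    set f'' := Function.update f' i ((Pi.single i (C (↑u⁻¹)) : Fin m → _) ⬝ᵥ f') with hf''
    have hmon : (f'' i).Monic := by
      simp only [hf'', Function.update_self, single_dotProduct]
      unfold Monic
      rw [leadingCoeff_mul, leadingCoeff_C]
      simp only [f']
      rw [← hu]; simp
    have h0 := sim_eval_zero f'' (hf'.sim hs) i hmon
    obtain ⟨j, hj⟩ := ih m _ ((hf'.sim hs).map (evalRingHom 0))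
    have h1 := (hs.trans h0).trans (hj.map (C : _ →+* (MvPolynomial (Fin n) k)[X]))
    have h2 := h1.map e.symm.toRingHom
    refine ⟨j, ?_⟩
    convert h2 using 1
    · ext1 i; simp [f']
    · ext1 i
      by_cases h : i = j
      · subst h; simp
      · simp [h]

section cancel
variable {R : Type*} [CommRing R]

theorem cancel_one (hR : Hermite R) {P : Type*} [AddCommGroup P] [Module R P] {m : ℕ}
    (e : (P × R) ≃ₗ[R] (Fin m → R)) : Module.Free R P := by
  classical
  have hU : Uni (e (0, 1)) := by
    refine ⟨fun i => (e.symm (Pi.single i 1)).2, ?_⟩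
    have h1 : ∀ v : Fin m → R, (fun i => (e.symm (Pi.single i 1)).2) ⬝ᵥ v = (e.symm v).2 := by
      intro v
      conv_rhs => rw [pi_eq_sum_univ' v]
      simp only [map_sum, map_smul, Prod.snd_sum, Prod.smul_snd, dotProduct, smul_eq_mul]
      refine Finset.sum_congr rfl fun i _ => ?_
      rw [mul_comm]
    rw [h1]; simp
  obtain ⟨j, M, N, hNM, hM⟩ := hR m _ hU
  have hMN : M * N = 1 := mul_eq_one_comm.mp hNM
  let eM : (Fin m → R) ≃ₗ[R] (Fin m → R) :=
    LinearEquiv.ofLinearMap M.mulVecLin N.mulVecLin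
      (by rw [← Matrix.mulVecLin_mul, hMN, Matrix.mulVecLin_one])
      (by rw [← Matrix.mulVecLin_mul, hNM, Matrix.mulVecLin_one])
  let e' := e.trans eM
  have he' : e' (0, 1) = Pi.single j 1 := hM
  have hec : ∀ c : R, e' (0, c) = c • Pi.single j 1 := by
    intro c
    rw [← he', ← map_smul]; simp
  let ψ : P →ₗ[R] ({i : Fin m // i ≠ j} → R) :=
    (LinearMap.funLeft R R (Subtype.val)).comp (e'.toLinearMap.comp (LinearMap.inl R P R))
  have hψ : ∀ p i, ψ p i = e' (p, 0) i.1 := fun p i => rfl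
  have hb : Function.Bijective ψ := by
    constructor
    · rw [← LinearMap.ker_eq_bot, LinearMap.ker_eq_bot']
      intro p hp
      have h1 : e' (p, 0) = e' (0, e' (p, 0) j) := by
        rw [hec]
        ext i
        by_cases h : i = j
        · subst h; simp
        · have := congrFun hp ⟨i, h⟩
          rw [hψ] at this
          rw [this]; simp [h]
      exact (Prod.ext_iff.mp (e'.injective h1)).1
    · intro w
      let w' : Fin m → R := fun i => if h : i = j then 0 else w ⟨i, h⟩
      refine ⟨(e'.symm w').1, ?_⟩
      ext i
      rw [hψ]
      have h1 : ((e'.symm w').1, (0 : R)) = e'.symm w' - (0, (e'.symm w').2) := by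
        ext <;> simp
      rw [h1, map_sub, hec]
      simp [w', i.2]
  exact Module.Free.of_equiv (LinearEquiv.ofBijective ψ hb).symm

theorem cancel_fin (hR : Hermite R) (r : ℕ) : ∀ {P : Type*} [AddCommGroup P] [Module R P]
    [Module.Finite R P] [Module.Free R (P × (Fin r → R))], Module.Free R P := by
  induction r with
  | zero =>
    intro P _ _ _ h
    exact Module.Free.of_equiv (LinearEquiv.prodUnique (R := R) (M := P) (M₂ := Fin 0 → R))
  | succ r ih =>
    intro P _ _ _ h
    by_cases htr : Subsingleton R
    · have := Module.subsingleton R P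
      infer_instance
    rw [not_subsingleton_iff_nontrivial] at htr
    have e1 : (P × (Fin (r + 1) → R)) ≃ₗ[R] (P × (Fin r → R)) × R :=
      (LinearEquiv.prodCongr (LinearEquiv.refl R P)
        ((Fin.consLinearEquiv R (fun _ : Fin (r + 1) => R)).symm.trans
          (LinearEquiv.prodComm R _ _))).trans
        (LinearEquiv.prodAssoc R P (Fin r → R) R).symm
    have : Module.Free R ((P × (Fin r → R)) × R) := Module.Free.of_equiv e1
    have b := Module.finBasis R ((P × (Fin r → R)) × R)
    have := cancel_one hR b.equivFun
    exact ih

theorem cancel (hR : Hermite R) {P F : Type*} [AddCommGroup P] [Module R P]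
    [Module.Finite R P] [AddCommGroup F] [Module R F] [Module.Finite R F] [Module.Free R F]
    (h : Module.Free R (P × F)) : Module.Free R P := by
  by_cases htr : Subsingleton R
  · have := Module.subsingleton R P
    infer_instance
  rw [not_subsingleton_iff_nontrivial] at htr
  have b := Module.finBasis R F
  have : Module.Free R (P × (Fin (Module.finrank R F) → R)) :=
    Module.Free.of_equiv (LinearEquiv.prodCongr (LinearEquiv.refl R P) b.equivFun)
  exact cancel_fin hR (Module.finrank R F)

end cancel
end QS

namespace QS
open Polynomial
universe u v w

/-- finite free resolution of length at most `d` -/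
def FFR (R : Type u) [CommRing R] : ℕ → ∀ (M : Type u) [AddCommGroup M] [Module R M], Prop
  | 0, M, _, _ => Module.Finite R M ∧ Module.Free R M
  | d + 1, M, _, _ => ∃ (m : ℕ) (f : (Fin m → R) →ₗ[R] M), Function.Surjective f ∧
      FFR R d (LinearMap.ker f)

section ffr
variable {R : Type u} [CommRing R]

theorem FFR.of_equiv {d : ℕ} {M N : Type u} [AddCommGroup M] [Module R M] [AddCommGroup N]
    [Module R N] (e : M ≃ₗ[R] N) (h : FFR R d M) : FFR R d N := by
  cases d with
  | zero =>
    obtain ⟨h1, h2⟩ := h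
    exact ⟨Module.Finite.equiv e, Module.Free.of_equiv e⟩
  | succ d =>
    obtain ⟨m, f, hf, hk⟩ := h
    refine ⟨m, e.toLinearMap.comp f, e.surjective.comp hf, ?_⟩
    rwa [LinearEquiv.ker_comp]

theorem FFR.finite {d : ℕ} {M : Type u} [AddCommGroup M] [Module R M] (h : FFR R d M) :
    Module.Finite R M := by
  cases d with
  | zero => exact h.1
  | succ d =>
    obtain ⟨m, f, hf, _⟩ := h
    exact Module.Finite.of_surjective f hf

theorem exists_fin_equiv (F : Type v) [AddCommGroup F] [Module R F] [Module.Finite R F]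
    [Module.Free R F] : ∃ m : ℕ, Nonempty ((Fin m → R) ≃ₗ[R] F) := by
  by_cases htr : Subsingleton R
  · have := Module.subsingleton R F
    exact ⟨0, ⟨LinearEquiv.ofSubsingleton _ _⟩⟩
  rw [not_subsingleton_iff_nontrivial] at htr
  exact ⟨_, ⟨(Module.finBasis R F).equivFun.symm⟩⟩

theorem ker_comp_equiv {F G M : Type*} [AddCommGroup F] [Module R F] [AddCommGroup G] [Module R G]
    [AddCommGroup M] [Module R M] (e : G ≃ₗ[R] F) (f : F →ₗ[R] M) :
    Nonempty (LinearMap.ker (f.comp e.toLinearMap) ≃ₗ[R] LinearMap.ker f) := by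
  refine ⟨e.ofSubmodules _ _ ?_⟩
  ext x
  simp only [Submodule.mem_map, LinearMap.mem_ker, LinearMap.comp_apply]
  constructor
  · rintro ⟨y, hy, rfl⟩; exact hy
  · intro hx; exact ⟨e.symm x, by simpa using hx, by simp⟩

theorem FFR.succ_of_ker {d : ℕ} {F : Type v} {M : Type u} [AddCommGroup F] [Module R F]
    [AddCommGroup M] [Module R M] [Module.Finite R F] [Module.Free R F] (f : F →ₗ[R] M)
    (hf : Function.Surjective f) {K : Type u} [AddCommGroup K] [Module R K]
    (e : K ≃ₗ[R] LinearMap.ker f) (h : FFR R d K) : FFR R (d + 1) M := by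
  obtain ⟨m, ⟨a⟩⟩ := exists_fin_equiv (R := R) F
  obtain ⟨b⟩ := ker_comp_equiv a f
  exact ⟨m, f.comp a.toLinearMap, hf.comp a.surjective, h.of_equiv (e.trans b.symm)⟩

theorem FFR.succ_of_exact {d : ℕ} {F : Type v} {M : Type u} [AddCommGroup F] [Module R F]
    [AddCommGroup M] [Module R M] [Module.Finite R F] [Module.Free R F] (f : F →ₗ[R] M)
    (hf : Function.Surjective f) {K : Type u} [AddCommGroup K] [Module R K]
    (i : K →ₗ[R] F) (hi : Function.Injective i) (hif : Function.Exact i f)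
    (h : FFR R d K) : FFR R (d + 1) M := by
  refine FFR.succ_of_ker f hf ?_ h
  exact (LinearEquiv.ofInjective i hi).trans
    (LinearEquiv.ofEq _ _ (LinearMap.exact_iff.mp hif).symm)

theorem FFR.prod_free {d : ℕ} {M : Type u} [AddCommGroup M] [Module R M] (h : FFR R d M)
    (F : Type u) [AddCommGroup F] [Module R F] [Module.Finite R F] [Module.Free R F] :
    FFR R d (M × F) := by
  cases d with
  | zero =>
    obtain ⟨h1, h2⟩ := h
    exact ⟨inferInstance, inferInstance⟩
  | succ d =>
    obtain ⟨m, f, hf, hk⟩ := h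
    refine FFR.succ_of_exact (f.prodMap (LinearMap.id : F →ₗ[R] F))
      (hf.prodMap Function.surjective_id)
      ((LinearMap.inl R _ F).comp (LinearMap.ker f).subtype)
      (LinearMap.inl_injective.comp (Submodule.subtype_injective _)) ?_ hk
    rintro ⟨x, y⟩
    constructor
    · intro hx
      simp only [LinearMap.prodMap_apply, Prod.mk_eq_zero, LinearMap.id_apply] at hx
      exact ⟨⟨x, hx.1⟩, by simp [hx.2]⟩
    · rintro ⟨⟨z, hz⟩, hz'⟩
      simp only [LinearMap.comp_apply, Submodule.subtype_apply, LinearMap.inl_apply,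
        Prod.mk.injEq] at hz'
      obtain ⟨rfl, rfl⟩ := hz'
      simpa using hz

theorem schanuel {F G M : Type*} [AddCommGroup F] [Module R F] [AddCommGroup G] [Module R G]
    [AddCommGroup M] [Module R M] [Module.Projective R F] [Module.Projective R G]
    (f : F →ₗ[R] M) (g : G →ₗ[R] M) (hf : Function.Surjective f) (hg : Function.Surjective g) :
    Nonempty ((LinearMap.ker f × G) ≃ₗ[R] (LinearMap.ker g × F)) := by
  obtain ⟨s, hs⟩ := Module.projective_lifting_property f g hf
  obtain ⟨t, ht⟩ := Module.projective_lifting_property g f hg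
  have hs' : ∀ y, f (s y) = g y := fun y => congrArg (fun φ => φ y) hs
  have ht' : ∀ y, g (t y) = f y := fun y => congrArg (fun φ => φ y) ht
  let W : Submodule R (F × G) := LinearMap.ker (f.comp (LinearMap.fst R F G) -
    g.comp (LinearMap.snd R F G))
  have hW : ∀ z, z ∈ W ↔ f z.1 = g z.2 := by
    intro z; simp [W, sub_eq_zero]
  let e1 : (LinearMap.ker f × G) ≃ₗ[R] W :=
    { toFun := fun z => ⟨(z.1.1 + s z.2, z.2), by
        rw [hW]; simp [hs']⟩
      map_add' := by
        intro x y; ext <;> simp <;> abel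
      map_smul' := by
        intro c x; ext <;> simp
      invFun := fun z => (⟨z.1.1 - s z.1.2, by
        have := (hW _).mp z.2
        simp [hs', this]⟩, z.1.2)
      left_inv := by intro x; ext <;> simp
      right_inv := by intro x; ext <;> simp }
  let e2 : (LinearMap.ker g × F) ≃ₗ[R] W :=
    { toFun := fun z => ⟨(z.2, z.1.1 + t z.2), by
        rw [hW]; simp [ht']⟩
      map_add' := by
        intro x y; ext <;> simp <;> abel
      map_smul' := by
        intro c x; ext <;> simp
      invFun := fun z => (⟨z.1.2 - t z.1.1, by
        have := (hW _).mp z.2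
        simp [ht', this]⟩, z.1.1)
      left_inv := by intro x; ext <;> simp
      right_inv := by intro x; ext <;> simp }
  exact ⟨e1.trans e2.symm⟩

theorem FFR.cancel (hR : Hermite R) (d : ℕ) : ∀ {M : Type u} [AddCommGroup M] [Module R M]
    {F : Type u} [AddCommGroup F] [Module R F] [Module.Finite R F] [Module.Free R F]
    (_ : FFR R d (M × F)), FFR R d M := by
  induction d with
  | zero =>
    intro M _ _ F _ _ _ _ h
    have := h.1
    have hM : Module.Finite R M :=
      Module.Finite.of_surjective (LinearMap.fst R M F) LinearMap.fst_surjective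
    exact ⟨hM, QS.cancel hR h.2⟩
  | succ d ih =>
    intro M _ _ F _ _ _ _ h
    have := h.finite
    have hM : Module.Finite R M :=
      Module.Finite.of_surjective (LinearMap.fst R M F) LinearMap.fst_surjective
    obtain ⟨m, f, hf, hk⟩ := h
    obtain ⟨a, g, hg⟩ := Module.Finite.exists_fin' R M
    refine ⟨a, g, hg, ?_⟩
    let g' := g.prodMap (LinearMap.id : F →ₗ[R] F)
    have hg' : Function.Surjective g' := hg.prodMap Function.surjective_id
    obtain ⟨e⟩ := schanuel f g' hf hg'
    have h2 := (hk.prod_free ((Fin a → R) × F)).of_equiv e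
    have h3 := ih h2
    refine h3.of_equiv ?_
    let i : LinearMap.ker g →ₗ[R] ((Fin a → R) × F) :=
      (LinearMap.inl R _ F).comp (LinearMap.ker g).subtype
    have hi : Function.Injective i :=
      LinearMap.inl_injective.comp (Submodule.subtype_injective _)
    have hr : LinearMap.ker g' = LinearMap.range i := by
      ext ⟨x, y⟩
      constructor
      · intro hx
        simp only [g', LinearMap.mem_ker, LinearMap.prodMap_apply, Prod.mk_eq_zero,
          LinearMap.id_apply] at hx
        exact ⟨⟨x, hx.1⟩, by simp [i, hx.2]⟩
      · rintro ⟨⟨z, hz⟩, hz'⟩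
        simp only [i, LinearMap.comp_apply, Submodule.subtype_apply, LinearMap.inl_apply,
          Prod.mk.injEq] at hz'
        obtain ⟨rfl, rfl⟩ := hz'
        simpa [g'] using hz
    exact (LinearEquiv.ofEq _ _ hr).trans (LinearEquiv.ofInjective i hi).symm

theorem FFR.ker (hR : Hermite R) {d : ℕ} {M : Type u} [AddCommGroup M] [Module R M]
    (h : FFR R (d + 1) M) {F : Type u} [AddCommGroup F] [Module R F] [Module.Finite R F]
    [Module.Free R F] (g : F →ₗ[R] M) (hg : Function.Surjective g) :
    FFR R d (LinearMap.ker g) := by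
  obtain ⟨m, f, hf, hk⟩ := h
  obtain ⟨e⟩ := schanuel f g hf hg
  exact FFR.cancel hR d ((hk.prod_free F).of_equiv e)

theorem FFR.succ {d : ℕ} : ∀ {M : Type u} [AddCommGroup M] [Module R M],
    FFR R d M → FFR R (d + 1) M := by
  induction d with
  | zero =>
    intro M _ _ h
    have := h.1
    have := h.2
    refine FFR.succ_of_exact (K := PUnit.{u+1}) (LinearMap.id : M →ₗ[R] M) Function.surjective_id 0
      (fun _ _ _ => Subsingleton.elim _ _) ?_ ⟨inferInstance, inferInstance⟩
    intro x
    simp [eq_comm]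
  | succ d ih =>
    rintro M _ _ ⟨m, f, hf, hk⟩
    exact ⟨m, f, hf, ih hk⟩

theorem FFR.ext {d : ℕ} : ∀ {M' M M'' : Type u} [AddCommGroup M'] [Module R M'] [AddCommGroup M]
    [Module R M] [AddCommGroup M''] [Module R M''] (i : M' →ₗ[R] M) (p : M →ₗ[R] M'')
    (_ : Function.Injective i) (_ : Function.Exact i p) (_ : Function.Surjective p),
    FFR R d M' → FFR R d M'' → FFR R d M := by
  induction d with
  | zero =>
    intro M' M M'' _ _ _ _ _ _ i p hi hip hp h' h''
    obtain ⟨_, _⟩ := h'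
    obtain ⟨_, _⟩ := h''
    obtain ⟨s, hs⟩ := Module.projective_lifting_property p LinearMap.id hp
    obtain ⟨e, _⟩ := hip.splitSurjectiveEquiv hi ⟨s, hs⟩
    exact ⟨Module.Finite.equiv e.symm, Module.Free.of_equiv e.symm⟩
  | succ d ih =>
    intro M' M M'' _ _ _ _ _ _ i p hi hip hp h' h''
    obtain ⟨a, f', hf', hk'⟩ := h'
    obtain ⟨b, f'', hf'', hk''⟩ := h''
    obtain ⟨h, hh⟩ := Module.projective_lifting_property p f'' hp
    have hh' : ∀ y, p (h y) = f'' y := fun y => congrArg (fun φ => φ y) hh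
    have hpi : ∀ x, p (i x) = 0 := fun x => (hip _).mpr ⟨x, rfl⟩
    let q : ((Fin a → R) × (Fin b → R)) →ₗ[R] M := (i.comp f').coprod h
    have hq : ∀ x y, q (x, y) = i (f' x) + h y := fun x y => rfl
    have hqs : Function.Surjective q := by
      intro m
      obtain ⟨y, hy⟩ := hf'' (p m)
      obtain ⟨m', hm'⟩ := (hip (m - h y)).mp (by rw [map_sub, hh', hy, sub_self])
      obtain ⟨x, hx⟩ := hf' m'
      exact ⟨(x, y), by rw [hq, hx, hm']; abel⟩
    let j : LinearMap.ker f' →ₗ[R] LinearMap.ker q :=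
      ((LinearMap.inl R _ (Fin b → R)).comp (LinearMap.ker f').subtype).codRestrict _ (by
        intro x
        have := x.2
        rw [LinearMap.mem_ker] at this ⊢
        simp [q, this])
    let r : LinearMap.ker q →ₗ[R] LinearMap.ker f'' :=
      ((LinearMap.snd R (Fin a → R) (Fin b → R)).comp (LinearMap.ker q).subtype).codRestrict _ (by
        rintro ⟨⟨x, y⟩, hx⟩
        rw [LinearMap.mem_ker, hq] at hx
        have := congrArg p hx
        rw [map_add, hpi, hh', zero_add, map_zero] at this
        exact this)
    refine FFR.succ_of_ker q hqs (LinearEquiv.refl R _) (ih j r ?_ ?_ ?_ hk' hk'')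
    · intro x y hxy
      have := congrArg (fun z => z.1.1) hxy
      exact Subtype.ext this
    · rintro ⟨⟨x, y⟩, hx⟩
      constructor
      · intro h0
        have hy : y = 0 := congrArg Subtype.val h0
        subst hy
        rw [LinearMap.mem_ker, hq, map_zero, add_zero] at hx
        exact ⟨⟨x, hi (by rw [hx, map_zero])⟩, rfl⟩
      · rintro ⟨z, hz⟩
        rw [← hz]; rfl
    · rintro ⟨y, hy⟩
      obtain ⟨m', hm'⟩ := (hip (h y)).mp (by rw [hh']; exact hy)
      obtain ⟨x, hx⟩ := hf' m'
      exact ⟨⟨(-x, y), by rw [LinearMap.mem_ker, hq, map_neg, map_neg, hx, hm']; abel⟩, rfl⟩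

theorem FFR.coker {d : ℕ} {M' M M'' : Type u} [AddCommGroup M'] [Module R M'] [AddCommGroup M]
    [Module R M] [AddCommGroup M''] [Module R M''] (i : M' →ₗ[R] M) (p : M →ₗ[R] M'')
    (hi : Function.Injective i) (hip : Function.Exact i p) (hp : Function.Surjective p)
    (h' : FFR R d M') (h : FFR R d M) : FFR R (d + 1) M'' := by
  cases d with
  | zero =>
    obtain ⟨_, _⟩ := h
    exact FFR.succ_of_exact p hp i hi hip h'
  | succ d =>
    obtain ⟨a, f, hf, hk⟩ := h
    let q := p.comp f
    let e := LinearEquiv.ofInjective i hi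
    have hker : ∀ x, q x = 0 → f x ∈ LinearMap.range i := fun x hx => (hip _).mp hx
    let r : LinearMap.ker q →ₗ[R] LinearMap.range i :=
      (f.comp (LinearMap.ker q).subtype).codRestrict _ (fun x => hker x.1 x.2)
    let j : LinearMap.ker f →ₗ[R] LinearMap.ker q :=
      (LinearMap.ker f).subtype.codRestrict _ (by
        intro x
        have := x.2
        rw [LinearMap.mem_ker] at this ⊢
        simp [q, this])
    refine FFR.succ_of_ker q (hp.comp hf) (LinearEquiv.refl R _)
      (FFR.ext j r ?_ ?_ ?_ hk.succ (h'.of_equiv e))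
    · intro x y hxy
      exact Subtype.ext (congrArg (fun z => z.1) hxy)
    · rintro ⟨x, hx⟩
      constructor
      · intro h0
        exact ⟨⟨x, congrArg Subtype.val h0⟩, rfl⟩
      · rintro ⟨z, hz⟩
        rw [← hz]
        exact Subtype.ext z.2
    · rintro ⟨y, m', rfl⟩
      obtain ⟨x, hx⟩ := hf (i m')
      exact ⟨⟨x, by rw [LinearMap.mem_ker, LinearMap.comp_apply, hx]; exact (hip _).mpr ⟨_, rfl⟩⟩,
        Subtype.ext hx⟩

theorem FFR.free_of_projective (hR : Hermite R) {d : ℕ} : ∀ {M : Type u} [AddCommGroup M]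
    [Module R M] [Module.Projective R M], FFR R d M → Module.Free R M := by
  induction d with
  | zero => intro M _ _ _ h; exact h.2
  | succ d ih =>
    intro M _ _ _ h
    have := h.finite
    obtain ⟨a, f, hf, hk⟩ := h
    obtain ⟨s, hs⟩ := Module.projective_lifting_property f LinearMap.id hf
    obtain ⟨e, _⟩ := (LinearMap.exact_subtype_ker_map f).splitSurjectiveEquiv
      (Submodule.subtype_injective _) ⟨s, hs⟩
    have hP : Module.Projective R (LinearMap.ker f) :=
      Module.Projective.of_split (e.symm.toLinearMap.comp (LinearMap.inl R _ M))
        ((LinearMap.fst R _ M).comp e.toLinearMap) (by ext x; simp)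
    have hfin := hk.finite
    have hfree := ih hk
    exact QS.cancel (F := LinearMap.ker f) hR
      (Module.Free.of_equiv (e.trans (LinearEquiv.prodComm R _ _)))

theorem FFR.of_ringEquiv {S : Type u} [CommRing S] (σ : R ≃+* S) {d : ℕ} :
    ∀ {M N : Type u} [AddCommGroup M] [Module R M] [AddCommGroup N] [Module S N] (φ : M ≃+ N)
    (_ : ∀ (r : R) (x : M), φ (r • x) = σ r • φ x), FFR R d M → FFR S d N := by
  induction d with
  | zero =>
    intro M N _ _ _ _ φ hφ h
    obtain ⟨h1, h2⟩ := h
    obtain ⟨m, ⟨e⟩⟩ := exists_fin_equiv (R := R) M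
    have e' : (Fin m → S) ≃ₗ[S] N :=
      { toFun := fun v => φ (e (fun i => σ.symm (v i)))
        invFun := fun x i => σ (e.symm (φ.symm x) i)
        left_inv := by intro v; ext i; simp
        right_inv := by intro v; simp
        map_add' := by
          intro v w
          rw [← map_add, ← map_add]; congr 2; ext i; simp
        map_smul' := by
          intro c v
          have : (fun i => σ.symm ((c • v) i)) = σ.symm c • fun i => σ.symm (v i) := by
            ext i; simp
          rw [this, map_smul, hφ]; simp }
    exact ⟨Module.Finite.equiv e', Module.Free.of_equiv e'⟩
  | succ d ih =>
    intro M N _ _ _ _ φ hφ h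
    obtain ⟨m, f, hf, hk⟩ := h
    let f' : (Fin m → S) →ₗ[S] N :=
      { toFun := fun v => φ (f (fun i => σ.symm (v i)))
        map_add' := by
          intro v w
          rw [← map_add, ← map_add]; congr 2; ext i; simp
        map_smul' := by
          intro c v
          have : (fun i => σ.symm ((c • v) i)) = σ.symm c • fun i => σ.symm (v i) := by
            ext i; simp
          rw [this, map_smul, hφ]; simp }
    have hf'a : ∀ v, f' v = φ (f (fun i => σ.symm (v i))) := fun v => rfl
    refine ⟨m, f', ?_, ?_⟩
    · intro y
      obtain ⟨v, hv⟩ := hf (φ.symm y)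
      exact ⟨fun i => σ (v i), by rw [hf'a]; simp [hv]⟩
    · refine ih (M := LinearMap.ker f)
        { toFun := fun v => ⟨fun i => σ (v.1 i), by
            have := v.2
            rw [LinearMap.mem_ker] at this ⊢
            rw [hf'a]; simp [this]⟩
          invFun := fun v => ⟨fun i => σ.symm (v.1 i), by
            have := v.2
            rw [LinearMap.mem_ker, hf'a] at this
            rw [LinearMap.mem_ker]
            exact φ.injective (by rw [this, map_zero])⟩
          left_inv := by intro v; ext i; simp
          right_inv := by intro v; ext i; simp
          map_add' := by intro v w; ext i; simp } ?_ hk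
      intro r x
      ext i; simp

def Good (R : Type u) [CommRing R] (d : ℕ) : Prop :=
  ∀ (M : Type u) [AddCommGroup M] [Module R M] [Module.Finite R M], FFR R d M

theorem Good.of_equiv {S : Type u} [CommRing S] (σ : R ≃+* S) {d : ℕ} (h : Good R d) :
    Good S d := by
  intro M _ _ _
  letI : Module R M := Module.compHom M (σ : R →+* S)
  have hsm : ∀ (r : R) (x : M), r • x = σ r • x := fun _ _ => rfl
  have : Module.Finite R M := by
    obtain ⟨s, hs⟩ := (Module.Finite.fg_top : (⊤ : Submodule S M).FG)
    refine ⟨⟨s, ?_⟩⟩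
    rw [eq_top_iff]
    intro x _
    have hx : x ∈ Submodule.span S (s : Set M) := by rw [hs]; trivial
    induction hx using Submodule.span_induction with
    | mem x h => exact Submodule.subset_span h
    | zero => exact zero_mem _
    | add x y _ _ hx hy => exact add_mem (hx trivial) (hy trivial)
    | smul c x _ hx =>
      have : c • x = σ.symm c • x := by rw [hsm]; simp
      rw [this]; exact Submodule.smul_mem _ _ (hx trivial)
  exact FFR.of_ringEquiv σ (AddEquiv.refl M) (fun r x => hsm r x) (h M)

theorem good_pid [IsDomain R] [IsPrincipalIdealRing R] : Good R 1 := by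
  intro M _ _ _
  obtain ⟨a, g, hg⟩ := Module.Finite.exists_fin' R M
  exact ⟨a, g, hg, inferInstance, inferInstance⟩

end ffr
end QS

namespace QS
open Polynomial TensorProduct

universe u v w

section base
variable {A : Type u} [CommRing A]

theorem FFR.baseChange {d : ℕ} : ∀ {L : Type u} [AddCommGroup L] [Module A L],
    FFR A d L → FFR A[X] d (A[X] ⊗[A] L) := by
  induction d with
  | zero =>
    intro L _ _ h
    have := h.1
    have := h.2
    exact ⟨inferInstance, inferInstance⟩
  | succ d ih =>
    intro L _ _ h
    obtain ⟨m, f, hf, hk⟩ := h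
    refine FFR.succ_of_exact (LinearMap.baseChange A[X] f) (LinearMap.lTensor_surjective A[X] hf)
      (LinearMap.baseChange A[X] (LinearMap.ker f).subtype)
      (Module.Flat.lTensor_preserves_injective_linearMap (M := A[X]) _
        (LinearMap.ker f).injective_subtype) ?_ (ih hk)
    exact lTensor_exact A[X] (LinearMap.exact_subtype_ker_map f) hf

theorem FFR.polyModule {d : ℕ} {L : Type u} [AddCommGroup L] [Module A L] (h : FFR A d L) :
    FFR A[X] d (PolynomialModule A L) :=
  h.baseChange.of_equiv (PolynomialModule.polynomialTensorProductLEquivPolynomialModule A L)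

end base

section seq
variable {A : Type u} [CommRing A] {N : Type v} [AddCommGroup N] [Module A N] [Module A[X] N]
  [IsScalarTower A A[X] N]

/-- evaluation -/
noncomputable def pMap (L : Submodule A N) : PolynomialModule A L →ₗ[A[X]] N where
  toFun f := f.coeff.sum fun i l => (X : A[X]) ^ i • (l : N)
  map_add' a b := by
    rw [PolynomialModule.coeff_add]
    refine Finsupp.sum_add_index' ?_ ?_
    · simp
    · simp
  map_smul' r f := by
    induction f using PolynomialModule.induction_linear with
    | zero => simp
    | add f g e₁ e₂ =>
      rw [smul_add, PolynomialModule.coeff_add, PolynomialModule.coeff_add]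
      rw [Finsupp.sum_add_index' (by simp) (by simp), Finsupp.sum_add_index' (by simp) (by simp),
        e₁, e₂, smul_add]
    | single i m =>
      induction r using Polynomial.induction_on' with
      | add _ _ e₁ e₂ =>
        rw [add_smul, PolynomialModule.coeff_add,
          Finsupp.sum_add_index' (by simp) (by simp), e₁, e₂, RingHom.id_apply, RingHom.id_apply,
          RingHom.id_apply, add_smul]
      | monomial j a =>
        rw [PolynomialModule.monomial_smul_single, PolynomialModule.coeff_single,
          PolynomialModule.coeff_single, Finsupp.sum_single_index (by simp),
          Finsupp.sum_single_index (by simp), RingHom.id_apply, ← C_mul_X_pow_eq_monomial,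
          mul_smul, ← mul_smul (X ^ j : A[X]), ← pow_add, Submodule.coe_smul,
          ← algebraMap_smul A[X] a (m : N), Polynomial.algebraMap_eq, smul_comm]

theorem pMap_single (L : Submodule A N) (i : ℕ) (l : L) :
    pMap L (PolynomialModule.single A i l) = (X : A[X]) ^ i • (l : N) := by
  change ((PolynomialModule.single A i l).coeff.sum fun i (l : L) => (X : A[X]) ^ i • (l : N)) = _
  rw [PolynomialModule.coeff_single, Finsupp.sum_single_index (by simp)]

/-- mult by X as map L' to L -/
noncomputable def xMap (L' L : Submodule A N) (hX : ∀ l ∈ L', (X : A[X]) • l ∈ L) : L' →ₗ[A] L where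
  toFun l := ⟨(X : A[X]) • (l : N), hX l l.2⟩
  map_add' a b := by ext; simp
  map_smul' r a := by
    ext
    simp only [Submodule.coe_smul, RingHom.id_apply]
    exact smul_comm (X : A[X]) r (a : N)

/-- extension to polynomials -/
noncomputable def eMap {L' L : Type*} [AddCommGroup L] [AddCommGroup L'] [Module A L] [Module A L']
    (f : L' →ₗ[A] L) : PolynomialModule A L' →ₗ[A[X]] PolynomialModule A L where
  toFun := PolynomialModule.map A f
  map_add' a b := map_add _ _ _
  map_smul' r a := by
    rw [PolynomialModule.map_smul]; simp

theorem eMap_coeff {L' L : Type*} [AddCommGroup L] [AddCommGroup L'] [Module A L] [Module A L']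
    (f : L' →ₗ[A] L) (h : PolynomialModule A L') (i : ℕ) :
    (eMap f h).coeff i = f (h.coeff i) := rfl

theorem eMap_single {L' L : Type*} [AddCommGroup L] [AddCommGroup L'] [Module A L] [Module A L']
    (f : L' →ₗ[A] L) (i : ℕ) (l : L') :
    (eMap f (PolynomialModule.single A i l)) = PolynomialModule.single A i (f l) :=
  PolynomialModule.map_single _ _ _ _

/-- the first map -/
noncomputable def iMap (L' L : Submodule A N) (hle : L' ≤ L)
    (hX : ∀ l ∈ L', (X : A[X]) • l ∈ L) : PolynomialModule A L' →ₗ[A[X]] PolynomialModule A L :=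
  (X : A[X]) • eMap (Submodule.inclusion hle) - eMap (xMap L' L hX)

theorem iMap_apply (L' L : Submodule A N) (hle : L' ≤ L)
    (hX : ∀ l ∈ L', (X : A[X]) • l ∈ L) (h) : iMap L' L hle hX h =
     (X : A[X]) • eMap (Submodule.inclusion hle) h - eMap (xMap L' L hX) h := rfl

theorem coeff_sub' {L : Type*} [AddCommGroup L] [Module A L] (f g : PolynomialModule A L) (i : ℕ) :
    (f - g).coeff i = f.coeff i - g.coeff i := rfl

theorem iMap_coeff_zero (L' L : Submodule A N) (hle : L' ≤ L)
    (hX : ∀ l ∈ L', (X : A[X]) • l ∈ L) (h) :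
    ((iMap L' L hle hX h).coeff 0 : N) = - ((X : A[X]) • (h.coeff 0 : N)) := by
  rw [iMap_apply, coeff_sub', eMap_coeff, ← monomial_one_one_eq_X,
    PolynomialModule.monomial_smul_apply]
  simp [xMap, monomial_one_one_eq_X]

theorem iMap_coeff_succ (L' L : Submodule A N) (hle : L' ≤ L)
    (hX : ∀ l ∈ L', (X : A[X]) • l ∈ L) (h) (j : ℕ) :
    ((iMap L' L hle hX h).coeff (j + 1) : N) =
      (h.coeff j : N) - ((X : A[X]) • (h.coeff (j + 1) : N)) := by
  rw [iMap_apply, coeff_sub', eMap_coeff, ← monomial_one_one_eq_X,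
    PolynomialModule.monomial_smul_apply]
  simp [xMap, eMap_coeff, monomial_one_one_eq_X]

theorem iMap_injective (L' L : Submodule A N) (hle : L' ≤ L)
    (hX : ∀ l ∈ L', (X : A[X]) • l ∈ L) : Function.Injective (iMap L' L hle hX) := by
  rw [injective_iff_map_eq_zero]
  intro h hh
  have h1 : ∀ j, (h.coeff j : N) = (X : A[X]) • (h.coeff (j + 1) : N) := by
    intro j
    have := iMap_coeff_succ L' L hle hX h j
    rw [hh] at this
    exact sub_eq_zero.1 (this.symm.trans (by simp))
  have h2 : ∀ m j, (h.coeff j : N) = (X : A[X]) ^ m • (h.coeff (j + m) : N) := by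
    intro m
    induction m with
    | zero => simp
    | succ m ih => intro j; rw [ih j, h1 (j + m), ← mul_smul, ← pow_succ, add_assoc]
  obtain ⟨D, hD⟩ := h.coeff.support.exists_nat_subset_range
  ext j
  have : h.coeff (j + D) = 0 := by
    by_contra hne
    have := hD (Finsupp.mem_support_iff.2 hne)
    simp at this
  rw [h2 D j, this]
  simp

theorem pMap_iMap (L' L : Submodule A N) (hle : L' ≤ L)
    (hX : ∀ l ∈ L', (X : A[X]) • l ∈ L) (h) : pMap L (iMap L' L hle hX h) = 0 := by
  induction h using PolynomialModule.induction_linear with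
  | zero => simp
  | add f g e₁ e₂ => rw [map_add, map_add, e₁, e₂, add_zero]
  | single i m =>
    rw [iMap_apply, map_sub, map_smul, eMap_single, eMap_single, pMap_single, pMap_single]
    simp only [xMap, LinearMap.coe_mk, AddHom.coe_mk, Submodule.coe_inclusion]
    rw [smul_comm, sub_self]

theorem exact_iMap_pMap (L' L : Submodule A N) (hle : L' ≤ L)
    (hX : ∀ l ∈ L', (X : A[X]) • l ∈ L) (hX' : ∀ l, (X : A[X]) • l ∈ L → l ∈ L') :
    Function.Exact (iMap L' L hle hX) (pMap L) := by
  intro n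
  constructor
  swap
  · rintro ⟨h, rfl⟩
    exact pMap_iMap _ _ _ _ _
  intro hn
  obtain ⟨D, hD⟩ := n.coeff.support.exists_nat_subset_range
  have hz : ∀ j, D ≤ j → n.coeff j = 0 := by
    intro j hj
    by_contra hne
    have := hD (Finsupp.mem_support_iff.2 hne)
    simp at this
    omega
  let S : ℕ → N := fun i => ∑ j ∈ Finset.range D, (X : A[X]) ^ j • (n.coeff (i + j) : N)
  have hS : ∀ i, S i = (n.coeff i : N) + (X : A[X]) • S (i + 1) := by
    intro i
    have e1 : (X : A[X]) • S (i + 1) =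
        ∑ j ∈ Finset.range D, (X : A[X]) ^ (j + 1) • (n.coeff (i + (j + 1)) : N) := by
      simp only [S, Finset.smul_sum]
      refine Finset.sum_congr rfl fun j _ => ?_
      rw [← mul_smul, ← pow_succ', add_assoc, add_comm 1 j]
    have e2 := Finset.sum_range_succ (fun j => (X : A[X]) ^ j • (n.coeff (i + j) : N)) D
    have e3 := Finset.sum_range_succ' (fun j => (X : A[X]) ^ j • (n.coeff (i + j) : N)) D
    rw [e1]
    rw [hz (i + D) (by omega)] at e2
    simp only [ZeroMemClass.coe_zero, smul_zero, add_zero] at e2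
    change ∑ j ∈ Finset.range D, (X : A[X]) ^ j • (n.coeff (i + j) : N) = _
    rw [← e2, e3, add_comm]
    simp
  have hS0 : S 0 = 0 := by
    rw [← hn]
    change _ = n.coeff.sum fun i (l : L) => (X : A[X]) ^ i • (l : N)
    rw [Finsupp.sum_of_support_subset _ hD _ (by simp)]
    simp [S]
  have hSD : ∀ i, D ≤ i → S i = 0 := by
    intro i hi
    refine Finset.sum_eq_zero fun j _ => ?_
    rw [hz (i + j) (by omega)]
    simp
  have hSL : ∀ i, S (i + 1) ∈ L' := by
    intro i
    induction i with
    | zero =>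
      apply hX'
      have := hS 0
      rw [hS0] at this
      rw [← neg_eq_of_add_eq_zero_right this.symm]
      exact L.neg_mem (n.coeff 0).2
    | succ i ih =>
      apply hX'
      have := hS (i + 1)
      rw [← sub_eq_iff_eq_add'.2 this]
      exact L.sub_mem (hle ih) (n.coeff (i+1)).2
  refine ⟨PolynomialModule.ofCoeff A (Finsupp.onFinset (Finset.range D)
    (fun i => (⟨S (i + 1), hSL i⟩ : L')) ?_), ?_⟩
  · intro i hi
    by_contra hne
    apply hi
    simp only [Finset.mem_range, not_lt] at hne
    ext
    exact hSD _ (by omega)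
  · ext j
    cases j with
    | zero =>
      rw [iMap_coeff_zero]
      have := hS 0
      rw [hS0] at this
      exact (eq_neg_of_add_eq_zero_left this.symm).symm
    | succ j =>
      rw [iMap_coeff_succ]
      exact sub_eq_iff_eq_add.2 (hS (j + 1))

theorem pMap_surjective (L : Submodule A N) (hL : Submodule.span A[X] (L : Set N) = ⊤) :
    Function.Surjective (pMap L) := by
  rw [← LinearMap.range_eq_top, eq_top_iff, ← hL, Submodule.span_le]
  intro l hl
  exact ⟨PolynomialModule.single A 0 ⟨l, hl⟩, by rw [pMap_single]; simp⟩

end seq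

theorem FFR.of_seq {A : Type u} [CommRing A] {N : Type u} [AddCommGroup N] [Module A N]
    [Module A[X] N] [IsScalarTower A A[X] N] (L' L : Submodule A N) (hle : L' ≤ L)
    (hX : ∀ l ∈ L', (X : A[X]) • l ∈ L) (hX' : ∀ l, (X : A[X]) • l ∈ L → l ∈ L')
    (hL : Submodule.span A[X] (L : Set N) = ⊤) {g : ℕ} (h' : FFR A g L') (h : FFR A g L) :
    FFR A[X] (g + 1) N :=
  FFR.coker (iMap L' L hle hX) (pMap L) (iMap_injective _ _ _ _) (exact_iMap_pMap _ _ _ _ hX')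
    (pMap_surjective L hL) h'.polyModule h.polyModule

end QS

namespace QS
open Polynomial

universe u v w

section step
variable {A : Type u} [CommRing A]

/-- bounded degree part -/
noncomputable def bd {a : ℕ} (N : Submodule A[X] (Fin a → A[X])) (e : ℕ) : Submodule A N :=
  (Submodule.pi Set.univ (fun _ : Fin a => degreeLT A e)).comap (N.subtype.restrictScalars A)

theorem mem_bd {a : ℕ} (N : Submodule A[X] (Fin a → A[X])) (e : ℕ) (l : N) :
    l ∈ bd N e ↔ ∀ i j, e ≤ j → ((l : Fin a → A[X]) i).coeff j = 0 := by
  simp only [bd, Submodule.mem_comap, Submodule.mem_pi, Set.mem_univ, true_imp_iff, mem_degreeLT,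
    degree_lt_iff_coeff_zero]
  rfl

theorem ffr_bd (hA : Hermite A) {g : ℕ} (h : Good A (g + 1)) {a : ℕ}
    (N : Submodule A[X] (Fin a → A[X])) (e : ℕ) : FFR A g (bd N e) := by
  have : Module.Finite A (degreeLT A e) := Module.Finite.equiv (degreeLTEquiv A e).symm
  have : Module.Free A (degreeLT A e) := Module.Free.of_equiv (degreeLTEquiv A e).symm
  let φ : (Fin a → degreeLT A e) →ₗ[A] (Fin a → A[X]) :=
    LinearMap.compLeft (degreeLT A e).subtype (Fin a)
  have hφ : Function.Injective φ := by
    intro x y hxy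
    ext1 i
    exact Subtype.ext (congrFun hxy i)
  let W : Submodule A (Fin a → degreeLT A e) := (N.restrictScalars A).comap φ
  have hW : FFR A g W := by
    have := FFR.ker hA (h ((Fin a → degreeLT A e) ⧸ W)) W.mkQ W.mkQ_surjective
    rwa [Submodule.ker_mkQ] at this
  let ψ : W →ₗ[A] bd N e :=
    { toFun := fun w => ⟨⟨φ w, w.2⟩, fun i _ => (w.1 i).2⟩
      map_add' := fun x y => by ext : 2; exact map_add φ _ _
      map_smul' := fun r y => by ext : 2; exact map_smul φ _ _ }
  refine hW.of_equiv (LinearEquiv.ofBijective ψ ⟨?_, ?_⟩)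
  · intro x y hxy
    apply Subtype.ext
    apply hφ
    exact congrArg (fun z : bd N e => ((z : N) : Fin a → A[X])) hxy
  · intro y
    exact ⟨⟨fun i => ⟨y.1.1 i, y.2 i trivial⟩, y.1.2⟩, rfl⟩

theorem exists_bd_span [IsNoetherianRing A] {a : ℕ} (N : Submodule A[X] (Fin a → A[X])) :
    ∃ e, Submodule.span A[X] (bd N (e + 1) : Set N) = ⊤ := by
  obtain ⟨s, hs⟩ := (Module.Finite.fg_top : (⊤ : Submodule A[X] N).FG)
  refine ⟨s.sup fun l => Finset.univ.sup fun i => ((l : Fin a → A[X]) i).natDegree, ?_⟩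
  rw [eq_top_iff, ← hs]
  apply Submodule.span_mono
  intro l hl
  rw [SetLike.mem_coe, mem_bd]
  intro i j hj
  apply coeff_eq_zero_of_natDegree_lt
  have h1 : ((l : Fin a → A[X]) i).natDegree ≤
      Finset.univ.sup fun i => ((l : Fin a → A[X]) i).natDegree :=
    Finset.le_sup (f := fun i => ((l : Fin a → A[X]) i).natDegree) (Finset.mem_univ i)
  have h2 := Finset.le_sup (f := fun l : N => Finset.univ.sup fun i =>
    ((l : Fin a → A[X]) i).natDegree) hl
  omega

theorem good_poly [IsNoetherianRing A] (hA : Hermite A) {g : ℕ} (h : Good A (g + 1)) :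
    Good A[X] (g + 2) := by
  intro M _ _ _
  obtain ⟨a, f, hf⟩ := Module.Finite.exists_fin' A[X] M
  refine ⟨a, f, hf, ?_⟩
  obtain ⟨e, he⟩ := exists_bd_span (LinearMap.ker f)
  refine FFR.of_seq (bd _ e) (bd _ (e + 1)) ?_ ?_ ?_ he (ffr_bd hA h _ _) (ffr_bd hA h _ _)
  · intro l hl
    rw [mem_bd] at hl ⊢
    exact fun i j hj => hl i j (by omega)
  · intro l hl
    rw [mem_bd] at hl ⊢
    intro i j hj
    obtain ⟨j, rfl⟩ : ∃ j', j = j' + 1 := ⟨j - 1, by omega⟩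
    simpa using hl i j (by omega)
  · intro l hl
    rw [mem_bd] at hl ⊢
    intro i j hj
    simpa using hl i (j + 1) (by omega)

end step

theorem good_mv (k : Type u) [Field k] (n : ℕ) : Good (MvPolynomial (Fin (n + 1)) k) (n + 1) := by
  induction n with
  | zero =>
    exact Good.of_equiv (MvPolynomial.uniqueAlgEquiv k (Fin 1)).symm.toRingEquiv good_pid
  | succ n ih =>
    exact Good.of_equiv (MvPolynomial.finSuccEquiv k (n + 1)).symm.toRingEquiv
      (good_poly (hermite_mvPolynomial k (n + 1)) ih)

/-- free via projective, any universe -/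
theorem free_of_proj {R : Type u} [CommRing R] (hR : Hermite R) {d : ℕ} (hg : Good R d)
    (P : Type v) [AddCommGroup P] [Module R P] [Module.Finite R P] [Module.Projective R P] :
    Module.Free R P := by
  obtain ⟨m, f, hf⟩ := Module.Finite.exists_fin' R P
  let e := f.quotKerEquivOfSurjective hf
  have : Module.Projective R ((Fin m → R) ⧸ LinearMap.ker f) := Module.Projective.of_equiv e.symm
  have := FFR.free_of_projective hR (hg ((Fin m → R) ⧸ LinearMap.ker f))
  exact Module.Free.of_equiv e

/-- main induction -/
theorem syz_aux {R : Type u} [CommRing R] (hR : Hermite R) {d : ℕ}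
    (m : ℕ → ℕ) (δ : ∀ i : ℕ, (Fin (m (i + 1)) → R) →ₗ[R] (Fin (m i) → R))
    (hexact : ∀ i, LinearMap.ker (δ i) = LinearMap.range (δ (i + 1)))
    {M : Type u} [AddCommGroup M] [Module R M]
    (ε : (Fin (m 0) → R) →ₗ[R] M) (hε : Function.Surjective ε)
    (hexact0 : LinearMap.ker ε = LinearMap.range (δ 0)) (h : FFR R (d + 1) M) :
    FFR R d (LinearMap.ker ε) ∧ ∀ j, d = j + 1 → FFR R 0 (LinearMap.ker (δ j)) := by
  have h0 := FFR.ker hR h ε hε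
  refine ⟨h0, ?_⟩
  induction d generalizing m M with
  | zero => intro j hj; omega
  | succ d ih =>
    let ε' : (Fin (m 1) → R) →ₗ[R] LinearMap.ker ε :=
      (δ 0).codRestrict _ (fun x => by rw [hexact0]; exact ⟨x, rfl⟩)
    have hε' : Function.Surjective ε' := by
      rintro ⟨y, hy⟩
      obtain ⟨x, hx⟩ := hexact0 ▸ hy
      exact ⟨x, Subtype.ext hx⟩
    have hk : LinearMap.ker ε' = LinearMap.ker (δ 0) := LinearMap.ker_codRestrict _ _ _
    have h1 := FFR.ker hR h0 ε' hε'
    intro j hj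
    cases j with
    | zero =>
      obtain rfl : d = 0 := by omega
      rwa [hk] at h1
    | succ j =>
      exact ih (fun i => m (i + 1)) (fun i => δ (i + 1)) (fun i => hexact (i + 1)) ε' hε'
        (hk.trans (hexact 0)) h0 h1 j (by omega)

theorem conj_ker {R : Type u} [CommRing R] {F G : Type*} {F' G' : Type*} [AddCommGroup F]
    [AddCommGroup G] [AddCommGroup F'] [AddCommGroup G'] [Module R F] [Module R G] [Module R F']
    [Module R G'] (a : F ≃ₗ[R] F') (b : G ≃ₗ[R] G') (f : F' →ₗ[R] G') (x : F) :
    x ∈ LinearMap.ker (b.symm.toLinearMap.comp (f.comp a.toLinearMap)) ↔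
      a x ∈ LinearMap.ker f := by
  simp

theorem conj_range {R : Type u} [CommRing R] {F G : Type*} {F' G' : Type*} [AddCommGroup F]
    [AddCommGroup G] [AddCommGroup F'] [AddCommGroup G'] [Module R F] [Module R G] [Module R F']
    [Module R G'] (a : F ≃ₗ[R] F') (b : G ≃ₗ[R] G') (f : F' →ₗ[R] G') (x : G) :
    x ∈ LinearMap.range (b.symm.toLinearMap.comp (f.comp a.toLinearMap)) ↔
      b x ∈ LinearMap.range f := by
  simp only [LinearMap.mem_range, LinearMap.comp_apply, LinearEquiv.coe_coe]
  constructor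
  · rintro ⟨y, rfl⟩
    exact ⟨a y, by simp⟩
  · rintro ⟨y, hy⟩
    exact ⟨a.symm y, by simp [hy]⟩

theorem syz_main {R : Type u} [CommRing R] (hR : Hermite R) {d : ℕ} (hg : Good R (d + 2))
    (P : ℕ → Type v) [∀ i, AddCommGroup (P i)] [∀ i, Module R (P i)]
    [∀ i, Module.Projective R (P i)] [∀ i, Module.Finite R (P i)]
    (δ : ∀ i : ℕ, (P (i + 1) →ₗ[R] P i)) (ε : P 0 →ₗ[R] R)
    (hexact0 : LinearMap.ker ε = LinearMap.range (δ 0))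
    (hexact : ∀ i, LinearMap.ker (δ i) = LinearMap.range (δ (i + 1))) :
    (d = 0 → Module.Free R (LinearMap.ker ε)) ∧
    (∀ j : ℕ, d = j + 1 → Module.Free R (LinearMap.ker (δ j))) := by
  have hfree : ∀ i, Module.Free R (P i) := fun i => free_of_proj hR hg (P i)
  choose m e' using fun i => exists_fin_equiv (R := R) (P i)
  let e := fun i => (e' i).some
  have hI : FFR R (d + 1) (LinearMap.range ε) := by
    have := FFR.ker hR (hg (R ⧸ LinearMap.range ε)) (LinearMap.range ε).mkQ
      (Submodule.mkQ_surjective _)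
    rwa [Submodule.ker_mkQ] at this
  have hk0 : LinearMap.ker (ε.rangeRestrict.comp (e 0).toLinearMap) =
      LinearMap.ker (ε.comp (e 0).toLinearMap) := by
    rw [LinearMap.ker_comp, LinearMap.ker_comp, LinearMap.ker_rangeRestrict]
  have key := syz_aux hR m
    (fun i => (e i).symm.toLinearMap.comp ((δ i).comp (e (i + 1)).toLinearMap))
    (fun i => by
      ext x
      rw [conj_ker, conj_range, hexact i])
    (ε.rangeRestrict.comp (e 0).toLinearMap)
    (ε.surjective_rangeRestrict.comp (e 0).surjective)
    (by
      rw [hk0]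
      ext x
      rw [conj_range, ← hexact0]
      rfl) hI
  constructor
  · rintro rfl
    have h1 := key.1
    rw [hk0] at h1
    obtain ⟨b⟩ := ker_comp_equiv (e 0) ε
    have := h1.2
    exact Module.Free.of_equiv b
  · intro j hj
    have h1 := key.2 j hj
    have hk : LinearMap.ker ((e j).symm.toLinearMap.comp ((δ j).comp (e (j + 1)).toLinearMap)) =
        LinearMap.ker ((δ j).comp (e (j + 1)).toLinearMap) := by
      ext x
      rw [conj_ker]
      rfl
    rw [hk] at h1
    obtain ⟨b⟩ := ker_comp_equiv (e (j + 1)) (δ j)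
    have := h1.2
    exact Module.Free.of_equiv b

end QS

theorem syzygy_free
    (k : Type) [Field k] (n : ℕ) (hn : 2 ≤ n)
    (I : Ideal (MvPolynomial (Fin n) k))
    (P : ℕ → ModuleCat (MvPolynomial (Fin n) k))
    (hproj : ∀ i, Module.Projective (MvPolynomial (Fin n) k) (P i))
    (hfg : ∀ i, Module.Finite (MvPolynomial (Fin n) k) (P i))
    (δ : ∀ i : ℕ, (P (i + 1) →ₗ[MvPolynomial (Fin n) k] P i))
    (ε : P 0 →ₗ[MvPolynomial (Fin n) k] MvPolynomial (Fin n) k)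
    (hrange : LinearMap.range ε = I)
    (hexact0 : LinearMap.ker ε = LinearMap.range (δ 0))
    (hexact : ∀ i, LinearMap.ker (δ i) = LinearMap.range (δ (i + 1))) :
    (n = 2 → Module.Free (MvPolynomial (Fin n) k) (LinearMap.ker ε)) ∧
    (∀ j : ℕ, n = j + 3 →
      Module.Free (MvPolynomial (Fin n) k) (LinearMap.ker (δ j))) := by
  have hR := QS.hermite_mvPolynomial k n
  have hg : QS.Good (MvPolynomial (Fin n) k) n := by
    obtain ⟨n, rfl⟩ : ∃ n', n = n' + 1 := ⟨n - 1, by omega⟩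
    exact QS.good_mv k n
  obtain ⟨d, hd⟩ : ∃ d, n = d + 2 := ⟨n - 2, by omega⟩
  have hg' : QS.Good (MvPolynomial (Fin n) k) (d + 2) := hd ▸ hg
  have key := QS.syz_main hR hg' (fun i => P i) δ ε hexact0 hexact
  exact ⟨fun h => key.1 (by omega), fun j h => key.2 j (by omega)⟩
end

section
/- Let A be a Noetherian commutative ring and I ⊂ A a nonzero ideal admitting a finite free resolution by finitely generated free A-modules. Then the rank of I as an A-module equals 1. -/
open Module

lemma ffr_lTensor_inj {R : Type} [CommRing R] [IsLocalRing R] (x : R) (hx : x ≠ 0)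
    (hxm : ∀ a ∈ IsLocalRing.maximalIdeal R, a * x = 0)
    {M N : Type} [AddCommGroup M] [Module R M] [AddCommGroup N] [Module R N]
    [Module.Free R M] (f : M →ₗ[R] N) (hf : Function.Injective f) :
    Function.Injective (f.lTensor (IsLocalRing.ResidueField R)) := by
  let g : IsLocalRing.ResidueField R →ₗ[R] R :=
    (IsLocalRing.maximalIdeal R).liftQ (LinearMap.toSpanSingleton R R x)
      (fun a ha => by simpa using hxm a ha)
  have hg : Function.Injective g := by
    refine LinearMap.ker_eq_bot.mp (Submodule.ker_liftQ_eq_bot _ _ _ ?_)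
    intro a ha
    rw [IsLocalRing.mem_maximalIdeal, mem_nonunits_iff]
    intro hu
    apply hx
    have : a * x = 0 := by simpa using ha
    exact (hu.mul_right_eq_zero).mp this
  have h1 : Function.Injective (g.rTensor M) :=
    Module.Flat.rTensor_preserves_injective_linearMap g hg
  have h2 : Function.Injective (f.lTensor R) :=
    Module.Flat.lTensor_preserves_injective_linearMap f hf
  have h3 : (g.rTensor N) ∘ₗ (f.lTensor (IsLocalRing.ResidueField R))
      = (f.lTensor R) ∘ₗ (g.rTensor M) := by
    rw [LinearMap.rTensor_comp_lTensor, LinearMap.lTensor_comp_rTensor]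
  have h4 : Function.Injective
      ((g.rTensor N) ∘ₗ (f.lTensor (IsLocalRing.ResidueField R))) := by
    rw [h3]; exact h2.comp h1
  exact Function.Injective.of_comp (f := g.rTensor N) h4

lemma ffr_local {R : Type} [CommRing R] [IsLocalRing R] (x : R) (hx : x ≠ 0)
    (hxm : ∀ a ∈ IsLocalRing.maximalIdeal R, a * x = 0) (n : ℕ) :
    ∀ (F : ℕ → Type) [∀ i, AddCommGroup (F i)] [∀ i, Module R (F i)]
      [∀ i, Module.Free R (F i)] [∀ i, Module.Finite R (F i)]
      (M : Type) [AddCommGroup M] [Module R M]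
      (d : ∀ i, F (i + 1) →ₗ[R] F i) (g : F 0 →ₗ[R] M),
      Function.Surjective g → Function.Exact (d 0) g →
      (∀ i, Function.Exact (d (i + 1)) (d i)) → (∀ i, n ≤ i → Subsingleton (F i)) →
      Module.Free R M ∧ Module.Finite R M ∧
        (finrank R M : ℤ) = ∑ i ∈ Finset.range n, (-1) ^ i * (finrank R (F i) : ℤ) := by
  induction n with
  | zero =>
    intro F _ _ _ _ M _ _ d g hg _ _ hs
    have := hs 0 le_rfl
    have : Subsingleton M := hg.subsingleton
    exact ⟨inferInstance, inferInstance, by simp [Module.finrank_zero_of_subsingleton]⟩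
  | succ n ih =>
    intro F _ _ _ _ M _ _ d g hg h0 hd hs
    have hk : ∀ y, d 0 y ∈ LinearMap.ker g := fun y => (h0 _).mpr ⟨y, rfl⟩
    obtain ⟨k1, k2, k3⟩ := ih (fun i => F (i + 1)) (LinearMap.ker g) (fun i => d (i + 1))
      ((d 0).codRestrict _ hk)
      (by
        rintro ⟨y, hy⟩
        obtain ⟨z, rfl⟩ := (h0 _).mp hy
        exact ⟨z, rfl⟩)
      (by
        intro y
        rw [← hd 0 y]
        simp [Subtype.ext_iff])
      (fun i => hd (i + 1)) (fun i hi => hs (i + 1) (by omega))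
    have hex : Function.Exact (LinearMap.ker g).subtype g := LinearMap.exact_subtype_ker_map g
    have hinj := (LinearMap.ker g).injective_subtype
    have hfree : Module.Free R M := Module.free_of_lTensor_residueField_injective
      (LinearMap.ker g).subtype g hg hex (ffr_lTensor_inj x hx hxm _ hinj)
    have hfin : Module.Finite R M := Module.Finite.of_surjective g hg
    obtain ⟨s, hs⟩ := Module.projective_lifting_property g LinearMap.id hg
    have e := (hex.splitSurjectiveEquiv hinj ⟨s, hs⟩).1
    have h5 := e.finrank_eq
    rw [Module.finrank_prod] at h5
    refine ⟨hfree, hfin, ?_⟩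
    rw [Finset.sum_range_succ', h5]
    push_cast
    rw [k3, one_mul, ← add_assoc, ← Finset.sum_add_distrib,
      Finset.sum_eq_zero (fun i _ => by ring)]
    simp

lemma ffr_atPrime (A : Type) [CommRing A]
    (I : Ideal A) (N : ℕ) (r : ℕ → ℕ)
    (d : ∀ i : ℕ, ((Fin (r (i + 1)) → A) →ₗ[A] (Fin (r i) → A)))
    (ε : (Fin (r 0) → A) →ₗ[A] A)
    (hε : LinearMap.range ε = I)
    (h0 : LinearMap.ker ε = LinearMap.range (d 0))
    (hd : ∀ i, LinearMap.ker (d i) = LinearMap.range (d (i + 1)))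
    (hr : ∀ i, N < i → r i = 0)
    (P : Ideal A) [P.IsPrime] (y : A) (hy : ∀ a, a ∈ P ↔ a * y = 0) :
    Module.Free (Localization P.primeCompl) (LocalizedModule P.primeCompl I) ∧
    Module.Finite (Localization P.primeCompl) (LocalizedModule P.primeCompl I) ∧
    (finrank (Localization P.primeCompl) (LocalizedModule P.primeCompl I) : ℤ)
      = ∑ i ∈ Finset.range (N + 1), (-1) ^ i * (r i : ℤ) := by
  let S := P.primeCompl
  let R := Localization.AtPrime P
  have hx : algebraMap A R y ≠ 0 := by
    intro h
    rw [IsLocalization.map_eq_zero_iff S R] at h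
    obtain ⟨m, hm⟩ := h
    exact m.2 ((hy _).mpr hm)
  have hxm : ∀ a ∈ IsLocalRing.maximalIdeal R, a * algebraMap A R y = 0 := by
    intro a ha
    rw [← Localization.AtPrime.map_eq_maximalIdeal] at ha
    refine Submodule.span_induction (p := fun a _ => a * algebraMap A R y = 0) ?_ ?_ ?_ ?_ ha
    · rintro _ ⟨b, hb, rfl⟩
      rw [← map_mul, (hy b).mp hb, map_zero]
    · simp
    · intro a b _ _ h1 h2
      rw [add_mul, h1, h2, add_zero]
    · intro a b _ h
      rw [smul_eq_mul, mul_assoc, h, mul_zero]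
  have hgm : ∀ v, ε v ∈ I := fun v => hε ▸ ⟨v, rfl⟩
  let g : (Fin (r 0) → A) →ₗ[A] I := ε.codRestrict I hgm
  have hg : Function.Surjective g := by
    rintro ⟨a, ha⟩
    rw [← hε] at ha
    obtain ⟨v, rfl⟩ := ha
    exact ⟨v, rfl⟩
  have hg0 : Function.Exact (d 0) g := by
    rw [LinearMap.exact_iff, ← h0]
    exact LinearMap.ker_codRestrict _ _ _
  have hfree : ∀ i, Module.Free R (LocalizedModule S (Fin (r i) → A)) := fun i =>
    Module.free_of_isLocalizedModule S (LocalizedModule.mkLinearMap S (Fin (r i) → A))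
  have hfin : ∀ i, Module.Finite R (LocalizedModule S (Fin (r i) → A)) := fun i =>
    Module.Finite.of_isLocalizedModule S (LocalizedModule.mkLinearMap S (Fin (r i) → A))
  have key := ffr_local (R := R) (algebraMap A R y) hx hxm (N + 1)
    (fun i => LocalizedModule S (Fin (r i) → A)) (LocalizedModule S I)
    (fun i => LocalizedModule.map S (d i)) (LocalizedModule.map S g)
    (LocalizedModule.map_surjective S g hg)
    (LocalizedModule.map_exact S _ _ hg0)
    (fun i => LocalizedModule.map_exact S _ _ ((LinearMap.exact_iff).mpr (hd i)))
    (fun i hi => by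
      have : IsEmpty (Fin (r i)) := by rw [hr i (by omega)]; infer_instance
      infer_instance)
  refine ⟨key.1, key.2.1, key.2.2.trans (Finset.sum_congr rfl fun i _ => ?_)⟩
  have : Nontrivial A := ⟨⟨1, 0, fun h => ‹P.IsPrime›.ne_top
    ((Ideal.eq_top_iff_one _).mpr (h ▸ P.zero_mem))⟩⟩
  have : finrank R (LocalizedModule S (Fin (r i) → A)) = r i := by
    rw [Module.finrank_of_isLocalizedModule_of_free R S
      (LocalizedModule.mkLinearMap S (Fin (r i) → A))]
    simp
  rw [this]


/-- Let `A` be a Noetherian commutative ring and `I ⊆ A` a nonzero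
ideal admitting a finite free resolution by finitely generated free `A`-modules
`0 → A^{r_N} → ⋯ → A^{r_0} → I → 0`.  Then the rank of `I` as an `A`-module is `1`. -/
theorem rank_eq_one_of_finite_free_resolution
    (A : Type) [CommRing A] [IsNoetherianRing A]
    (I : Ideal A) (hI : I ≠ ⊥)
    (hFFR : ∃ (N : ℕ) (r : ℕ → ℕ)
        (d : ∀ i : ℕ, ((Fin (r (i + 1)) → A) →ₗ[A] (Fin (r i) → A)))
        (ε : (Fin (r 0) → A) →ₗ[A] A),
        LinearMap.range ε = I ∧
        LinearMap.ker ε = LinearMap.range (d 0) ∧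
        (∀ i, LinearMap.ker (d i) = LinearMap.range (d (i + 1))) ∧
        (∀ i, N < i → r i = 0)) :
    Module.rank A I = 1 := by
  obtain ⟨N, r, d, ε, hε, h0, hd, hr⟩ := hFFR
  have key := ffr_atPrime A I N r d ε hε h0 hd hr
  obtain ⟨z, hzI, hz0⟩ := Submodule.exists_mem_ne_zero_of_ne_bot hI
  have : Nontrivial A := ⟨⟨z, 0, hz0⟩⟩
  have : Nontrivial I := ⟨⟨⟨z, hzI⟩, 0, fun h => hz0 (congrArg Subtype.val h)⟩⟩
  have hreg : ∃ w ∈ I, ∀ a, a * w = 0 → a = 0 := by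
    by_contra! hcon
    have hsub : (I : Set A) ⊆ ⋃ p ∈ associatedPrimes A A, (p : Set A) := by
      rw [biUnion_associatedPrimes_eq_zero_divisors]
      intro w hw
      obtain ⟨a, h1, h2⟩ := hcon w hw
      exact ⟨a, h2, by rw [smul_eq_mul, mul_comm]; exact h1⟩
    obtain ⟨P, hP, hIP⟩ := (I.subset_union_prime_finite (associatedPrimes.finite A A)
      (f := id) 0 0 fun _ h _ _ ↦ h.1).1 hsub
    obtain ⟨hPp, y, hy⟩ := isAssociatedPrime_iff.mp hP
    have hy' : ∀ a, a ∈ P ↔ a * y = 0 := by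
      intro a; rw [hy, Submodule.mem_colon_singleton]; simp
    obtain ⟨f1, f2, f3⟩ := key P y hy'
    have hann : ∀ t : LocalizedModule P.primeCompl I,
        algebraMap A (Localization P.primeCompl) y • t = 0 := by
      intro t
      induction t using LocalizedModule.induction_on with
      | h m s =>
        rw [algebraMap_smul, LocalizedModule.smul'_mk]
        have : y • m = 0 := by
          ext
          have := (hy' m).mp (hIP m.2)
          simpa [mul_comm] using this
        rw [this, LocalizedModule.zero_mk]
    have hyne : algebraMap A (Localization P.primeCompl) y ≠ 0 := by
      intro h
      rw [IsLocalization.map_eq_zero_iff P.primeCompl] at h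
      obtain ⟨m, hm⟩ := h
      exact m.2 ((hy' _).mpr hm)
    have hfr : finrank (Localization P.primeCompl) (LocalizedModule P.primeCompl I) = 0 := by
      by_contra hne
      let b := Module.finBasis (Localization P.primeCompl) (LocalizedModule P.primeCompl I)
      have i : Fin (finrank (Localization P.primeCompl) (LocalizedModule P.primeCompl I)) :=
        ⟨0, Nat.pos_of_ne_zero hne⟩
      apply hyne
      have := congrArg (fun t => b.repr t i) (hann (b i))
      simp only [map_smul, Finsupp.smul_apply, Module.Basis.repr_self, Finsupp.single_eq_same,
        smul_eq_mul, mul_one, map_zero, Finsupp.zero_apply] at this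
      exact this
    rw [hfr] at f3
    obtain ⟨Q, hQ⟩ := associatedPrimes.nonempty A I
    obtain ⟨hQp, q, hq⟩ := isAssociatedPrime_iff.mp hQ
    have hq' : ∀ a, a ∈ Q ↔ a * (q : A) = 0 := by
      intro a; rw [hq, Submodule.mem_colon_singleton]; simp [Subtype.ext_iff]
    obtain ⟨e1, e2, e3⟩ := key Q q hq'
    rw [← f3] at e3
    have e4 : finrank (Localization Q.primeCompl) (LocalizedModule Q.primeCompl I) = 0 := by
      exact_mod_cast e3
    have : Nontrivial (Localization Q.primeCompl) :=
      inferInstanceAs (Nontrivial (Localization.AtPrime Q))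
    have hsub := (Module.finBasisOfFinrankEq
      (Localization Q.primeCompl) (LocalizedModule Q.primeCompl I) e4).repr.toEquiv.subsingleton
    have : LocalizedModule.mkLinearMap Q.primeCompl I q = 0 := Subsingleton.elim _ _
    rw [← LinearMap.mem_ker, LocalizedModule.mem_ker_mkLinearMap_iff] at this
    obtain ⟨s, hs, hs2⟩ := this
    exact hs ((hq' s).mpr (by simpa using congrArg Subtype.val hs2))
  obtain ⟨w, hw, hreg⟩ := hreg
  apply le_antisymm
  · simpa using Submodule.rank_le I
  · rw [Module.one_le_rank_iff]
    refine ⟨LinearMap.toSpanSingleton A I ⟨w, hw⟩, (injective_iff_map_eq_zero _).mpr ?_⟩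
    intro a ha
    exact hreg a (by simpa using congrArg Subtype.val ha)
end

section
/- Let m ≥ 2 and J = (f_1,...,f_m) ⊂ k[s,t,u] be a homogeneous ideal with gcd(f_1,...,f_m) = 1 and deg(f_i) ≤ d for all i. Then the Castelnuovo–Mumford regularity of J satisfies reg(J) ≤ 3d − 2. -/
open MvPolynomial

abbrev S3 (k : Type) [Field k] := MvPolynomial (Fin 3) k

/-- A minimal *graded* free resolution
`0 → ⊕ᵢ S(−deg2 i) → ⊕ᵢ S(−deg1 i) → ⊕ᵢ S(−deg0 i) → J → 0` of a homogeneous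
ideal `J ⊆ S = k[s,t,u]`.  The maps are graded (each matrix entry is
homogeneous of the appropriate degree) and minimal (all entries of the
differentials have zero constant coefficient, i.e. lie in `m = (s,t,u)`), so
the twists `degᵢ` are the graded Betti degrees of `J`. -/
structure GradedMinFreeRes (k : Type) [Field k] (J : Ideal (S3 k)) where
  b0 : ℕ
  b1 : ℕ
  b2 : ℕ
  deg0 : Fin b0 → ℕ
  deg1 : Fin b1 → ℕ
  deg2 : Fin b2 → ℕ
  ε : (Fin b0 → S3 k) →ₗ[S3 k] S3 k
  d1 : (Fin b1 → S3 k) →ₗ[S3 k] (Fin b0 → S3 k)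
  d2 : (Fin b2 → S3 k) →ₗ[S3 k] (Fin b1 → S3 k)
  range_eps : LinearMap.range ε = J
  exact1 : LinearMap.ker ε = LinearMap.range d1
  exact2 : LinearMap.ker d1 = LinearMap.range d2
  inj2 : LinearMap.ker d2 = ⊥
  min1 : ∀ x i, constantCoeff (d1 x i) = 0
  min2 : ∀ x i, constantCoeff (d2 x i) = 0
  hom0 : ∀ i, (ε (Pi.single i 1)).IsHomogeneous (deg0 i)
  hom1 : ∀ i j, d1 (Pi.single j 1) i = 0 ∨
    (deg0 i ≤ deg1 j ∧ (d1 (Pi.single j 1) i).IsHomogeneous (deg1 j - deg0 i))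
  hom2 : ∀ i j, d2 (Pi.single j 1) i = 0 ∨
    (deg1 i ≤ deg2 j ∧ (d2 (Pi.single j 1) i).IsHomogeneous (deg2 j - deg1 i))


section Helpers

attribute [local instance] MvPolynomial.gradedAlgebra

theorem hc_mul {k : Type} [Field k] {a n : ℕ} (p q : S3 k) (hq : q.IsHomogeneous a) :
    homogeneousComponent n (p * q) =
      if a ≤ n then homogeneousComponent (n - a) p * q else 0 := by
  have h := DirectSum.coe_decompose_mul_of_right_mem (homogeneousSubmodule (Fin 3) k)
    (a := p) (b := q) (i := a) n hq
  have hd : ∀ (r : S3 k) (l : ℕ),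
      ((DirectSum.decompose (homogeneousSubmodule (Fin 3) k) r l : _) : S3 k)
        = homogeneousComponent l r := fun r l => decomposition.decompose'_apply r l
  rw [hd, hd] at h
  exact h

/-- homogeneous vectors in a twisted free module -/
def GH {k : Type} [Field k] {ι : Type} (deg : ι → ℕ) (n : ℕ) (x : ι → S3 k) : Prop :=
  ∀ i, x i = 0 ∨ (deg i ≤ n ∧ (x i).IsHomogeneous (n - deg i))

theorem GH.zero_of_lt {k : Type} [Field k] {ι : Type} {deg : ι → ℕ} {n : ℕ} {x : ι → S3 k}
    (h : GH deg n x) {i : ι} (hi : n < deg i) : x i = 0 := by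
  rcases h i with h | h
  · exact h
  · omega

theorem GH.add {k : Type} [Field k] {ι : Type} {deg : ι → ℕ} {n : ℕ} {x y : ι → S3 k}
    (hx : GH deg n x) (hy : GH deg n y) : GH deg n (x + y) := by
  intro i
  rcases hx i with h | ⟨h, h'⟩
  · rcases hy i with g | ⟨g, g'⟩
    · left; simp [h, g]
    · right; refine ⟨g, ?_⟩; simpa [h] using g'
  · rcases hy i with g | ⟨g, g'⟩
    · right; refine ⟨h, ?_⟩; simpa [g] using h'
    · right; exact ⟨h, h'.add g'⟩

theorem GH.smul {k : Type} [Field k] {ι : Type} {deg : ι → ℕ} {n a : ℕ} {x : ι → S3 k}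
    (hx : GH deg n x) {p : S3 k} (hp : p.IsHomogeneous a) : GH deg (a + n) (p • x) := by
  intro i
  rcases hx i with h | ⟨h, h'⟩
  · left; simp [h]
  · right
    refine ⟨by omega, ?_⟩
    have := hp.mul h'
    rw [show a + n - deg i = a + (n - deg i) by omega]
    simpa using this

theorem GH.neg {k : Type} [Field k] {ι : Type} {deg : ι → ℕ} {n : ℕ} {x : ι → S3 k}
    (hx : GH deg n x) : GH deg n (-x) := by
  intro i
  rcases hx i with h | ⟨h, h'⟩
  · left; simp [h]
  · right
    exact ⟨h, h'.neg⟩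

theorem GH.single {k : Type} [Field k] {ι : Type} [DecidableEq ι] (deg : ι → ℕ) (j : ι) :
    GH deg (deg j) (Pi.single j (1 : S3 k)) := by
  intro i
  by_cases h : i = j
  · subst h
    right
    simpa using isHomogeneous_one (Fin 3) k
  · left; simp [h]

theorem graded_lift {k : Type} [Field k] {ι κ : Type} [Fintype ι] [DecidableEq ι]
    (dι : ι → ℕ) (dκ : κ → ℕ) (L : (ι → S3 k) →ₗ[S3 k] (κ → S3 k))
    (hA : ∀ i j, L (Pi.single j 1) i = 0 ∨
      (dκ i ≤ dι j ∧ (L (Pi.single j 1) i).IsHomogeneous (dι j - dκ i)))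
    (n : ℕ) (x : ι → S3 k) (hy : GH dκ n (L x)) :
    ∃ x', GH dι n x' ∧ L x' = L x := by
  classical
  have hL : ∀ (z : ι → S3 k) (i : κ), L z i = ∑ j, z j * L (Pi.single j 1) i := by
    intro z i
    conv_lhs => rw [LinearMap.pi_apply_eq_sum_univ L z]
    simp only [Finset.sum_apply, Pi.smul_apply, smul_eq_mul]
    refine Finset.sum_congr rfl fun j _ => ?_
    have hs : (Pi.single j 1 : ι → S3 k) = fun l => if j = l then 1 else 0 := by
      funext l
      simp [Pi.single_apply, eq_comm]
    rw [hs]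
  refine ⟨fun j => if dι j ≤ n then homogeneousComponent (n - dι j) (x j) else 0, ?_, ?_⟩
  · intro j
    by_cases h : dι j ≤ n
    · right
      simp only [h, if_true, true_and]
      exact homogeneousComponent_isHomogeneous _ _
    · left; simp [h]
  · ext1 i
    by_cases hi : dκ i ≤ n
    · have hy' : homogeneousComponent (n - dκ i) (L x i) = L x i := by
        rcases hy i with h | ⟨_, h⟩
        · simp [h]
        · exact homogeneousComponent_eq_self h
      rw [← hy', hL, hL x, map_sum]
      refine Finset.sum_congr rfl fun j _ => ?_
      rcases hA i j with h | ⟨h, h'⟩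
      · simp [h]
      · rw [hc_mul _ _ h']
        by_cases hj : dι j ≤ n
        · rw [if_pos hj, if_pos (by omega), show n - dκ i - (dι j - dκ i) = n - dι j by omega]
        · rw [if_neg hj, if_neg (by omega), zero_mul]
    · rw [hy.zero_of_lt (by omega), hL]
      refine Finset.sum_eq_zero fun j _ => ?_
      rcases hA i j with h | ⟨h, h'⟩
      · simp [h]
      · rw [if_neg (by omega), zero_mul]

theorem dvd_of_gcd_unit {k : Type} [Field k] {ι : Type} [Fintype ι] (g : ι → S3 k)
    (hg : ∀ p : S3 k, (∀ i, p ∣ g i) → IsUnit p) (q h : S3 k) (H : ∀ l, q ∣ g l * h) : q ∣ h := by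
  classical
  obtain ⟨inst⟩ : Nonempty (NormalizedGCDMonoid (S3 k)) := inferInstance
  have h1 : q ∣ Finset.univ.gcd (fun l => g l * h) := Finset.dvd_gcd fun l _ => H l
  have h2 := h1.trans (Finset.gcd_mul_right' (s := Finset.univ) (f := g) h).dvd
  have hu : IsUnit (Finset.univ.gcd g) := hg _ fun i => Finset.gcd_dvd (Finset.mem_univ i)
  exact (hu.dvd_mul_left).1 h2

end Helpers

/-- Let `J = (f₁,…,f_m) ⊆ k[s,t,u]` (m ≥ 2) be a homogeneous
ideal with `gcd(f₁,…,f_m) = 1` and `deg fᵢ ≤ d`.  Then the Castelnuovo–Mumford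
regularity of `J` satisfies `reg(J) ≤ 3d − 2`; equivalently, in the minimal
graded free resolution of `J` the `i`-th free module is generated in degrees
at most `3d − 2 + i`. -/
theorem regularity_le
    (k : Type) [Field k] (m d : ℕ) (hm : 2 ≤ m)
    (f : Fin m → S3 k) (δ : Fin m → ℕ)
    (hhom : ∀ i, (f i).IsHomogeneous (δ i)) (hdeg : ∀ i, δ i ≤ d)
    (hgcd : ∀ p : S3 k, (∀ i, p ∣ f i) → IsUnit p)
    (res : GradedMinFreeRes k (Ideal.span (Set.range f))) :
    (∀ i, res.deg0 i ≤ 3 * d - 2) ∧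
    (∀ i, res.deg1 i ≤ 3 * d - 1) ∧
    (∀ i, res.deg2 i ≤ 3 * d) := by
  classical
  obtain ⟨b0, b1, b2, deg0, deg1, deg2, ε, d1, d2, range_eps, exact1, exact2, inj2, min1, min2,
    hom0, hom1, hom2⟩ := res
  dsimp only
  have hker1 : ∀ x, ε x = 0 → ∃ w, d1 w = x := fun x hx => by
    have : x ∈ LinearMap.ker ε := hx
    rw [exact1] at this
    exact this
  have hker2 : ∀ x, d1 x = 0 → ∃ w, d2 w = x := fun x hx => by
    have : x ∈ LinearMap.ker d1 := hx
    rw [exact2] at this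
    exact this
  have hεd : ∀ w, ε (d1 w) = 0 := fun w => by
    have : d1 w ∈ LinearMap.ker ε := by rw [exact1]; exact ⟨w, rfl⟩
    exact this
  have hdd : ∀ w, d1 (d2 w) = 0 := fun w => by
    have : d2 w ∈ LinearMap.ker d1 := by rw [exact2]; exact ⟨w, rfl⟩
    exact this
  have hinj : Function.Injective d2 := LinearMap.ker_eq_bot.1 inj2
  set g : Fin b0 → S3 k := fun i => ε (Pi.single i 1) with hgdef
  have hε : ∀ x, ε x = ∑ i, x i * g i := by
    intro x
    conv_lhs => rw [LinearMap.pi_apply_eq_sum_univ ε x]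
    refine Finset.sum_congr rfl fun j _ => ?_
    rw [smul_eq_mul, hgdef]
    congr 2
    ext l
    simp [Pi.single_apply, eq_comm]
  -- gcd of the g
  have hgu : ∀ p : S3 k, (∀ i, p ∣ g i) → IsUnit p := by
    intro p hp
    refine hgcd p fun i => ?_
    have : f i ∈ LinearMap.range ε := by
      rw [range_eps]; exact Ideal.subset_span ⟨i, rfl⟩
    obtain ⟨x, hx⟩ := this
    rw [← hx, hε]
    exact Finset.dvd_sum fun j _ => (hp j).mul_left _
  obtain ⟨i0, hi0⟩ : ∃ i, g i ≠ 0 := by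
    by_contra! hcon
    exact not_isUnit_zero (hgu 0 fun i => by rw [hcon i])
  -- generators
  have D0 : ∀ i, deg0 i ≤ d := by
    intro e
    by_contra! hlt
    have hl : ∀ i, ∃ a : Fin b0 → S3 k, a e = 0 ∧ ε a = f i := by
      intro i
      have : f i ∈ LinearMap.range ε := by
        rw [range_eps]; exact Ideal.subset_span ⟨i, rfl⟩
      obtain ⟨x, hx⟩ := this
      obtain ⟨x', h1, h2⟩ := graded_lift deg0 (fun _ : Unit => 0) (LinearMap.pi fun _ : Unit => ε)
        (by
          intro _ j
          right
          exact ⟨Nat.zero_le _, by simpa using hom0 j⟩)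
        (δ i) x (by
          intro _
          right
          refine ⟨Nat.zero_le _, ?_⟩
          simpa [hx] using hhom i)
      refine ⟨x', h1.zero_of_lt (lt_of_le_of_lt (hdeg i) hlt), ?_⟩
      have := congrFun h2 ()
      simpa [hx] using this
    choose a ha0 ha using hl
    have hmem : g e ∈ Ideal.span (Set.range f) := by
      rw [← range_eps]; exact ⟨_, rfl⟩
    obtain ⟨c, hc⟩ := (Ideal.mem_span_range_iff_exists_fun).1 hmem
    have hz : ε (Pi.single e 1 - ∑ i, c i • a i) = 0 := by
      rw [map_sub, map_sum]
      simp only [map_smul, ha, smul_eq_mul, hc]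
      exact sub_self _
    obtain ⟨w, hw⟩ := hker1 _ hz
    have := min1 w e
    rw [hw] at this
    simp [ha0] at this
  -- Koszul lifts, degree two
  have K2 : ∀ i j, ∃ w, GH deg1 (deg0 i + deg0 j) w ∧
      d1 w = g i • Pi.single j 1 - g j • Pi.single i 1 := by
    intro i j
    obtain ⟨w, hw⟩ := hker1 (g i • Pi.single j 1 - g j • Pi.single i 1) (by
      rw [map_sub, map_smul, map_smul, smul_eq_mul, smul_eq_mul]
      change g i * g j - g j * g i = 0
      ring)
    have hgh : GH deg0 (deg0 i + deg0 j) (d1 w) := by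
      rw [hw, sub_eq_add_neg]
      refine ((GH.single deg0 j).smul (hom0 i)).add (GH.neg ?_)
      rw [add_comm]
      exact (GH.single deg0 i).smul (hom0 j)
    obtain ⟨w', h1, h2⟩ := graded_lift deg1 deg0 d1 hom1 _ w hgh
    exact ⟨w', h1, h2.trans hw⟩
  choose A hAh hA using K2
  have K3 : ∀ i j l, ∃ v, GH deg2 (deg0 i + deg0 j + deg0 l) v ∧
      d2 v = g i • A j l - g j • A i l + g l • A i j := by
    intro i j l
    obtain ⟨v, hv⟩ := hker2 (g i • A j l - g j • A i l + g l • A i j) (by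
      simp only [map_add, map_sub, map_smul, hA]
      module)
    have hgh : GH deg1 (deg0 i + deg0 j + deg0 l) (d2 v) := by
      rw [hv, sub_eq_add_neg]
      refine GH.add (GH.add ?_ (GH.neg ?_)) ?_
      · have := (hAh j l).smul (hom0 i)
        rwa [show deg0 i + (deg0 j + deg0 l) = deg0 i + deg0 j + deg0 l by omega] at this
      · have := (hAh i l).smul (hom0 j)
        rwa [show deg0 j + (deg0 i + deg0 l) = deg0 i + deg0 j + deg0 l by omega] at this
      · have := (hAh i j).smul (hom0 l)
        rwa [show deg0 l + (deg0 i + deg0 j) = deg0 i + deg0 j + deg0 l by omega] at this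
    obtain ⟨v', h1, h2⟩ := graded_lift deg2 deg1 d2 hom2 _ v hgh
    exact ⟨v', h1, h2.trans hv⟩
  choose B hBh hB using K3
  -- homotopy
  have hV : ∀ i w, ∃ v, d2 v = g i • w - ∑ j, (d1 w j) • A i j := by
    intro i w
    refine hker2 _ ?_
    have hx : ∑ j, d1 w j * g j = 0 := by rw [← hε, hεd]
    rw [map_sub, map_smul, map_sum]
    simp only [map_smul, hA]
    ext1 l
    simp only [Pi.sub_apply, Pi.smul_apply, Finset.sum_apply, smul_eq_mul, mul_sub,
      Finset.sum_sub_distrib, Pi.zero_apply]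
    have e1 : ∑ j, d1 w j * (g i * (Pi.single j (1 : S3 k) : Fin b0 → S3 k) l)
        = g i * d1 w l := by
      simp [Pi.single_apply, mul_comm]
    have e2 : ∑ j, d1 w j * (g j * (Pi.single i (1 : S3 k) : Fin b0 → S3 k) l) = 0 := by
      simp only [← mul_assoc]
      rw [← Finset.sum_mul, hx, zero_mul]
    rw [e1, e2]
    ring
  have D2 : ∀ i, deg2 i ≤ 3 * d := by
    intro e
    by_contra! hlt
    have hB0 : ∀ i j l, B i j l e = 0 := fun i j l => (hBh i j l).zero_of_lt (by
      have := D0 i; have := D0 j; have := D0 l; omega)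
    choose V hVs using hV
    have hsym : ∀ i l w, g l * V i w e = g i * V l w e := by
      intro i l w
      have hx : ∑ j, d1 w j * g j = 0 := by rw [← hε, hεd]
      have : g l • V i w - g i • V l w = ∑ j, (d1 w j) • B i l j := by
        apply hinj
        rw [map_sub, map_smul, map_smul, map_sum, hVs, hVs]
        simp only [map_smul, hB]
        have e1 : ∑ j, d1 w j • (g i • A l j - g l • A i j + g j • A i l)
            = g i • ∑ j, d1 w j • A l j - g l • ∑ j, d1 w j • A i j
              + (∑ j, d1 w j * g j) • A i l := by
          rw [Finset.smul_sum, Finset.smul_sum, Finset.sum_smul, ← Finset.sum_sub_distrib,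
            ← Finset.sum_add_distrib]
          refine Finset.sum_congr rfl fun j _ => ?_
          module
        rw [e1, hx]
        module
      have h2 := congrFun this e
      simp only [Pi.sub_apply, Pi.smul_apply, Finset.sum_apply, smul_eq_mul, hB0, mul_zero,
        Finset.sum_const_zero] at h2
      exact sub_eq_zero.1 h2
    have hdiv : ∀ w, g i0 ∣ V i0 w e := fun w =>
      dvd_of_gcd_unit g hgu _ _ fun l => ⟨V l w e, hsym i0 l w⟩
    choose c hc using hdiv
    set y := d2 (Pi.single e 1) with hy
    have hg : g i0 • (Pi.single e 1 : Fin b2 → S3 k) = ∑ q, y q • V i0 (Pi.single q 1) := by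
      apply hinj
      rw [map_smul, map_sum, ← hy]
      simp only [map_smul, hVs]
      have hysum : y = ∑ q, y q • (Pi.single q 1 : Fin b1 → S3 k) := by
        ext1 r
        simp [Finset.sum_apply, Pi.single_apply]
      have hdy : ∀ j, ∑ q, y q * d1 (Pi.single q 1) j = 0 := by
        intro j
        have h0 : d1 y = 0 := hdd _
        rw [hysum, map_sum] at h0
        have := congrFun h0 j
        simpa only [map_smul, Finset.sum_apply, Pi.smul_apply, smul_eq_mul, Pi.zero_apply]
          using this
      simp only [smul_sub, Finset.sum_sub_distrib, Finset.smul_sum, smul_smul]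
      rw [Finset.sum_comm (f := fun q j => (y q * d1 (Pi.single q 1) j) • A i0 j)]
      simp only [← Finset.sum_smul, hdy, zero_smul, Finset.sum_const_zero, sub_zero]
      conv_lhs => rw [hysum, Finset.smul_sum]
      refine Finset.sum_congr rfl fun q _ => ?_
      rw [smul_smul, mul_comm]
    have h3 := congrFun hg e
    simp only [Pi.smul_apply, Finset.sum_apply, smul_eq_mul, Pi.single_eq_same, hc] at h3
    have h4 : (1 : S3 k) = ∑ q, y q * c (Pi.single q 1) := by
      apply mul_left_cancel₀ hi0
      rw [h3, Finset.mul_sum]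
      exact Finset.sum_congr rfl fun q _ => by ring
    have h5 := congrArg constantCoeff h4
    simp [map_sum, hy, min2] at h5
  have D1 : ∀ i, deg1 i ≤ 3 * d - 1 := by
    intro e
    by_contra! hlt
    have hA0 : ∀ i j, A i j e = 0 := fun i j => (hAh i j).zero_of_lt (by
      have := D0 i; have := D0 j; omega)
    have hd2 : ∀ v, d2 v e = 0 := by
      have hs : ∀ j, d2 (Pi.single j 1) e = 0 := by
        intro j
        rcases hom2 e j with h | ⟨h, h'⟩
        · exact h
        · have h0 : deg2 j - deg1 e = 0 := by have := D2 j; omega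
          rw [h0] at h'
          have h1 := homogeneousComponent_eq_self h'
          rw [homogeneousComponent_zero] at h1
          have h2 := min2 (Pi.single j 1) e
          rw [constantCoeff_eq] at h2
          rw [← h1, h2, C_0]
      intro v
      have hv : v = ∑ q, v q • (Pi.single q 1 : Fin b2 → S3 k) := by
        ext1 r
        simp [Finset.sum_apply, Pi.single_apply]
      rw [hv, map_sum]
      simp only [map_smul, Finset.sum_apply, Pi.smul_apply, hs, smul_zero, Finset.sum_const_zero]
    obtain ⟨v, hv⟩ := hV i0 (Pi.single e 1)
    have h3 := congrFun hv e
    rw [hd2] at h3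
    simp [hA0] at h3
    exact hi0 h3.symm
  refine ⟨fun i => ?_, D1, D2⟩
  have := D0 i
  omega
end

section
/- Let S = k[s,t,u] over an infinite field k, and let J = (g_1,g_2,g_3,g_4) ⊂ S be a homogeneous ideal with deg(g_1)=...=deg(g_4)=d and height ht(J) = 3, where {g_1,g_2,g_3} form a regular sequence and g_4 ∉ (g_1,g_2,g_3). Let G = ((g_1,g_2,g_3) : J) be the linked Gorenstein ideal. Then the socle degree of S/G is 2d − 3, i.e., (S/G)_{2d−3} ≠ 0 and (S/G)_p = 0 for p > 2d−3. -/
open MvPolynomial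

/-- The height of an ideal: the infimum of the heights of the primes containing it. -/
noncomputable def idealHeight {S : Type} [CommRing S] (J : Ideal S) : ℕ∞ :=
  sInf {h : ℕ∞ | ∃ p : PrimeSpectrum S, J ≤ p.asIdeal ∧ h = Order.height p}

namespace LinkAux

variable {k : Type} [Field k]

/-- `a` is a nonzerodivisor modulo `I`. -/
def NZ (I : Ideal (MvPolynomial (Fin 3) k)) (a : MvPolynomial (Fin 3) k) : Prop :=
  ∀ x, a * x ∈ I → x ∈ I

/-- `I` is a homogeneous ideal. -/
def Hom (I : Ideal (MvPolynomial (Fin 3) k)) : Prop :=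
  ∀ f ∈ I, ∀ n, homogeneousComponent n f ∈ I

/-- `I + (a)`. -/
noncomputable def E (I : Ideal (MvPolynomial (Fin 3) k)) (a : MvPolynomial (Fin 3) k) :
    Ideal (MvPolynomial (Fin 3) k) := I ⊔ Ideal.span {a}

theorem mem_E {I : Ideal (MvPolynomial (Fin 3) k)} {a x : MvPolynomial (Fin 3) k} :
    x ∈ E I a ↔ ∃ y, x - a * y ∈ I := by
  unfold E
  rw [Submodule.mem_sup]
  constructor
  · rintro ⟨i, hi, z, hz, rfl⟩
    obtain ⟨y, rfl⟩ := Ideal.mem_span_singleton'.1 hz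
    exact ⟨y, by convert hi using 1; ring⟩
  · rintro ⟨y, hy⟩
    exact ⟨_, hy, a * y, Ideal.mem_span_singleton.2 ⟨y, rfl⟩, by ring⟩

theorem E_comm (I : Ideal (MvPolynomial (Fin 3) k)) (a b : MvPolynomial (Fin 3) k) :
    E (E I a) b = E (E I b) a := by
  unfold E
  rw [sup_right_comm]

theorem le_E {I : Ideal (MvPolynomial (Fin 3) k)} {a x : MvPolynomial (Fin 3) k}
    (h : x ∈ I) : x ∈ E I a := mem_E.2 ⟨0, by simpa using h⟩

theorem comp_mul_le {g y : MvPolynomial (Fin 3) k} {d n : ℕ} (hg : g.IsHomogeneous d)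
    (h : d ≤ n) :
    homogeneousComponent n (g * y) = g * homogeneousComponent (n - d) y := by
  let _ : GradedAlgebra (homogeneousSubmodule (Fin 3) k) := MvPolynomial.gradedAlgebra
  have := DirectSum.coe_decompose_mul_of_left_mem_of_le (homogeneousSubmodule (Fin 3) k)
    (a := g) (b := y) (i := d) (n := n) hg h
  have e : ∀ (p : MvPolynomial (Fin 3) k) (i : ℕ),
      ((DirectSum.decompose (homogeneousSubmodule (Fin 3) k) p i : homogeneousSubmodule (Fin 3) k i)
        : MvPolynomial (Fin 3) k) = homogeneousComponent i p :=
    fun p i => decomposition.decompose'_apply p i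
  rwa [e, e] at this

theorem comp_mul_lt {g y : MvPolynomial (Fin 3) k} {d n : ℕ} (hg : g.IsHomogeneous d)
    (h : n < d) :
    homogeneousComponent n (g * y) = 0 := by
  let _ : GradedAlgebra (homogeneousSubmodule (Fin 3) k) := MvPolynomial.gradedAlgebra
  have := DirectSum.coe_decompose_mul_of_left_mem_of_not_le (homogeneousSubmodule (Fin 3) k)
    (a := g) (b := y) (i := d) (n := n) hg (by omega)
  have e : ∀ (p : MvPolynomial (Fin 3) k) (i : ℕ),
      ((DirectSum.decompose (homogeneousSubmodule (Fin 3) k) p i : homogeneousSubmodule (Fin 3) k i)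
        : MvPolynomial (Fin 3) k) = homogeneousComponent i p :=
    fun p i => decomposition.decompose'_apply p i
  rwa [e] at this

theorem hom_bot : Hom (⊥ : Ideal (MvPolynomial (Fin 3) k)) := by
  intro f hf n
  rw [Ideal.mem_bot] at hf
  subst hf
  simp

theorem hom_E {I : Ideal (MvPolynomial (Fin 3) k)} {a : MvPolynomial (Fin 3) k} {d : ℕ}
    (hI : Hom I) (ha : a.IsHomogeneous d) : Hom (E I a) := by
  intro f hf n
  obtain ⟨y, hy⟩ := mem_E.1 hf
  have h := hI _ hy n
  rw [map_sub] at h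
  rcases le_or_gt d n with hdn | hdn
  · rw [comp_mul_le ha hdn] at h
    exact mem_E.2 ⟨_, h⟩
  · rw [comp_mul_lt ha hdn, sub_zero] at h
    exact le_E h

theorem E_hom {I : Ideal (MvPolynomial (Fin 3) k)} {a f : MvPolynomial (Fin 3) k} {d n : ℕ}
    (hI : Hom I) (ha : a.IsHomogeneous d) (hf : f.IsHomogeneous (n + d)) (hfa : f ∈ E I a) :
    ∃ y : MvPolynomial (Fin 3) k, y.IsHomogeneous n ∧ f - a * y ∈ I := by
  obtain ⟨y, hy⟩ := mem_E.1 hfa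
  have h := hI _ hy (n + d)
  rw [map_sub, comp_mul_le ha (by omega), homogeneousComponent_eq_self hf, Nat.add_sub_cancel] at h
  exact ⟨_, homogeneousComponent_isHomogeneous _ _, h⟩

theorem E_hom_lt {I : Ideal (MvPolynomial (Fin 3) k)} {a f : MvPolynomial (Fin 3) k} {d n : ℕ}
    (hI : Hom I) (ha : a.IsHomogeneous d) (hf : f.IsHomogeneous n) (hn : n < d)
    (hfa : f ∈ E I a) : f ∈ I := by
  obtain ⟨y, hy⟩ := mem_E.1 hfa
  have h := hI _ hy n
  rwa [map_sub, comp_mul_lt ha hn, homogeneousComponent_eq_self hf, sub_zero] at h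

theorem nz_swap {I : Ideal (MvPolynomial (Fin 3) k)} {a b : MvPolynomial (Fin 3) k}
    (ha : NZ I a) (hb : NZ (E I a) b) : NZ (E I b) a := by
  intro x hx
  obtain ⟨y, hy⟩ := mem_E.1 hx
  have hy' : y ∈ E I a := hb y (mem_E.2 ⟨x, by
    have := I.neg_mem hy
    convert this using 1; ring⟩)
  obtain ⟨z, hz⟩ := mem_E.1 hy'
  refine mem_E.2 ⟨z, ha _ ?_⟩
  have := I.add_mem hy (I.mul_mem_left b hz)
  convert this using 1; ring

/-- socle exchange -/
theorem exchange {I : Ideal (MvPolynomial (Fin 3) k)} {g l f : MvPolynomial (Fin 3) k} {d j : ℕ}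
    (hI : Hom I) (hg : g.IsHomogeneous d) (hl : l.IsHomogeneous 1)
    (ng : NZ I g) (nl : NZ I l) (hf : f.IsHomogeneous j) (hfn : f ∉ E I g)
    (hlf : l ∈ Ideal.span (Set.range (X : Fin 3 → MvPolynomial (Fin 3) k)))
    (hs : ∀ i, X i * f ∈ E I g) :
    ∃ j' h, j' + d = j + 1 ∧ h.IsHomogeneous j' ∧ h ∉ E I l ∧ ∀ i, X i * h ∈ E I l := by
  have hlf' : l * f ∈ E I g := by
    have : Ideal.span (Set.range (X : Fin 3 → MvPolynomial (Fin 3) k)) ≤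
        Submodule.comap (LinearMap.mulRight _ f) (E I g) := by
      rw [Ideal.span_le]
      rintro _ ⟨i, rfl⟩
      exact hs i
    exact this hlf
  have hd : (l * f).IsHomogeneous (j + 1) := by
    have := hl.mul hf
    rwa [add_comm] at this
  rcases lt_or_ge (j + 1) d with hjd | hjd
  · exact absurd (le_E (nl _ (E_hom_lt hI hg hd hjd hlf'))) hfn
  obtain ⟨j', hj'⟩ := Nat.exists_eq_add_of_le' hjd
  rw [hj'] at hd
  obtain ⟨h, hh, hm⟩ := E_hom hI hg hd hlf'
  refine ⟨j', h, hj'.symm, hh, ?_, ?_⟩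
  · intro hc
    obtain ⟨y, hy⟩ := mem_E.1 hc
    apply hfn
    refine mem_E.2 ⟨y, nl _ ?_⟩
    have := I.add_mem hm (I.mul_mem_left g hy)
    convert this using 1; ring
  · intro i
    obtain ⟨y, hy⟩ := mem_E.1 (hs i)
    refine mem_E.2 ⟨y, ng _ ?_⟩
    have := I.sub_mem (I.mul_mem_left l hy) (I.mul_mem_left (X i) hm)
    convert this using 1; ring

theorem transfer {I : Ideal (MvPolynomial (Fin 3) k)} {g l : MvPolynomial (Fin 3) k} {d N : ℕ}
    (hI : Hom I) (hg : g.IsHomogeneous d) (hl : l.IsHomogeneous 1)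
    (ng : NZ I g) (nl : NZ I l)
    (hN : ∀ n, N < n → ∀ f : MvPolynomial (Fin 3) k, f.IsHomogeneous n → f ∈ E I l) :
    ∀ n, N + d ≤ n → ∀ f : MvPolynomial (Fin 3) k, f.IsHomogeneous n → f ∈ E I g := by
  let q : MvPolynomial (Fin 3) k →ₗ[k] (MvPolynomial (Fin 3) k ⧸ I) :=
    (Ideal.Quotient.mkₐ k I).toLinearMap
  have hq : ∀ x, q x = Ideal.Quotient.mk I x := fun x => rfl
  let W : ℕ → Submodule k (MvPolynomial (Fin 3) k ⧸ I) :=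
    fun n => Submodule.map q (homogeneousSubmodule (Fin 3) k n)
  have hfin : ∀ n, FiniteDimensional k (W n) := fun n =>
    Module.Finite.iff_fg.2 ((homogeneousSubmodule_fg (Fin 3) k n).map q)
  let μ : MvPolynomial (Fin 3) k → (MvPolynomial (Fin 3) k ⧸ I) →ₗ[k] (MvPolynomial (Fin 3) k ⧸ I) :=
    fun a => LinearMap.mulLeft k (q a)
  have hμ : ∀ a, NZ I a → Function.Injective (μ a) := by
    intro a ha
    rw [injective_iff_map_eq_zero]
    intro x hx
    obtain ⟨x, rfl⟩ := Ideal.Quotient.mk_surjective x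
    rw [Ideal.Quotient.eq_zero_iff_mem]
    apply ha
    rw [← Ideal.Quotient.eq_zero_iff_mem, map_mul]
    exact hx
  have hle : ∀ a e n, a.IsHomogeneous e → (W n).map (μ a) ≤ W (n + e) := by
    rintro a e n ha _ ⟨_, ⟨y, hy, rfl⟩, rfl⟩
    refine ⟨a * y, ?_, ?_⟩
    · have := ha.mul hy
      rwa [add_comm] at this
    · simp [μ, hq]
  have hr : ∀ a n, NZ I a → Module.finrank k ((W n).map (μ a)) = Module.finrank k (W n) := by
    intro a n ha
    exact (Submodule.equivMapOfInjective (μ a) (hμ a ha) (W n)).finrank_eq.symm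
  have h1 : ∀ n, N ≤ n → Module.finrank k (W (n+1)) = Module.finrank k (W n) := by
    intro n hn
    rw [← hr l n nl]
    have : (W n).map (μ l) = W (n + 1) := by
      refine le_antisymm (hle l 1 n hl) ?_
      rintro _ ⟨f, hf, rfl⟩
      obtain ⟨y, hy, hfy⟩ := E_hom hI hl hf (hN (n + 1) (by omega) f hf)
      refine ⟨q y, ⟨y, hy, rfl⟩, ?_⟩
      rw [← Ideal.Quotient.eq, map_mul] at hfy
      exact hfy.symm
    rw [this]
  have h2 : ∀ n, N ≤ n → ∀ e, Module.finrank k (W (n+e)) = Module.finrank k (W n) := by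
    intro n hn e
    induction e with
    | zero => rfl
    | succ e ih => rw [← ih, ← h1 (n+e) (by omega)]; rfl
  intro n hn f hf
  obtain ⟨m, rfl⟩ := Nat.exists_eq_add_of_le' (show d ≤ n by omega)
  have h3 : (W m).map (μ g) = W (m + d) :=
    Submodule.eq_of_le_of_finrank_eq (hle g d m hg) (by rw [hr g m ng, h2 m (by omega)])
  have h4 : q f ∈ W (m + d) := ⟨f, hf, rfl⟩
  rw [← h3] at h4
  obtain ⟨_, ⟨y, hy, rfl⟩, h5⟩ := h4
  refine mem_E.2 ⟨y, ?_⟩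
  rw [← Ideal.Quotient.eq, map_mul]
  exact h5.symm


/-- The linear form with coefficients `c`. -/
noncomputable def L : (Fin 3 → k) →ₗ[k] MvPolynomial (Fin 3) k :=
  Fintype.linearCombination k (X : Fin 3 → MvPolynomial (Fin 3) k)

theorem L_apply (c : Fin 3 → k) : L c = ∑ i, c i • (X i : MvPolynomial (Fin 3) k) := by
  simp [L, Fintype.linearCombination_apply]

theorem L_hom (c : Fin 3 → k) : (L c).IsHomogeneous 1 := by
  rw [L_apply]
  refine IsHomogeneous.sum _ _ _ (fun i _ => ?_)
  rw [smul_eq_C_mul]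
  simpa using (isHomogeneous_C (Fin 3) (c i)).mul (isHomogeneous_X k i)

/-- The irrelevant ideal -/
noncomputable def mm : Ideal (MvPolynomial (Fin 3) k) :=
  Ideal.span (Set.range (X : Fin 3 → MvPolynomial (Fin 3) k))

theorem L_mem (c : Fin 3 → k) : L c ∈ (mm : Ideal (MvPolynomial (Fin 3) k)) := by
  rw [L_apply]
  refine Submodule.sum_mem _ (fun i _ => ?_)
  rw [smul_eq_C_mul]
  exact Ideal.mul_mem_left _ _ (Ideal.subset_span ⟨i, rfl⟩)

theorem mem_mm {f : MvPolynomial (Fin 3) k} : f ∈ (mm : Ideal (MvPolynomial (Fin 3) k)) ↔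
    constantCoeff f = 0 := by
  unfold mm
  rw [← Set.image_univ, mem_ideal_span_X_image, constantCoeff_eq]
  constructor
  · intro h
    by_contra hc
    obtain ⟨i, -, hi⟩ := h 0 (mem_support_iff.2 hc)
    exact hi rfl
  · intro h m hm
    by_contra! hc
    have hm0 : m = 0 := Finsupp.ext (fun i => hc i trivial)
    rw [hm0, mem_support_iff] at hm
    exact hm h

theorem hom_mem_mm {f : MvPolynomial (Fin 3) k} {n : ℕ} (hn : 0 < n) (hf : f.IsHomogeneous n) :
    f ∈ (mm : Ideal (MvPolynomial (Fin 3) k)) := by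
  rw [mem_mm, constantCoeff_eq]
  by_contra h
  have := hf h
  simp at this
  omega

theorem one_notMem_mm : (1 : MvPolynomial (Fin 3) k) ∉ (mm : Ideal (MvPolynomial (Fin 3) k)) := by
  rw [mem_mm]; simp

theorem E_le_mm {I : Ideal (MvPolynomial (Fin 3) k)} {a : MvPolynomial (Fin 3) k}
    (hI : I ≤ mm) (ha : a ∈ (mm : Ideal (MvPolynomial (Fin 3) k))) : E I a ≤ mm := by
  unfold E
  refine sup_le hI ?_
  rw [Ideal.span_singleton_le_iff_mem]
  exact ha

theorem nz_notMem {I : Ideal (MvPolynomial (Fin 3) k)} {a : MvPolynomial (Fin 3) k}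
    (hI : I ≤ mm) (ha : NZ I a) : a ∉ I := fun h =>
  one_notMem_mm (hI (ha 1 (by simpa using h)))

theorem nz_iff {I : Ideal (MvPolynomial (Fin 3) k)} {a : MvPolynomial (Fin 3) k} :
    NZ I a ↔ IsSMulRegular (MvPolynomial (Fin 3) k ⧸ I) a := by
  rw [isSMulRegular_iff_right_eq_zero_of_smul]
  constructor
  · intro h x hx
    obtain ⟨x, rfl⟩ := Ideal.Quotient.mk_surjective x
    rw [Ideal.Quotient.eq_zero_iff_mem]
    apply h
    rw [← Ideal.Quotient.eq_zero_iff_mem]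
    exact hx
  · intro h x hx
    rw [← Ideal.Quotient.eq_zero_iff_mem] at hx ⊢
    exact h _ hx

theorem avoid [Infinite k] {I₁ I₂ : Ideal (MvPolynomial (Fin 3) k)}
    {g₁ g₂ : MvPolynomial (Fin 3) k} (m₁ : g₁ ∈ (mm : Ideal (MvPolynomial (Fin 3) k)))
    (m₂ : g₂ ∈ (mm : Ideal (MvPolynomial (Fin 3) k))) (h₁ : NZ I₁ g₁) (h₂ : NZ I₂ g₂) :
    ∃ c : Fin 3 → k, NZ I₁ (L c) ∧ NZ I₂ (L c) := by
  let A := associatedPrimes (MvPolynomial (Fin 3) k) (MvPolynomial (Fin 3) k ⧸ I₁) ∪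
    associatedPrimes (MvPolynomial (Fin 3) k) (MvPolynomial (Fin 3) k ⧸ I₂)
  have hA : A.Finite := (associatedPrimes.finite _ _).union (associatedPrimes.finite _ _)
  have e : ∀ (I : Ideal (MvPolynomial (Fin 3) k)) a,
      (∃ p ∈ associatedPrimes (MvPolynomial (Fin 3) k) (MvPolynomial (Fin 3) k ⧸ I), a ∈ p) ↔
      ¬ NZ I a := by
    intro I a
    have := biUnion_associatedPrimes_eq_compl_regular (MvPolynomial (Fin 3) k)
      (MvPolynomial (Fin 3) k ⧸ I)
    have := Set.ext_iff.1 this a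
    rw [nz_iff]
    simpa using this
  have hn : ∀ p ∈ A, ¬ mm ≤ p := by
    rintro p (hp | hp) hle
    · exact (e I₁ g₁).1 ⟨p, hp, hle m₁⟩ h₁
    · exact (e I₂ g₂).1 ⟨p, hp, hle m₂⟩ h₂
  have : Finite A := hA
  obtain ⟨c, hc⟩ := Submodule.exists_forall_notMem_of_forall_ne_top
    (fun p : A => (p.1.restrictScalars k).comap (L (k := k))) (by
      rintro ⟨p, hp⟩ htop
      apply hn p hp
      unfold mm
      rw [Ideal.span_le]
      rintro _ ⟨i, rfl⟩
      have : Pi.single i (1 : k) ∈ (p.restrictScalars k).comap (L (k := k)) := by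
        rw [htop]; trivial
      simpa [L] using this)
  refine ⟨c, ?_, ?_⟩
  · by_contra h
    obtain ⟨p, hp, hpc⟩ := (e I₁ _).2 h
    exact hc ⟨p, Or.inl hp⟩ hpc
  · by_contra h
    obtain ⟨p, hp, hpc⟩ := (e I₂ _).2 h
    exact hc ⟨p, Or.inr hp⟩ hpc

theorem full {I : Ideal (MvPolynomial (Fin 3) k)} {c : Fin 3 → Fin 3 → k}
    (hc : LinearIndependent k c) (h : ∀ i, L (c i) ∈ I) : mm ≤ I := by
  have hs : Submodule.span k (Set.range c) = ⊤ := hc.span_eq_top_of_card_eq_finrank' (by simp)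
  have : Submodule.span k (Set.range c) ≤ (I.restrictScalars k).comap (L (k := k)) := by
    rw [Submodule.span_le]
    rintro _ ⟨i, rfl⟩
    exact h i
  rw [hs] at this
  unfold mm
  rw [Ideal.span_le]
  rintro _ ⟨i, rfl⟩
  have := this (x := Pi.single i (1 : k)) trivial
  simpa [L] using this

theorem key [Infinite k] {d : ℕ} (hd : 0 < d) {a b c : MvPolynomial (Fin 3) k}
    (ha : a.IsHomogeneous d) (hb : b.IsHomogeneous d) (hc : c.IsHomogeneous d)
    (na : NZ ⊥ a) (nb : NZ (E ⊥ a) b) (nc : NZ (E (E ⊥ a) b) c) :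
    (∀ n, 3 * d - 3 < n → ∀ f : MvPolynomial (Fin 3) k, f.IsHomogeneous n →
      f ∈ E (E (E ⊥ a) b) c) ∧
    (∀ n, n < 3 * d - 3 → ∀ f : MvPolynomial (Fin 3) k, f.IsHomogeneous n →
      f ∉ E (E (E ⊥ a) b) c → ∃ i, X i * f ∉ E (E (E ⊥ a) b) c) := by
  have ma := hom_mem_mm hd ha
  have mb := hom_mem_mm hd hb
  have mc := hom_mem_mm hd hc
  obtain ⟨c₁, n₁, n₁'⟩ := avoid mb mc nb nc
  have s1 : NZ (E (E ⊥ a) (L c₁)) b := nz_swap nb n₁'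
  obtain ⟨c₂, n₂, -⟩ := avoid mb mb s1 s1
  have s2 : NZ (E ⊥ (L c₁)) a := nz_swap na n₁
  have n₂' := n₂
  rw [E_comm] at n₂'
  have s3 : NZ (E (E ⊥ (L c₁)) (L c₂)) a := nz_swap s2 n₂'
  obtain ⟨c₃, n₃, -⟩ := avoid ma ma s3 s3
  have H0 : Hom (⊥ : Ideal (MvPolynomial (Fin 3) k)) := hom_bot
  have Hab := hom_E (hom_E H0 ha) hb
  have Hal := hom_E (hom_E H0 ha) (L_hom c₁)
  have Hll := hom_E (hom_E H0 (L_hom c₁)) (L_hom c₂)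
  have r1 : E (E (E ⊥ a) b) (L c₁) = E (E (E ⊥ a) (L c₁)) b := E_comm _ _ _
  have r2 : E (E (E ⊥ a) (L c₁)) (L c₂) = E (E (E ⊥ (L c₁)) (L c₂)) a := by
    rw [E_comm ⊥ a, E_comm]
  constructor
  · have z1 : L c₁ ∈ E (E (E ⊥ (L c₁)) (L c₂)) (L c₃) :=
      le_E (le_E (mem_E.2 ⟨1, by simp⟩))
    have z2 : L c₂ ∈ E (E (E ⊥ (L c₁)) (L c₂)) (L c₃) :=
      le_E (mem_E.2 ⟨1, by simp⟩)
    have z3 : L c₃ ∈ E (E (E ⊥ (L c₁)) (L c₂)) (L c₃) := mem_E.2 ⟨1, by simp⟩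
    have li : LinearIndependent k ![c₃, c₂, c₁] := by
      have bot_le' : (⊥ : Ideal (MvPolynomial (Fin 3) k)) ≤ mm := bot_le
      have u1 := nz_notMem (E_le_mm bot_le' ma) n₁
      have u2 := nz_notMem (E_le_mm (E_le_mm bot_le' ma) (L_mem c₁)) n₂
      have u3 := nz_notMem (E_le_mm (E_le_mm bot_le' (L_mem c₁)) (L_mem c₂)) n₃
      refine linearIndependent_finCons.2 ⟨linearIndependent_finCons.2 ⟨?_, ?_⟩, ?_⟩
      · apply LinearIndependent.of_subsingleton (0 : Fin 1)
        rintro h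
        simp only [Matrix.cons_val_zero] at h
        apply u1
        rw [h, map_zero]
        exact Submodule.zero_mem _
      · intro h
        apply u2
        have : Submodule.span k (Set.range ![c₁]) ≤
            ((E (E ⊥ a) (L c₁)).restrictScalars k).comap (L (k := k)) := by
          rw [Submodule.span_le]
          rintro _ ⟨i, rfl⟩
          fin_cases i
          exact mem_E.2 ⟨1, by simp⟩
        exact this h
      · intro h
        apply u3
        have : Submodule.span k (Set.range ![c₂, c₁]) ≤
            ((E (E ⊥ (L c₁)) (L c₂)).restrictScalars k).comap (L (k := k)) := by
          rw [Submodule.span_le]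
          rintro _ ⟨i, rfl⟩
          fin_cases i
          · exact mem_E.2 ⟨1, by simp⟩
          · exact le_E (mem_E.2 ⟨1, by simp⟩)
        exact this h
    have t0 : ∀ n, 0 < n → ∀ f : MvPolynomial (Fin 3) k, f.IsHomogeneous n →
        f ∈ E (E (E ⊥ (L c₁)) (L c₂)) (L c₃) := by
      intro n hn f hf
      refine full li ?_ (hom_mem_mm hn hf)
      intro i
      fin_cases i
      · exact z3
      · exact z2
      · exact z1
    have t1 := transfer Hll ha (L_hom c₃) s3 n₃ t0
    rw [← r2] at t1
    have t2 := transfer (N := d - 1) Hal hb (L_hom c₂) s1 n₂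
      (fun n hn => t1 n (by omega))
    rw [← r1] at t2
    have t3 := transfer (N := 2 * d - 2) Hab hc (L_hom c₁) nc n₁'
      (fun n hn => t2 n (by omega))
    exact fun n hn => t3 n (by omega)
  · intro n hn f hf hfn
    by_contra! hs
    obtain ⟨j1, f1, e1, q1, p1, w1⟩ := exchange Hab hc (L_hom c₁) nc n₁' hf hfn (L_mem c₁) hs
    rw [r1] at p1 w1
    obtain ⟨j2, f2, e2, q2, p2, w2⟩ := exchange Hal hb (L_hom c₂) s1 n₂ q1 p1 (L_mem c₂) w1
    rw [r2] at p2 w2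
    obtain ⟨j3, f3, e3, q3, p3, w3⟩ := exchange Hll ha (L_hom c₃) s3 n₃ q2 p2 (L_mem c₃) w2
    omega

end LinkAux

/-- Let `S = k[s,t,u]` over an infinite field, and
`J = (g₁,g₂,g₃,g₄)` homogeneous with all `deg gᵢ = d`, `ht(J) = 3`, where
`g₁,g₂,g₃` form a regular sequence and `g₄ ∉ (g₁,g₂,g₃)`.  Let
`G = ((g₁,g₂,g₃) : J)` be the linked Gorenstein ideal.  Then the socle degree
of `S/G` is `2d − 3`: the graded piece `(S/G)_{2d−3}` is nonzero (there is a
homogeneous polynomial of degree `2d−3` not in `G`) and `(S/G)_p = 0` for all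
`p > 2d−3` (every homogeneous polynomial of degree `p` lies in `G`). -/
theorem socle_degree_of_linked_ideal
    (k : Type) [Field k] [Infinite k] (d : ℕ)
    (g : Fin 4 → MvPolynomial (Fin 3) k)
    (hhom : ∀ i, (g i).IsHomogeneous d)
    (hreg : RingTheory.Sequence.IsRegular (MvPolynomial (Fin 3) k)
      [g 0, g 1, g 2])
    (hg4 : g 3 ∉ Ideal.span {g 0, g 1, g 2})
    (hht : idealHeight (Ideal.span (Set.range g)) = 3)
    (G : Ideal (MvPolynomial (Fin 3) k))
    (hG : G = Submodule.colon (Ideal.span {g 0, g 1, g 2})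
      (Ideal.span (Set.range g))) :
    (∃ h : MvPolynomial (Fin 3) k, h.IsHomogeneous (2 * d - 3) ∧ h ∉ G) ∧
    (∀ p : ℕ, 2 * d - 3 < p →
      ∀ h : MvPolynomial (Fin 3) k, h.IsHomogeneous p → h ∈ G) := by
  have hw := hreg.toIsWeaklyRegular.regular_mod_prev
  have na : LinkAux.NZ ⊥ (g 0) := by
    have h := hw 0 (by simp)
    rw [LinkAux.nz_iff]
    have e : (Ideal.ofList ([g 0, g 1, g 2].take 0) • ⊤ : Ideal (MvPolynomial (Fin 3) k)) = ⊥ := by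
      simp
    rw [e] at h
    exact h
  have nb : LinkAux.NZ (LinkAux.E ⊥ (g 0)) (g 1) := by
    have h := hw 1 (by simp)
    rw [LinkAux.nz_iff]
    have e : (Ideal.ofList ([g 0, g 1, g 2].take 1) • ⊤ : Ideal (MvPolynomial (Fin 3) k)) =
        LinkAux.E ⊥ (g 0) := by
      simp [LinkAux.E]
    rw [e] at h
    exact h
  have nc : LinkAux.NZ (LinkAux.E (LinkAux.E ⊥ (g 0)) (g 1)) (g 2) := by
    have h := hw 2 (by simp)
    rw [LinkAux.nz_iff]
    have e : (Ideal.ofList ([g 0, g 1, g 2].take 2) • ⊤ : Ideal (MvPolynomial (Fin 3) k)) =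
        LinkAux.E (LinkAux.E ⊥ (g 0)) (g 1) := by
      simp [LinkAux.E]
    rw [e] at h
    exact h
  have hK : Ideal.span {g 0, g 1, g 2} =
      LinkAux.E (LinkAux.E (LinkAux.E ⊥ (g 0)) (g 1)) (g 2) := by
    simp only [LinkAux.E, Ideal.span_insert, bot_sup_eq, sup_assoc]
  have hmem : ∀ h, h ∈ G ↔ h * g 3 ∈ Ideal.span {g 0, g 1, g 2} := by
    intro h
    rw [hG, Submodule.mem_colon]
    constructor
    · intro H
      exact H _ (Ideal.subset_span ⟨3, rfl⟩)
    · intro H p hp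
      have hle : Ideal.span (Set.range g) ≤
          Submodule.comap (LinearMap.mulLeft _ h) (Ideal.span {g 0, g 1, g 2}) := by
        rw [Ideal.span_le]
        rintro _ ⟨i, rfl⟩
        change h * g i ∈ Ideal.span {g 0, g 1, g 2}
        fin_cases i
        · exact Ideal.mul_mem_left _ _ (Ideal.subset_span (by simp))
        · exact Ideal.mul_mem_left _ _ (Ideal.subset_span (by simp))
        · exact Ideal.mul_mem_left _ _ (Ideal.subset_span (by simp))
        · exact H
      exact hle hp
  have hd : 0 < d := by
    rcases Nat.eq_zero_or_pos d with rfl | h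
    · exfalso
      have h0 := hhom 0
      rw [← totalDegree_zero_iff_isHomogeneous, totalDegree_eq_zero_iff_eq_C] at h0
      by_cases hc : coeff 0 (g 0) = 0
      · rw [hc, map_zero] at h0
        have := na 1 (by rw [h0]; simp)
        simp at this
      · apply hg4
        have hu : IsUnit (g 0) := by
          rw [h0]
          exact (isUnit_iff_ne_zero.2 hc).map C
        rw [Ideal.eq_top_of_isUnit_mem _ (Ideal.subset_span (by simp)) hu]
        trivial
    · exact h
  obtain ⟨k1, k2⟩ := LinkAux.key hd (hhom 0) (hhom 1) (hhom 2) na nb nc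
  rw [← hK] at k1 k2
  have hd2 : 2 ≤ d := by
    by_contra hlt
    exact hg4 (k1 d (by omega) _ (hhom 3))
  constructor
  · have ind : ∀ e, d + e ≤ 3 * d - 3 → ∃ h : MvPolynomial (Fin 3) k,
        h.IsHomogeneous e ∧ h * g 3 ∉ Ideal.span {g 0, g 1, g 2} := by
      intro e
      induction e with
      | zero =>
        intro _
        exact ⟨1, isHomogeneous_one _ _, by simpa using hg4⟩
      | succ e ih =>
        intro he
        obtain ⟨h, hh, hn⟩ := ih (by omega)
        obtain ⟨i, hi⟩ := k2 (e + d) (by omega) _ (hh.mul (hhom 3)) hn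
        refine ⟨X i * h, ?_, by rwa [mul_assoc]⟩
        have := (isHomogeneous_X k i).mul hh
        rwa [add_comm] at this
    obtain ⟨h, hh, hn⟩ := ind (2 * d - 3) (by omega)
    exact ⟨h, hh, fun hc => hn ((hmem h).1 hc)⟩
  · intro p hp h hh
    rw [hmem]
    exact k1 (p + d) (by omega) _ (hh.mul (hhom 3))
end

section
/- Let S = k[s,t,u] over an infinite field k and J = (g_1,g_2,g_3,g_4) ⊂ S a homogeneous ideal with all generators of degree d and ht(J) = 3. Then β_1(J) ≤ 2d + 2 and β_2(J) ≤ 2d − 1. -/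
open MvPolynomial

/-- A minimal free resolution `0 → S^{b₂} → S^{b₁} → S^{b₀} → J → 0` of an
ideal `J ⊆ S = k[s,t,u]`; minimality (all entries of the differentials lie in
`m = (s,t,u)`) guarantees `bᵢ = βᵢ(J) = dim_k Torᵢ^S(J,k)`. -/
structure MinFreeRes (k : Type) [Field k] (J : Ideal (S3 k)) where
  b0 : ℕ
  b1 : ℕ
  b2 : ℕ
  ε : (Fin b0 → S3 k) →ₗ[S3 k] S3 k
  d1 : (Fin b1 → S3 k) →ₗ[S3 k] (Fin b0 → S3 k)
  d2 : (Fin b2 → S3 k) →ₗ[S3 k] (Fin b1 → S3 k)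
  range_eps : LinearMap.range ε = J
  exact1 : LinearMap.ker ε = LinearMap.range d1
  exact2 : LinearMap.ker d1 = LinearMap.range d2
  inj2 : LinearMap.ker d2 = ⊥
  min1 : ∀ x i, constantCoeff (d1 x i) = 0
  min2 : ∀ x i, constantCoeff (d2 x i) = 0


lemma aux_exists_left {A : Type*} [CommRing A] [IsDomain A] {μ κ : Type*} [Fintype μ] [Fintype κ]
    [DecidableEq μ] [DecidableEq κ] (D : Matrix μ κ A)
    (hD : ∀ x : κ → A, D.mulVec x = 0 → x = 0) :
    ∃ E : Matrix κ μ A, (E * D).det ≠ 0 := by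
  let K := FractionRing A
  let f := algebraMap A K
  have hf : Function.Injective f := IsFractionRing.injective A K
  have hinj : LinearMap.ker (Matrix.mulVecLin (D.map f)) = ⊥ := by
    rw [LinearMap.ker_eq_bot']
    intro x hx
    obtain ⟨b, hb⟩ := IsLocalization.exist_integer_multiples_of_finite (nonZeroDivisors A) x
    choose y hy using hb
    have hb0 : f b ≠ 0 := by
      simpa using (map_ne_zero_iff f hf).2 (nonZeroDivisors.coe_ne_zero b)
    have hy' : ∀ i, f (y i) = f b * x i := fun i => by
      rw [show f (y i) = _ from hy i, Algebra.smul_def]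
    have : D.mulVec y = 0 := by
      ext i
      apply hf
      have := congrFun hx i
      simp only [Matrix.mulVecLin_apply, Matrix.mulVec, dotProduct, Matrix.map_apply,
        Pi.zero_apply] at this
      simp only [Matrix.mulVec, dotProduct, map_sum, map_mul, hy', Pi.zero_apply, map_zero]
      calc _ = f b * ∑ j, f (D i j) * x j := by
            rw [Finset.mul_sum]; exact Finset.sum_congr rfl fun j _ => by ring
        _ = 0 := by rw [this, mul_zero]
    have h0 := hD y this
    ext i
    have := hy' i
    rw [h0] at this
    simpa [hb0] using this.symm
  obtain ⟨L, hL⟩ := LinearMap.exists_leftInverse_of_injective _ hinj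
  have hB : (LinearMap.toMatrix' L) * D.map f = 1 := by
    have := congrArg LinearMap.toMatrix' hL
    rw [LinearMap.toMatrix'_comp, LinearMap.toMatrix'_id] at this
    rwa [show LinearMap.toMatrix' (D.map f).mulVecLin = D.map f from
      LinearMap.toMatrix'_toLin' _] at this
  set B := LinearMap.toMatrix' L
  obtain ⟨b, hb⟩ := IsLocalization.exist_integer_multiples_of_finite (nonZeroDivisors A)
    (fun ij : κ × μ => B ij.1 ij.2)
  choose E hE using hb
  have hb0 : f b ≠ 0 := by
    simpa using (map_ne_zero_iff f hf).2 (nonZeroDivisors.coe_ne_zero b)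
  let E' : Matrix κ μ A := Matrix.of fun i j => E (i, j)
  have hE' : E'.map f = f b • B := by
    ext i j
    have := hE (i, j)
    rw [Algebra.smul_def] at this
    simpa [E'] using this
  refine ⟨E', fun h => ?_⟩
  have h2 : ((E' * D).map f).det = 0 := by
    rw [← RingHom.mapMatrix_apply, ← RingHom.map_det, h, map_zero]
  rw [Matrix.map_mul, hE', Matrix.smul_mul, hB, Matrix.det_smul, Matrix.det_one, mul_one] at h2
  exact pow_ne_zero _ hb0 h2

lemma aux_prime {R : Type*} [CommRing R] {μ κ : Type*} [Fintype μ] [Fintype κ]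
    [DecidableEq μ] [DecidableEq κ] (D : Matrix μ κ R) (p : R) (hp : Prime p)
    (hD : ∀ x : κ → R, (∀ i, p ∣ D.mulVec x i) → ∀ j, p ∣ x j) :
    ∃ E : Matrix κ μ R, ¬ p ∣ (E * D).det := by
  have : (Ideal.span {p}).IsPrime := (Ideal.span_singleton_prime hp.ne_zero).2 hp
  let q := Ideal.Quotient.mk (Ideal.span {p})
  have hq : ∀ x, q x = 0 ↔ p ∣ x := fun x => by
    rw [Ideal.Quotient.eq_zero_iff_mem, Ideal.mem_span_singleton]
  have hs : Function.Surjective q := Ideal.Quotient.mk_surjective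
  obtain ⟨E, hE⟩ := aux_exists_left (D.map q) (by
    intro x hx
    choose y hy using fun i => hs (x i)
    obtain rfl : x = fun i => q (y i) := funext fun i => (hy i).symm
    ext j
    simp only [Pi.zero_apply]
    rw [hq]
    apply hD
    intro i
    rw [← hq]
    have := congrFun hx i
    simpa [Matrix.mulVec, dotProduct] using this)
  choose F hF using fun i j => hs (E i j)
  refine ⟨Matrix.of F, fun h => hE ?_⟩
  rw [← hq, RingHom.map_det, RingHom.mapMatrix_apply, Matrix.map_mul] at h
  convert h
  ext i j
  simp [hF]

lemma aux_dvd {R : Type*} [CommRing R] [IsDomain R] [UniqueFactorizationMonoid R] {T : Type*}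
    (x : T → R) (hx : ∀ p, Prime p → ∃ t, ¬ p ∣ x t) (a : R) (ha0 : a ≠ 0) : ∀ (b : R)
    (_ : ∀ t, a ∣ b * x t), a ∣ b := by
  induction a using UniqueFactorizationMonoid.induction_on_prime with
  | h₁ => exact absurd rfl ha0
  | h₂ u hu => intro b _; exact hu.dvd
  | h₃ a p ha hp ih =>
    intro b h
    obtain ⟨t, ht⟩ := hx p hp
    obtain ⟨c, rfl⟩ := (hp.dvd_or_dvd ((dvd_mul_right p a).trans (h t))).resolve_right ht
    apply mul_dvd_mul_left
    apply ih ha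
    intro t
    have := h t
    rw [mul_assoc] at this
    exact (mul_dvd_mul_iff_left hp.ne_zero).1 this

lemma aux_det {R : Type*} [CommRing R] {ι κ μ : Type*} [Fintype ι] [Fintype κ] [Fintype μ]
    [DecidableEq ι] [DecidableEq κ] [DecidableEq μ] (e : ι ⊕ κ ≃ μ)
    (D : Matrix ι μ R) (D2 : Matrix μ κ R) (C : Matrix μ ι R) (E : Matrix κ μ R)
    (h : D * D2 = 0) :
    ((Matrix.fromRows D E).submatrix id e).det * ((Matrix.fromCols C D2).submatrix e id).det
      = (D * C).det * (E * D2).det := by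
  rw [← Matrix.det_mul, Matrix.submatrix_mul_equiv, Matrix.fromRows_mul_fromCols, h,
    Matrix.submatrix_id_id, Matrix.det_fromBlocks_zero₁₂]

lemma aux_mem {R : Type*} [CommRing R] (m : Ideal R) {ι κ μ : Type*} [Fintype ι] [Fintype κ]
    [Fintype μ]
    [DecidableEq ι] [DecidableEq κ] [DecidableEq μ] (e : ι ⊕ κ ≃ μ)
    (D2 : Matrix μ κ R) (C : Matrix μ ι R) (h : ∀ i j, D2 i j ∈ m) :
    ((Matrix.fromCols C D2).submatrix e id).det ∈ m ^ (Fintype.card κ) := by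
  rw [Matrix.det_apply]
  refine Ideal.sum_mem _ fun σ _ => ?_
  rw [Units.smul_def, zsmul_eq_mul]
  apply Ideal.mul_mem_left
  rw [Fintype.prod_sum_type]
  apply Ideal.mul_mem_left
  have := Ideal.prod_mem_prod (s := (Finset.univ : Finset κ)) (I := fun _ => m)
    (x := fun x => D2 (e (σ (Sum.inr x))) x) (fun i _ => h _ _)
  simpa using this

lemma aux_finrank (k : Type) [Field k] (n : ℕ) :
    Module.finrank k (homogeneousSubmodule (Fin 3) k n) = (n + 2) * (n + 1) / 2 := by
  have e := AddMonoidAlgebra.supportedEquivFinsupp (R := k) (S := k)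
    {d : Fin 3 →₀ ℕ | d.degree = n}
  rw [homogeneousSubmodule_eq_finsupp_supported]
  have hset : {d : Fin 3 →₀ ℕ | d.degree = n}
      = ((Finset.univ : Finset (Fin 3)).finsuppAntidiag n : Set (Fin 3 →₀ ℕ)) := by
    ext x
    simp [Finset.mem_finsuppAntidiag, Finsupp.degree_eq_sum]
  refine e.finrank_eq.trans ?_
  rw [hset, Module.finrank_finsupp_self]
  simp only [Finset.coe_sort_coe, Fintype.card_coe]
  rw [Finset.card_finsuppAntidiag_nat_eq_choose]
  have : (Finset.univ : Finset (Fin 3)).card + n - 1 = n + 2 := by simp; omega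
  rw [this, Nat.choose_symm_add, Nat.choose_two_right]
  simp

lemma aux_syz (k : Type) [Field k] (d : ℕ) (hd : 1 ≤ d)
    (g : Fin 4 → MvPolynomial (Fin 3) k)
    (hhom : ∀ i, (g i).IsHomogeneous d) :
    ∃ a : Fin 4 → MvPolynomial (Fin 3) k, a ≠ 0 ∧ (∀ i, (a i).IsHomogeneous (d - 1)) ∧
      ∑ i, a i * g i = 0 := by
  let V := homogeneousSubmodule (Fin 3) k (d - 1)
  let U := homogeneousSubmodule (Fin 3) k (2 * d - 1)
  have : FiniteDimensional k V := Module.Finite.iff_fg.2 (homogeneousSubmodule_fg _ _ _)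
  have : FiniteDimensional k U := Module.Finite.iff_fg.2 (homogeneousSubmodule_fg _ _ _)
  let f0 : (Fin 4 → V) →ₗ[k] MvPolynomial (Fin 3) k :=
    ∑ i, (LinearMap.mulRight k (g i)) ∘ₗ V.subtype ∘ₗ LinearMap.proj i
  have hf0 : ∀ a, f0 a = ∑ i, (a i : MvPolynomial (Fin 3) k) * g i := fun a => by
    simp [f0]
  let f : (Fin 4 → V) →ₗ[k] U := f0.codRestrict U (fun a => by
    rw [hf0]
    refine Submodule.sum_mem _ fun i _ => ?_
    have := IsHomogeneous.mul (a i).2 (hhom i)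
    rwa [show d - 1 + d = 2 * d - 1 by omega] at this)
  have hlt : Module.finrank k U < Module.finrank k (Fin 4 → V) := by
    rw [Module.finrank_pi_fintype]
    simp only [V, U, aux_finrank]
    obtain ⟨c, rfl⟩ : ∃ c, d = c + 1 := ⟨d - 1, by omega⟩
    simp only [Finset.sum_const, Finset.card_univ, Fintype.card_fin, smul_eq_mul]
    have h1 : 2 * (c + 1) - 1 = 2 * c + 1 := by omega
    have h3 : (c + 1 - 1 + 2) * (c + 1 - 1 + 1) = (c+1)*((c+1)+1) := by simp; ring
    obtain ⟨r, hr⟩ := Nat.even_mul_succ_self (c+1)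
    rw [h1, h3, hr, show (2*c+1+2)*(2*c+1+1) = ((2*c+3)*(c+1))*2 by ring]
    rw [Nat.mul_div_cancel _ (by norm_num), show r + r = r * 2 by ring,
      Nat.mul_div_cancel _ (by norm_num)]
    nlinarith
  obtain ⟨a, ha, ha0⟩ := (Submodule.ne_bot_iff _).1 (LinearMap.ker_ne_bot_of_finrank_lt (f := f) hlt)
  refine ⟨fun i => a i, fun h => ha0 ?_, fun i => (a i).2, ?_⟩
  · ext i : 2
    exact congrFun h i
  · rw [← hf0]
    exact congrArg Subtype.val (LinearMap.mem_ker.1 ha)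

lemma core_matrix {R : Type*} [CommRing R] [IsDomain R] [UniqueFactorizationMonoid R]
    {n0 n1 n2 : Type*} [Fintype n0] [Fintype n1] [Fintype n2]
    [DecidableEq n0] [DecidableEq n1] [DecidableEq n2]
    (ε : n0 → R) (M1 : Matrix n0 n1 R) (M2 : Matrix n1 n2 R)
    (hex1 : ∀ x, ε ⬝ᵥ x = 0 → ∃ c, M1.mulVec c = x)
    (hM : M1 * M2 = 0)
    (hex2 : ∀ y, M1.mulVec y = 0 → ∃ z, M2.mulVec z = y)
    (hinj : ∀ x, M2.mulVec x = 0 → x = 0)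
    (g : Fin 4 → R) (hg : ∀ p, Prime p → ∃ i, ¬ p ∣ g i)
    (V : Matrix n0 (Fin 4) R) (W : Matrix (Fin 4) n0 R)
    (hV : Matrix.vecMul ε V = g) (hW : Matrix.vecMul g W = ε)
    (m : Ideal R) (hm : ∀ i j, M2 i j ∈ m)
    (a : Fin 4 → R) (ha : ∑ i, a i * g i = 0) (hg0 : g 0 ≠ 0) (ha1 : a 1 ≠ 0)
    (hcard : Fintype.card n0 + 3 + Fintype.card n2 = Fintype.card n1 + 4) :
    a 1 * g 0 ∈ m ^ Fintype.card n2 := by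
  let s : Matrix (Fin 4) (Fin 3) R := !![a 0, -g 2, -g 3; a 1, 0, 0; a 2, g 0, 0; a 3, 0, g 0]
  rw [Fin.sum_univ_four] at ha
  have hs : Matrix.vecMul g s = 0 := by
    ext j
    fin_cases j <;> simp [s, Matrix.vecMul, dotProduct, Fin.sum_univ_four]
    · linear_combination ha
    · ring
    · ring
  let Y : Matrix n0 (n0 ⊕ Fin 3) R := Matrix.fromCols (1 - V * W) (V * s)
  have hY : Matrix.vecMul ε Y = 0 := by
    simp only [Y, Matrix.vecMul_fromCols, Matrix.vecMul_sub, Matrix.vecMul_one,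
      ← Matrix.vecMul_vecMul, hV, hW, hs]
    ext (j | j) <;> simp
  have hC : ∀ t, ∃ c, M1.mulVec c = fun j => Y j t := fun t => hex1 _ (congrFun hY t)
  choose c hc using hC
  let C1 : Matrix n1 (n0 ⊕ Fin 3) R := Matrix.of fun i t => c t i
  have hC1 : M1 * C1 = Y := by
    ext i t
    exact congrFun (hc t) i
  let C : Matrix (n1 ⊕ Fin 4) (n0 ⊕ Fin 3) R :=
    Matrix.fromRows C1 (Matrix.fromCols (-W) s)
  let D2 : Matrix (n1 ⊕ Fin 4) n2 R := Matrix.fromRows M2 0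
  let D : Matrix (Fin 3) (Fin 4) R → Matrix (n0 ⊕ Fin 3) (n1 ⊕ Fin 4) R := fun P =>
    Matrix.fromBlocks M1 (-V) 0 P
  have hDD : ∀ P, D P * D2 = 0 := fun P => by
    simp [D, D2, Matrix.fromBlocks_mul_fromRows, hM]
  have hDC : ∀ P, (D P * C).det = (P * s).det := fun P => by
    have : D P * C = Matrix.fromBlocks 1 0 (-(P * W)) (P * s) := by
      simp only [D, C, Matrix.fromBlocks_mul_fromRows, hC1, Y, Matrix.mul_fromCols]
      ext (i | i) (j | j) <;> simp
    rw [this, Matrix.det_fromBlocks_zero₁₂, Matrix.det_one, one_mul]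
  obtain ⟨e⟩ : Nonempty ((n0 ⊕ Fin 3) ⊕ n2 ≃ n1 ⊕ Fin 4) := by
    rw [← Fintype.card_eq]
    simpa using hcard
  set Δ := ((Matrix.fromCols C D2).submatrix e id).det with hΔ
  have hdvd : ∀ (P : Matrix (Fin 3) (Fin 4) R) (E : Matrix n2 (n1 ⊕ Fin 4) R), Δ ∣ (P * s).det * (E * D2).det := fun P E => by
    rw [← hDC, ← aux_det e (D P) D2 C E (hDD P)]
    exact dvd_mul_left _ _
  have hP : ∀ i, ∃ P : Matrix (Fin 3) (Fin 4) R, (P * s).det = a 1 * g 0 * g i := by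
    intro i
    fin_cases i
    · refine ⟨!![0,1,0,0;0,0,1,0;0,0,0,1], ?_⟩
      simp [s, Matrix.det_fin_three, Matrix.mul_apply, Fin.sum_univ_four]
    · refine ⟨!![-1,0,0,0;0,0,1,0;0,0,0,1], ?_⟩
      simp [s, Matrix.det_fin_three, Matrix.mul_apply, Fin.sum_univ_four]
      linear_combination (-g 0) * ha
    · refine ⟨!![1,0,0,0;0,1,0,0;0,0,0,1], ?_⟩
      simp [s, Matrix.det_fin_three, Matrix.mul_apply, Fin.sum_univ_four]
      ring
    · refine ⟨!![-1,0,0,0;0,1,0,0;0,0,1,0], ?_⟩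
      simp [s, Matrix.det_fin_three, Matrix.mul_apply, Fin.sum_univ_four]
      ring
  have hΔ0 : Δ ≠ 0 := by
    intro h0
    obtain ⟨E, hE⟩ := aux_exists_left D2 (fun x hx => hinj x (by
      ext i
      simpa [D2, Matrix.fromRows_mulVec] using congrFun hx (Sum.inl i)))
    obtain ⟨P, hP⟩ := hP 0
    have := hdvd P E
    rw [h0, zero_dvd_iff, hP] at this
    exact mul_ne_zero (mul_ne_zero (mul_ne_zero ha1 hg0) hg0) hE this
  have h1 : ∀ P : Matrix (Fin 3) (Fin 4) R, Δ ∣ (P * s).det := fun P => by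
    refine aux_dvd (fun E : Matrix n2 (n1 ⊕ Fin 4) R => (E * D2).det) ?_ Δ hΔ0 _ (hdvd P)
    intro p hp
    apply aux_prime D2 p hp
    intro x hx j
    have hx' : ∀ i, p ∣ M2.mulVec x i := fun i => by
      simpa [D2, Matrix.fromRows_mulVec] using hx (Sum.inl i)
    choose y hy using hx'
    have hy' : M2.mulVec x = p • y := by ext i; simp [hy]
    have h0 : p • M1.mulVec y = 0 := by
      rw [← Matrix.mulVec_smul, ← hy', Matrix.mulVec_mulVec, hM, Matrix.zero_mulVec]
    obtain ⟨z, hz⟩ := hex2 y ((smul_eq_zero.1 h0).resolve_left hp.ne_zero)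
    have := hinj (x - p • z) (by
      rw [Matrix.mulVec_sub, Matrix.mulVec_smul, hz, hy', sub_self])
    rw [sub_eq_zero] at this
    rw [this]
    exact ⟨z j, rfl⟩
  have h2 : Δ ∣ a 1 * g 0 := by
    refine aux_dvd g hg Δ hΔ0 _ fun i => ?_
    obtain ⟨P, hP⟩ := hP i
    rw [← hP]
    exact h1 P
  refine Ideal.mem_of_dvd _ h2 (aux_mem m e D2 C ?_)
  rintro (i | i) j
  · exact hm i j
  · simp [D2]

lemma aux_rn {R M N : Type} [CommRing R] [IsDomain R] [AddCommGroup M] [Module R M]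
    [AddCommGroup N] [Module R N] [Module.Finite R M] (f : M →ₗ[R] N) :
    Module.finrank R (LinearMap.range f) + Module.finrank R (LinearMap.ker f)
      = Module.finrank R M := by
  rw [← f.quotKerEquivRange.finrank_eq, Submodule.finrank_quotient_add_finrank]

lemma core_rank (k : Type) [Field k] (J : Ideal (S3 k)) (hJ : J ≠ ⊥) (res : MinFreeRes k J) :
    res.b0 + res.b2 = res.b1 + 1 := by
  have h0 := aux_rn res.ε
  have h1 := aux_rn res.d1
  have h2 := aux_rn res.d2
  rw [res.exact1] at h0
  rw [res.exact2] at h1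
  rw [res.inj2, finrank_bot] at h2
  have hr : Module.finrank (S3 k) (LinearMap.range res.ε) = 1 := by
    have hne : Nontrivial (LinearMap.range res.ε) := by
      rw [Submodule.nontrivial_iff_ne_bot, res.range_eps]
      exact hJ
    have hle := Submodule.finrank_le (LinearMap.range res.ε)
    rw [Module.finrank_self] at hle
    have : 0 < Module.finrank (S3 k) (LinearMap.range res.ε) := Module.finrank_pos
    omega
  rw [hr] at h0
  simp only [Module.finrank_fin_fun] at h0 h1 h2
  omega

lemma eps_dot (k : Type) [Field k] (J : Ideal (S3 k)) (res : MinFreeRes k J)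
    (x : Fin res.b0 → S3 k) :
    (fun j => res.ε (Pi.single j 1)) ⬝ᵥ x = res.ε x := by
  conv_rhs => rw [← Finset.univ_sum_single x]
  rw [map_sum]
  refine Finset.sum_congr rfl fun j _ => ?_
  have : (Pi.single j (x j) : Fin res.b0 → S3 k) = x j • Pi.single j 1 := by
    rw [← Pi.single_smul]; simp
  rw [this, map_smul, smul_eq_mul, mul_comm]

lemma core_vw (k : Type) [Field k] (J : Ideal (S3 k)) (res : MinFreeRes k J)
    (g : Fin 4 → S3 k) (hJ : J = Ideal.span (Set.range g)) :
    ∃ (V : Matrix (Fin res.b0) (Fin 4) (S3 k)) (W : Matrix (Fin 4) (Fin res.b0) (S3 k)),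
      Matrix.vecMul (fun j => res.ε (Pi.single j 1)) V = g ∧
      Matrix.vecMul g W = (fun j => res.ε (Pi.single j 1)) := by
  have h1 : ∀ i, ∃ v, res.ε v = g i := fun i => by
    have : g i ∈ LinearMap.range res.ε := by
      rw [res.range_eps, hJ]
      exact Ideal.subset_span ⟨i, rfl⟩
    exact this
  have h2 : ∀ j, ∃ c : Fin 4 → S3 k, ∑ i, c i * g i = res.ε (Pi.single j 1) := fun j => by
    have : res.ε (Pi.single j 1) ∈ LinearMap.range res.ε := ⟨_, rfl⟩
    rw [res.range_eps] at this
    have := hJ.le this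
    exact Ideal.mem_span_range_iff_exists_fun.1 this
  choose v hv using h1
  choose w hw using h2
  refine ⟨Matrix.of fun j i => v i j, Matrix.of fun i j => w j i, ?_, ?_⟩
  · ext1 i
    rw [← hv i, ← eps_dot]
    rfl
  · ext1 j
    rw [← hw j]
    simp [Matrix.vecMul, dotProduct, mul_comm]

lemma core_b0 (k : Type) [Field k] (J : Ideal (S3 k)) (res : MinFreeRes k J)
    (g : Fin 4 → S3 k) (hJ : J = Ideal.span (Set.range g)) : res.b0 ≤ 4 := by
  obtain ⟨V, W, hV, hW⟩ := core_vw k J res g hJ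
  have h : (V.map constantCoeff) * (W.map constantCoeff) = 1 := by
    rw [← Matrix.map_mul]
    have hz : Matrix.vecMul (fun j => res.ε (Pi.single j 1)) (1 - V * W) = 0 := by
      rw [Matrix.vecMul_sub, Matrix.vecMul_one, ← Matrix.vecMul_vecMul, hV, hW, sub_self]
    ext i j
    have h1 : (fun i => (1 - V * W : Matrix (Fin res.b0) (Fin res.b0) (S3 k)) i j) ∈ LinearMap.ker res.ε := by
      rw [LinearMap.mem_ker, ← eps_dot]
      exact congrFun hz j
    rw [res.exact1] at h1
    obtain ⟨c, hc⟩ := h1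
    have h2 := res.min1 c i
    rw [hc] at h2
    simp only [Matrix.sub_apply, map_sub, sub_eq_zero] at h2
    rw [Matrix.map_apply, ← h2]
    simp [Matrix.one_apply, apply_ite]
  have hr : (1 : Matrix (Fin res.b0) (Fin res.b0) k).rank ≤ 4 := by
    rw [← h]
    refine (Matrix.rank_mul_le_left _ _).trans ?_
    simpa using Matrix.rank_le_width (V.map constantCoeff)
  simpa using hr

lemma core_perm (k : Type) [Field k] (d : ℕ) (hd : 1 ≤ d) (J : Ideal (S3 k))
    (res : MinFreeRes k J) (g : Fin 4 → S3 k) (hJ : J = Ideal.span (Set.range g))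
    (hhom : ∀ i, (g i).IsHomogeneous d)
    (hg : ∀ p, Prime p → ∃ i, ¬ p ∣ g i)
    (a : Fin 4 → S3 k) (hah : ∀ i, (a i).IsHomogeneous (d - 1))
    (ha : ∑ i, a i * g i = 0) (hg0 : g 0 ≠ 0) (ha1 : a 1 ≠ 0) : res.b2 ≤ 2 * d - 1 := by
  have hJ0 : J ≠ ⊥ := by
    rintro rfl
    apply hg0
    have : g 0 ∈ Ideal.span (Set.range g) := Ideal.subset_span ⟨0, rfl⟩
    rw [← hJ] at this
    exact this
  have hrank := core_rank k J hJ0 res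
  obtain ⟨V, W, hV, hW⟩ := core_vw k J res g hJ
  have hm1 : ∀ c, (LinearMap.toMatrix' res.d1).mulVec c = res.d1 c := fun c =>
    LinearMap.toMatrix'_mulVec _ _
  have hm2 : ∀ c, (LinearMap.toMatrix' res.d2).mulVec c = res.d2 c := fun c =>
    LinearMap.toMatrix'_mulVec _ _
  have key := core_matrix (fun j => res.ε (Pi.single j 1)) (LinearMap.toMatrix' res.d1)
    (LinearMap.toMatrix' res.d2) (by
      intro x hx
      rw [eps_dot, ← LinearMap.mem_ker, res.exact1] at hx
      obtain ⟨c, hc⟩ := hx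
      exact ⟨c, by rw [hm1, hc]⟩) (by
      rw [← LinearMap.toMatrix'_comp]
      have : res.d1 ∘ₗ res.d2 = 0 := by
        apply LinearMap.ext
        intro y
        have : res.d2 y ∈ LinearMap.ker res.d1 := by
          rw [res.exact2]; exact ⟨_, rfl⟩
        exact this
      rw [this, map_zero]) (by
      intro y hy
      rw [hm1, ← LinearMap.mem_ker, res.exact2] at hy
      obtain ⟨z, hz⟩ := hy
      exact ⟨z, by rw [hm2, hz]⟩) (by
      intro x hx
      rw [hm2, ← LinearMap.mem_ker, res.inj2] at hx
      exact hx) g hg V W hV hW (idealOfVars (Fin 3) k) (by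
      intro i j
      rw [← pow_one (idealOfVars (Fin 3) k), mem_pow_idealOfVars_iff']
      intro x hx
      have : x = 0 := by
        rw [← Finsupp.degree_eq_zero_iff]; omega
      rw [this, LinearMap.toMatrix'_apply]
      exact res.min2 _ _) a ha hg0 ha1 (by simp; omega)
  rw [mem_pow_idealOfVars_iff, Fintype.card_fin] at key
  have hne : a 1 * g 0 ≠ 0 := mul_ne_zero ha1 hg0
  obtain ⟨x, hx⟩ := (support_nonempty.2 hne)
  have h1 := key x hx
  have h2 := (hah 1).mul (hhom 0) (mem_support_iff.1 hx)
  have h3 : x.degree = Finsupp.weight 1 x := DFunLike.congr_fun Finsupp.degree_eq_weight_one x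
  rw [← h3] at h2
  omega

lemma main_aux
    (k : Type) [Field k] (d : ℕ)
    (g : Fin 4 → S3 k)
    (hhom : ∀ i, (g i).IsHomogeneous d) (J : Ideal (S3 k)) (hJ : J = Ideal.span (Set.range g))
    (hht : idealHeight J = 3)
    (res : MinFreeRes k J) :
    res.b1 ≤ 2 * d + 2 ∧ res.b2 ≤ 2 * d - 1 := by
  classical
  have hg : ∀ p, Prime p → ∃ i, ¬ p ∣ g i := by
    intro p hp
    by_contra! hc
    have hpr : (Ideal.span {p}).IsPrime := (Ideal.span_singleton_prime hp.ne_zero).2 hp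
    have hle : J ≤ Ideal.span {p} := by
      rw [hJ, Ideal.span_le]
      rintro _ ⟨i, rfl⟩
      exact Ideal.mem_span_singleton.2 (hc i)
    have h1 : (Ideal.span {p}).height ≤ 1 :=
      Ideal.height_le_one_of_isPrincipal_of_mem_minimalPrimes (Ideal.span {p}) _
        (by simp [Ideal.minimalPrimes_eq_subsingleton_self])
    have h2 : idealHeight J ≤ Order.height (⟨Ideal.span {p}, hpr⟩ : PrimeSpectrum (S3 k)) :=
      sInf_le ⟨⟨Ideal.span {p}, hpr⟩, hle, rfl⟩
    rw [← PrimeSpectrum.height_eq_orderHeight, hht] at h2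
    have := h2.trans h1
    exact absurd this (by decide)
  obtain ⟨p, hp⟩ := hg (X 0) X_prime
  have hp0 : g p ≠ 0 := fun h => hp (h ▸ dvd_zero _)
  have hd : 1 ≤ d := by
    by_contra hd
    obtain rfl : d = 0 := by omega
    have hu : IsUnit (g p) := by
      have := (totalDegree_zero_iff_isHomogeneous _).2 (hhom p)
      rw [totalDegree_eq_zero_iff_eq_C] at this
      rw [this] at hp0 ⊢
      exact (IsUnit.mk0 _ (fun h => hp0 (by rw [h, C_0]))).map C
    have hT : J = ⊤ := Ideal.eq_top_of_isUnit_mem _ (hJ.ge (Ideal.subset_span ⟨p, rfl⟩)) hu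
    have : idealHeight J = ⊤ := by
      rw [idealHeight, sInf_eq_top]
      rintro h ⟨q, hq, -⟩
      exact absurd (top_le_iff.1 (hT ▸ hq)) q.2.ne_top
    rw [this] at hht
    exact absurd hht (by decide)
  obtain ⟨a, ha0, hah, ha⟩ := aux_syz k d hd g hhom
  obtain ⟨j, hjp, hj⟩ : ∃ j, j ≠ p ∧ a j ≠ 0 := by
    by_contra! hc
    rw [Finset.sum_eq_single p (fun i _ hi => by rw [hc i hi, zero_mul]) (by simp)] at ha
    have hap := (mul_eq_zero.1 ha).resolve_right hp0
    apply ha0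
    ext1 i
    by_cases hi : i = p
    · rw [hi, hap]; rfl
    · exact hc i hi
  obtain ⟨σ, h0, h1⟩ : ∃ σ : Equiv.Perm (Fin 4), σ 0 = p ∧ σ 1 = j := by
    revert hjp
    clear * -
    revert p j
    decide
  have hb2 := core_perm k d hd J res (g ∘ σ)
    (by rw [hJ, Set.range_comp, σ.surjective.range_eq, Set.image_univ])
    (fun i => hhom _) (fun q hq => by
      obtain ⟨i, hi⟩ := hg q hq
      exact ⟨σ.symm i, by simpa using hi⟩) (a ∘ σ) (fun i => hah _)
    (by simpa using (Equiv.sum_comp σ (fun i => a i * g i)).trans ha)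
    (by simpa [h0] using hp0) (by simpa [h1] using hj)
  have hb0 := core_b0 k J res g hJ
  have hJ0 : J ≠ ⊥ := by
    intro h
    apply hp0
    have : g p ∈ J := hJ.ge (Ideal.subset_span ⟨p, rfl⟩)
    rw [h] at this
    exact this
  have := core_rank k J hJ0 res
  omega

/-- Let `S = k[s,t,u]` over an infinite field `k` and
`J = (g₁,g₂,g₃,g₄) ⊆ S` a homogeneous ideal with all generators of degree `d`
and `ht(J) = 3`.  Then `β₁(J) ≤ 2d + 2` and `β₂(J) ≤ 2d − 1`. -/
theorem betti_bounds_of_height_three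
    (k : Type) [Field k] [Infinite k] (d : ℕ)
    (g : Fin 4 → S3 k)
    (hhom : ∀ i, (g i).IsHomogeneous d)
    (hht : idealHeight (Ideal.span (Set.range g)) = 3)
    (res : MinFreeRes k (Ideal.span (Set.range g))) :
    res.b1 ≤ 2 * d + 2 ∧ res.b2 ≤ 2 * d - 1 := by
  exact main_aux k d g hhom _ rfl hht res
end
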